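/- Fix integers g ≥ 0 and m, n ≥ 1 with m + n ≥ 3. For every chamber datum ε there exists a polynomial P ∈ ℚ[x₁,…,x_m,y₁,…,y_n] of total degree at most 4g − 3 + m + n such that for every pair (μ,ν) ∈ C_ε of compositions of an integer d of lengths m and n, the number of bi-pruned factorisations satisfies |F^bi(g,μ,ν)| = d! · P(μ₁,…,μ_m,ν₁,…,ν_n). (Equivalently: the bi-pruned double Hurwitz number Ph_g(μ,ν) = |F^bi(g,μ,ν)|/d! is, on each chamber, a polynomial in the parts of μ and ν of degree at most 4g−3+m+n.) -/

import Mathlib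

open Equiv

/-- `L` is a `μ`-labeling of the permutation `σ` of `{1,…,d}`. -/
def IsLabeling (d m : ℕ) (μ : Fin m → ℕ) (σ : Equiv.Perm (Fin d)) (L : Fin d → Fin m) : Prop :=
  (∀ x, L (σ x) = L x) ∧
  (∀ i, (Finset.univ.filter fun x => L x = i).card = μ i) ∧
  (∀ (i : Fin m) (x y : Fin d), L x = i → L y = i → ∃ k : ℤ, (σ ^ k) x = y)

/-- The subgroup generated by `S` acts transitively on `{1,…,d}`. -/
def IsTransitiveOn (d : ℕ) (S : Set (Equiv.Perm (Fin d))) : Prop :=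
  ∀ x y : Fin d, ∃ g ∈ Subgroup.closure S, g x = y

/-- A tuple `(σ₁, L₁, (τ₁,…,τ_b), σ₂, L₂)`. -/
abbrev FactTuple (d m n b : ℕ) :=
  Equiv.Perm (Fin d) × (Fin d → Fin m) × (Fin b → Equiv.Perm (Fin d)) ×
    Equiv.Perm (Fin d) × (Fin d → Fin n)

/-- A factorisation of type `(g,μ,ν)`. -/
def IsFactorisation (d m n b : ℕ) (μ : Fin m → ℕ) (ν : Fin n → ℕ)
    (F : FactTuple d m n b) : Prop :=
  IsLabeling d m μ F.1 F.2.1 ∧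
  IsLabeling d n ν F.2.2.2.1 F.2.2.2.2 ∧
  (∀ i, (F.2.2.1 i).IsSwap) ∧
  IsTransitiveOn d ({F.1, F.2.2.2.1} ∪ Set.range F.2.2.1) ∧
  ((List.ofFn F.2.2.1).reverse).prod * F.1 = F.2.2.2.1

/-- `η_i = τ_i ⋯ τ₁ · σ₁` (with `η₀ = σ₁`), where `τ` is indexed from `0`. -/
def eta (d b : ℕ) (σ₁ : Equiv.Perm (Fin d)) (τ : Fin b → Equiv.Perm (Fin d)) (i : ℕ) :
    Equiv.Perm (Fin d) :=
  (((List.ofFn τ).take i).reverse).prod * σ₁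

/-- `π_i = η_{i-1}⁻¹ · η_i` (0-indexed: `π i = (η i)⁻¹ · η (i+1)`). -/
def invertTau (d b : ℕ) (σ₁ : Equiv.Perm (Fin d)) (τ : Fin b → Equiv.Perm (Fin d)) :
    Fin b → Equiv.Perm (Fin d) :=
  fun i => (eta d b σ₁ τ i)⁻¹ * eta d b σ₁ τ (i + 1)

/-- A bi-pruned factorisation: a factorisation such that every fiber of `L₁` is moved
by at least two of the `τ_j`, and every fiber of `L₂` is moved by at least two of the
`π_j = η_{j-1}⁻¹ · η_j`. -/
def IsBiPrunedFactorisation (d m n b : ℕ) (μ : Fin m → ℕ) (ν : Fin n → ℕ)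
    (F : FactTuple d m n b) : Prop :=
  IsFactorisation d m n b μ ν F ∧
  (∀ i : Fin m, ∃ j k : Fin b, j ≠ k ∧
    (∃ x : Fin d, F.2.1 x = i ∧ F.2.2.1 j x ≠ x) ∧
    (∃ x : Fin d, F.2.1 x = i ∧ F.2.2.1 k x ≠ x)) ∧
  (∀ i : Fin n, ∃ j k : Fin b, j ≠ k ∧
    (∃ x : Fin d, F.2.2.2.2 x = i ∧ invertTau d b F.1 F.2.2.1 j x ≠ x) ∧
    (∃ x : Fin d, F.2.2.2.2 x = i ∧ invertTau d b F.1 F.2.2.1 k x ≠ x))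

/-- A pair `(I,J)` of subsets of `{1,…,m}` and `{1,…,n}` is proper if it is neither
`(∅,∅)` nor `({1,…,m},{1,…,n})`. -/
def ProperPair (m n : ℕ) (I : Finset (Fin m)) (J : Finset (Fin n)) : Prop :=
  ¬(I = ∅ ∧ J = ∅) ∧ ¬(I = Finset.univ ∧ J = Finset.univ)

namespace Fermion

/-- The one-body operator with shift `k` and weight `w` on functions of `N` integer positions. -/
def oneBody {N : ℕ} (k : ℤ) (w : ℤ → ℚ) (F : (Fin N → ℤ) → ℚ) : (Fin N → ℤ) → ℚ :=
  fun v => ∑ i, w (v i) * F (Function.update v i (v i + k))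

/-- The filled sea of positions `-N, …, -1`. -/
def sea (N : ℕ) : Fin N → ℤ := fun b => (b : ℤ) - N

/-- The vacuum: the alternating indicator function of the filled sea. -/
def vac (N : ℕ) : (Fin N → ℤ) → ℚ :=
  fun v => (Matrix.of fun a b : Fin N => if v a = sea N b then (1 : ℚ) else 0).det

/-- Antisymmetry under exchange of two positions. -/
def IsAlt {N : ℕ} (F : (Fin N → ℤ) → ℚ) : Prop :=
  ∀ (v : Fin N → ℤ) (i j : Fin N), i ≠ j → F (v ∘ Equiv.swap i j) = -F v

/-- Vanishing as soon as some position lies below the sea. -/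
def IsSupp {N : ℕ} (F : (Fin N → ℤ) → ℚ) : Prop :=
  ∀ (v : Fin N → ℤ) (i : Fin N), v i < -N → F v = 0

variable {N : ℕ}

theorem oneBody_add (k : ℤ) (w : ℤ → ℚ) (F G : (Fin N → ℤ) → ℚ) :
    oneBody k w (F + G) = oneBody k w F + oneBody k w G := by
  funext v
  simp [oneBody, mul_add, Finset.sum_add_distrib]

theorem oneBody_zero (k : ℤ) (w : ℤ → ℚ) : oneBody k w (0 : (Fin N → ℤ) → ℚ) = 0 := by
  funext v
  simp [oneBody]

theorem oneBody_smul (k : ℤ) (w : ℤ → ℚ) (c : ℚ) (F : (Fin N → ℤ) → ℚ) :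
    oneBody k w (c • F) = c • oneBody k w F := by
  funext v
  simp only [oneBody, Pi.smul_apply, smul_eq_mul, Finset.mul_sum]
  exact Finset.sum_congr rfl fun i _ => by ring

theorem oneBody_list_sum (k : ℤ) (w : ℤ → ℚ) (l : List ((Fin N → ℤ) → ℚ)) :
    oneBody k w l.sum = (l.map (oneBody k w)).sum := by
  induction l with
  | nil => simp [oneBody_zero]
  | cons a l ih => simp [oneBody_add, ih]

theorem sum_sum_diag_sub {α : Type*} [Fintype α] [DecidableEq α] (f g : α → α → ℚ)
    (h : ∀ i j, i ≠ j → f i j = g j i) :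
    ∑ i, ∑ j, f i j - ∑ i, ∑ j, g i j = ∑ i, (f i i - g i i) := by
  rw [Finset.sum_comm (f := g), ← Finset.sum_sub_distrib]
  refine Finset.sum_congr rfl fun i _ => ?_
  rw [← Finset.sum_sub_distrib]
  refine Finset.sum_eq_single i (fun j _ hj => ?_) (by simp)
  rw [h i j (Ne.symm hj), sub_self]

/-- The weight of the commutator of two one-body operators. -/
def commWeight (k : ℤ) (w : ℤ → ℚ) (l : ℤ) (w' : ℤ → ℚ) : ℤ → ℚ :=
  fun j => w j * w' (j + k) - w' j * w (j + l)

theorem oneBody_comm (k l : ℤ) (w w' : ℤ → ℚ) (F : (Fin N → ℤ) → ℚ) :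
    oneBody k w (oneBody l w' F) =
      oneBody l w' (oneBody k w F) + oneBody (k + l) (commWeight k w l w') F := by
  funext v
  rw [Pi.add_apply, ← sub_eq_iff_eq_add']
  simp only [oneBody, Finset.mul_sum]
  rw [sum_sum_diag_sub]
  · refine Finset.sum_congr rfl fun i _ => ?_
    simp only [Function.update_self, Function.update_idem, commWeight]
    rw [show v i + l + k = v i + (k + l) by ring, show v i + k + l = v i + (k + l) by ring]
    ring
  · intro i j hij
    rw [Function.update_of_ne hij.symm, Function.update_of_ne hij,
      Function.update_comm hij]
    ring

theorem IsAlt.eq_zero {F : (Fin N → ℤ) → ℚ} (hF : IsAlt F) {v : Fin N → ℤ} {i j : Fin N}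
    (hij : i ≠ j) (h : v i = v j) : F v = 0 := by
  have h1 := hF v i j hij
  have h2 : v ∘ Equiv.swap i j = v := by
    funext a
    simp only [Function.comp_apply, Equiv.swap_apply_def]
    split_ifs with h3 h4
    · rw [h3, h]
    · rw [h4, h]
    · rfl
  rw [h2] at h1
  linarith

theorem IsAlt.oneBody {F : (Fin N → ℤ) → ℚ} (hF : IsAlt F) (k : ℤ) (w : ℤ → ℚ) :
    IsAlt (oneBody k w F) := by
  intro v i j hij
  simp only [Fermion.oneBody]
  rw [← Equiv.sum_comp (Equiv.swap i j), ← Finset.sum_neg_distrib]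
  refine Finset.sum_congr rfl fun a _ => ?_
  simp only [Function.comp_apply, Equiv.swap_apply_self]
  rw [← mul_neg, ← hF _ i j hij]
  congr 2
  funext b
  simp only [Function.update_apply, Function.comp_apply]
  by_cases hb : b = Equiv.swap i j a
  · subst hb
    simp
  · have : Equiv.swap i j b ≠ a := fun h => hb (by rw [← h, Equiv.swap_apply_self])
    rw [if_neg hb, if_neg this]

theorem IsSupp.oneBody {F : (Fin N → ℤ) → ℚ} (hF : IsSupp F) (k : ℤ) {w : ℤ → ℚ}
    (hw : ∀ j : ℤ, j < -N → w j = 0) : IsSupp (oneBody k w F) := by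
  intro v i hi
  refine Finset.sum_eq_zero fun a _ => ?_
  by_cases h : i = a
  · subst h
    rw [hw _ hi, zero_mul]
  · rw [hF _ i, mul_zero]
    rwa [Function.update_of_ne h]

theorem vac_alt (N : ℕ) : IsAlt (vac N) := by
  intro v i j hij
  have := Matrix.det_permute (Equiv.swap i j)
    (Matrix.of fun a b : Fin N => if v a = sea N b then (1 : ℚ) else 0)
  rw [Equiv.Perm.sign_swap hij] at this
  simpa [vac, Matrix.submatrix] using this

theorem exists_sea_of_vac_ne_zero {v : Fin N → ℤ} (h : vac N v ≠ 0) (a : Fin N) :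
    ∃ b, v a = sea N b := by
  by_contra! hc
  exact h (Matrix.det_eq_zero_of_row_eq_zero a fun b => by simp [hc b])

theorem sea_mem_of_vac_ne_zero {v : Fin N → ℤ} (h : vac N v ≠ 0) (b : Fin N) :
    ∃ a, v a = sea N b := by
  by_contra! hc
  exact h (Matrix.det_eq_zero_of_column_eq_zero b fun a => by simp [hc a])

theorem sea_mem_Ico (b : Fin N) : -(N : ℤ) ≤ sea N b ∧ sea N b < 0 := by
  have := b.isLt
  simp only [sea]
  omega

theorem exists_sea_eq {j : ℤ} (h1 : -(N : ℤ) ≤ j) (h2 : j < 0) : ∃ b, sea N b = j :=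
  ⟨⟨(j + N).toNat, by omega⟩, by simp only [sea]; omega⟩

theorem sea_injective : Function.Injective (sea N) := by
  intro a b h
  simp only [sea] at h
  ext
  omega

theorem vac_supp (N : ℕ) : IsSupp (vac N) := by
  intro v i hi
  by_contra h
  obtain ⟨b, hb⟩ := exists_sea_of_vac_ne_zero h i
  have := sea_mem_Ico b
  omega

theorem vac_sea (N : ℕ) : vac N (sea N) = 1 := by
  have : (Matrix.of fun a b : Fin N => if sea N a = sea N b then (1 : ℚ) else 0) = 1 := by
    ext a b
    simp [Matrix.one_apply, sea_injective.eq_iff]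
  rw [vac, this, Matrix.det_one]

theorem oneBody_sea_of_neg {F : (Fin N → ℤ) → ℚ} (hF : IsAlt F) (hS : IsSupp F) {k : ℤ}
    (hk : k < 0) (w : ℤ → ℚ) : oneBody k w F (sea N) = 0 := by
  refine Finset.sum_eq_zero fun i _ => ?_
  have hi := sea_mem_Ico i
  by_cases h : sea N i + k < -N
  · rw [hS _ i (by simpa using h), mul_zero]
  · obtain ⟨b, hb⟩ := exists_sea_eq (N := N) (j := sea N i + k) (by omega) (by omega)
    have hbi : i ≠ b := by
      rintro rfl
      omega
    rw [hF.eq_zero hbi, mul_zero]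
    rw [Function.update_self, Function.update_of_ne hbi.symm, hb]

theorem oneBody_vac_of_pos {k : ℤ} (hk : 0 < k) {w : ℤ → ℚ}
    (hw : ∀ j : ℤ, j < -N → w j = 0) : oneBody k w (vac N) = 0 := by
  funext v
  by_contra hv
  obtain ⟨i, _, hi⟩ := Finset.exists_ne_zero_of_sum_ne_zero hv
  have h1 : ¬ v i < -N := fun h => hi (by rw [hw _ h, zero_mul])
  have h2 : vac N (Function.update v i (v i + k)) ≠ 0 := fun h => hi (by rw [h, mul_zero])
  obtain ⟨b, hb⟩ := exists_sea_of_vac_ne_zero h2 i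
  rw [Function.update_self] at hb
  have hb' := sea_mem_Ico b
  obtain ⟨c, hc⟩ := exists_sea_eq (N := N) (j := v i) (by omega) (by omega)
  obtain ⟨a, ha⟩ := sea_mem_of_vac_ne_zero h2 c
  rw [hc] at ha
  have hai : a ≠ i := by
    rintro rfl
    rw [Function.update_self] at ha
    omega
  rw [Function.update_of_ne hai] at ha
  exact hv (((vac_alt N).oneBody k w).eq_zero hai ha)

theorem oneBody_oneBody_vac_sea {k : ℕ} (hk : 0 < k) (hkN : k ≤ N) (w w' : ℤ → ℚ) :
    oneBody k w (oneBody (-k) w' (vac N)) (sea N) =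
      ∑ j ∈ Finset.Ico (-k : ℤ) 0, w j * w' (j + k) := by
  have key : ∀ i : Fin N, w (sea N i) *
      oneBody (-k) w' (vac N) (Function.update (sea N) i (sea N i + k)) =
      if -(k : ℤ) ≤ sea N i then w (sea N i) * w' (sea N i + k) else 0 := by
    intro i
    have hi := sea_mem_Ico i
    split_ifs with h
    · congr 1
      rw [oneBody, Finset.sum_eq_single i]
      · simp [vac_sea]
      · intro a _ hai
        by_contra hne
        have h2 := right_ne_zero_of_mul hne
        obtain ⟨b, hb⟩ := exists_sea_of_vac_ne_zero h2 i
        rw [Function.update_of_ne hai.symm, Function.update_self] at hb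
        have := sea_mem_Ico b
        omega
      · simp
    · obtain ⟨b, hb⟩ := exists_sea_eq (N := N) (j := sea N i + k) (by omega) (by omega)
      have hbi : i ≠ b := by
        rintro rfl
        omega
      rw [((vac_alt N).oneBody _ _).eq_zero hbi, mul_zero]
      rw [Function.update_self, Function.update_of_ne hbi.symm, hb]
  rw [oneBody, Finset.sum_congr rfl fun i _ => key i, ← Finset.sum_filter]
  refine Finset.sum_bij (fun i _ => sea N i) ?_ ?_ ?_ ?_
  · intro i hi
    simp only [Finset.mem_filter, Finset.mem_univ, true_and] at hi
    exact Finset.mem_Ico.2 ⟨hi, (sea_mem_Ico i).2⟩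
  · intro a _ b _ h
    exact sea_injective h
  · intro j hj
    obtain ⟨h1, h2⟩ := Finset.mem_Ico.1 hj
    obtain ⟨b, hb⟩ := exists_sea_eq (N := N) (j := j) (by omega) h2
    exact ⟨b, by simpa [hb] using h1, hb⟩
  · intro i _
    rfl

/-- A product of one-body operators applied to the vacuum. -/
def state (N : ℕ) (l : List (ℤ × (ℤ → ℚ))) : (Fin N → ℤ) → ℚ :=
  l.foldr (fun a F => oneBody a.1 a.2 F) (vac N)

@[simp] theorem state_nil : state N [] = vac N := rfl

@[simp] theorem state_cons (a : ℤ × (ℤ → ℚ)) (l : List (ℤ × (ℤ → ℚ))) :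
    state N (a :: l) = oneBody a.1 a.2 (state N l) := rfl

theorem state_alt (l : List (ℤ × (ℤ → ℚ))) : IsAlt (state N l) := by
  induction l with
  | nil => exact vac_alt N
  | cons a l ih => exact ih.oneBody _ _

theorem state_supp (l : List (ℤ × (ℤ → ℚ))) (hl : ∀ a ∈ l, ∀ j : ℤ, j < -N → a.2 j = 0) :
    IsSupp (state N l) := by
  induction l with
  | nil => exact vac_supp N
  | cons a l ih =>
    exact (ih fun c hc => hl c (List.mem_cons_of_mem _ hc)).oneBody _
      (hl a List.mem_cons_self)

/-- All ways of replacing one element `c` of a list by `f a c`. -/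
def mergeAll {α : Type*} (f : α → α → α) (a : α) : List α → List (List α)
  | [] => []
  | c :: l => (f a c :: l) :: (mergeAll f a l).map (c :: ·)

/-- The commutator of two one-body operators. -/
def comm (a c : ℤ × (ℤ → ℚ)) : ℤ × (ℤ → ℚ) := (a.1 + c.1, commWeight a.1 a.2 c.1 c.2)

theorem oneBody_state (a : ℤ × (ℤ → ℚ)) (ha : oneBody a.1 a.2 (vac N) = 0)
    (l : List (ℤ × (ℤ → ℚ))) :
    oneBody a.1 a.2 (state N l) = ((mergeAll comm a l).map (state N)).sum := by
  induction l with
  | nil => simpa [mergeAll] using ha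
  | cons c l ih =>
    rw [state_cons, oneBody_comm, ih, oneBody_list_sum]
    simp only [mergeAll, List.map_cons, List.map_map, List.sum_cons, state_cons]
    rw [add_comm]
    rfl

/-- The vacuum expectation of a product of one-body operators. -/
def vev (N : ℕ) (l : List (ℤ × (ℤ → ℚ))) : ℚ := state N l (sea N)

theorem list_sum_apply {α : Type*} (l : List (α → ℚ)) (x : α) :
    l.sum x = (l.map (· x)).sum := by
  induction l with
  | nil => rfl
  | cons a l ih => simp [ih]

theorem vev_cons_of_pos (a : ℤ × (ℤ → ℚ)) (hk : 0 < a.1) (hw : ∀ j : ℤ, j < -N → a.2 j = 0)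
    (l : List (ℤ × (ℤ → ℚ))) : vev N (a :: l) = ((mergeAll comm a l).map (vev N)).sum := by
  rw [vev, state_cons, oneBody_state a (oneBody_vac_of_pos hk hw), list_sum_apply, List.map_map]
  rfl

theorem vev_cons_of_neg (a : ℤ × (ℤ → ℚ)) (hk : a.1 < 0) (l : List (ℤ × (ℤ → ℚ)))
    (hl : ∀ a ∈ l, ∀ j : ℤ, j < -N → a.2 j = 0) : vev N (a :: l) = 0 :=
  oneBody_sea_of_neg (state_alt l) (state_supp l hl) hk _

/-- All ways of applying `f` to one element of a list. -/
def modifyAll {α : Type*} (f : α → α) : List α → List (List α)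
  | [] => []
  | c :: l => (f c :: l) :: (modifyAll f l).map (c :: ·)

/-- The commutator of a diagonal operator of weight `u` with a one-body operator. -/
def diagComm (u : ℤ → ℚ) (c : ℤ × (ℤ → ℚ)) : ℤ × (ℤ → ℚ) :=
  (c.1, fun j => c.2 j * (u j - u (j + c.1)))

theorem oneBody_diag_state (u : ℤ → ℚ) (hu : oneBody 0 u (vac N) = 0)
    (l : List (ℤ × (ℤ → ℚ))) :
    oneBody 0 u (state N l) = ((modifyAll (diagComm u) l).map (state N)).sum := by
  induction l with
  | nil => simpa [modifyAll] using hu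
  | cons c l ih =>
    rw [state_cons, oneBody_comm, ih, oneBody_list_sum]
    simp only [modifyAll, List.map_cons, List.map_map, List.sum_cons, state_cons]
    rw [add_comm]
    congr 1
    · rw [zero_add]
      congr 1
      funext j
      simp only [commWeight, diagComm, add_zero]
      ring

/-- All results of applying `modifyAll f` repeatedly, `b` times. -/
def modifyIter {α : Type*} (f : α → α) (b : ℕ) (l : List α) : List (List α) :=
  (fun L => L.flatMap (modifyAll f))^[b] [l]

theorem modifyIter_succ {α : Type*} (f : α → α) (b : ℕ) (l : List α) :
    modifyIter f (b + 1) l = (modifyIter f b l).flatMap (modifyAll f) := by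
  rw [modifyIter, Function.iterate_succ_apply']
  rfl

theorem oneBody_diag_iterate_state (u : ℤ → ℚ) (hu : oneBody 0 u (vac N) = 0) (b : ℕ)
    (l : List (ℤ × (ℤ → ℚ))) :
    (oneBody 0 u)^[b] (state N l) = ((modifyIter (diagComm u) b l).map (state N)).sum := by
  induction b with
  | zero => simp [modifyIter]
  | succ b ih =>
    rw [Function.iterate_succ_apply', ih, oneBody_list_sum, List.map_map, modifyIter_succ]
    generalize modifyIter (diagComm u) b l = L
    induction L with
    | nil => simp
    | cons c L ihL =>
      simp only [List.map_cons, List.sum_cons, List.flatMap_cons, List.map_append,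
        List.sum_append, ihL]
      congr 1
      exact oneBody_diag_state u hu c

theorem foldr_list_sum (lν : List (ℤ × (ℤ → ℚ))) (L : List ((Fin N → ℤ) → ℚ)) :
    lν.foldr (fun a F => oneBody a.1 a.2 F) L.sum =
      (L.map fun F => lν.foldr (fun a F => oneBody a.1 a.2 F) F).sum := by
  induction lν with
  | nil => simp
  | cons a l ih =>
    rw [List.foldr_cons, ih, oneBody_list_sum, List.map_map]
    rfl

/-- Vacuum expectation with a power of a diagonal operator inserted. -/
theorem foldr_diag_iterate_state (u : ℤ → ℚ) (hu : oneBody 0 u (vac N) = 0) (b : ℕ)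
    (lν l : List (ℤ × (ℤ → ℚ))) :
    lν.foldr (fun a F => oneBody a.1 a.2 F) ((oneBody 0 u)^[b] (state N l)) (sea N) =
      ((modifyIter (diagComm u) b l).map fun l' => vev N (lν ++ l')).sum := by
  rw [oneBody_diag_iterate_state u hu, foldr_list_sum, list_sum_apply, List.map_map, List.map_map]
  congr 1
  refine List.map_congr_left fun l' _ => ?_
  simp [vev, state, List.foldr_append]

theorem diag_apply (u : ℤ → ℚ) (F : (Fin N → ℤ) → ℚ) (v : Fin N → ℤ) :
    oneBody 0 u F v = (∑ i, u (v i)) * F v := by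
  simp [oneBody, Finset.sum_mul]

end Fermion

namespace Fermion

open Polynomial in
/-- Weighted degree bound for polynomials over a multivariate polynomial ring, in which
the new variable has weight one. -/
def WDeg {E : Type} (D : ℕ) (f : (MvPolynomial E ℚ)[X]) : Prop :=
  ∀ n, f.coeff n = 0 ∨ (f.coeff n).totalDegree + n ≤ D

section WDeg

open Polynomial

variable {E : Type} {D D' : ℕ} {f g : (MvPolynomial E ℚ)[X]}

theorem WDeg.mono (h : WDeg D f) (hD : D ≤ D') : WDeg D' f :=
  fun n => (h n).imp id fun h => h.trans hD

theorem WDeg.zero : WDeg D (0 : (MvPolynomial E ℚ)[X]) := fun n => Or.inl (by simp)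

theorem WDeg.coeff_le (h : WDeg D f) (n : ℕ) : (f.coeff n).totalDegree ≤ D - n := by
  rcases h n with h | h
  · simp [h]
  · omega

theorem wDeg_of_coeff (h : ∀ n ≤ D, (f.coeff n).totalDegree ≤ D - n)
    (h' : ∀ n, D < n → f.coeff n = 0) : WDeg D f := by
  intro n
  by_cases hn : n ≤ D
  · have := h n hn
    right
    omega
  · exact Or.inl (h' n (by omega))

theorem WDeg.coeff_eq_zero (h : WDeg D f) {n : ℕ} (hn : D < n) : f.coeff n = 0 := by
  rcases h n with h | h
  · exact h
  · omega

theorem WDeg.add (hf : WDeg D f) (hg : WDeg D g) : WDeg D (f + g) := by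
  refine wDeg_of_coeff (fun n _ => ?_) fun n hn => ?_
  · rw [coeff_add]
    exact (MvPolynomial.totalDegree_add _ _).trans (max_le (hf.coeff_le n) (hg.coeff_le n))
  · rw [coeff_add, hf.coeff_eq_zero hn, hg.coeff_eq_zero hn, add_zero]

theorem WDeg.neg (hf : WDeg D f) : WDeg D (-f) := by
  intro n
  rw [coeff_neg, neg_eq_zero, MvPolynomial.totalDegree_neg]
  exact hf n

theorem WDeg.sub (hf : WDeg D f) (hg : WDeg D g) : WDeg D (f - g) := by
  rw [sub_eq_add_neg]
  exact hf.add hg.neg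

theorem WDeg.mul (hf : WDeg D f) (hg : WDeg D' g) : WDeg (D + D') (f * g) := by
  have key : ∀ n, ∀ x ∈ Finset.HasAntidiagonal.antidiagonal n, f.coeff x.1 * g.coeff x.2 = 0 ∨
      (f.coeff x.1 * g.coeff x.2).totalDegree + n ≤ D + D' := by
    intro n x hx
    have hx' := Finset.HasAntidiagonal.mem_antidiagonal.1 hx
    rcases hf x.1 with h1 | h1
    · left
      rw [h1, zero_mul]
    rcases hg x.2 with h2 | h2
    · left
      rw [h2, mul_zero]
    right
    have := MvPolynomial.totalDegree_mul (f.coeff x.1) (g.coeff x.2)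
    omega
  refine wDeg_of_coeff (fun n _ => ?_) fun n hn => ?_
  · rw [coeff_mul]
    refine MvPolynomial.totalDegree_finsetSum_le fun x hx => ?_
    rcases key n x hx with h | h
    · simp [h]
    · omega
  · rw [coeff_mul]
    refine Finset.sum_eq_zero fun x hx => ?_
    rcases key n x hx with h | h
    · exact h
    · omega

theorem WDeg.C {a : MvPolynomial E ℚ} (h : a.totalDegree ≤ D) : WDeg D (C a) := by
  refine wDeg_of_coeff (fun n _ => ?_) fun n hn => ?_
  · rw [coeff_C]
    split_ifs with h0
    · simpa [h0] using h
    · simp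
  · rw [coeff_C, if_neg (by omega)]

theorem WDeg.X : WDeg 1 (X : (MvPolynomial E ℚ)[X]) := by
  refine wDeg_of_coeff (fun n _ => ?_) fun n hn => ?_
  · rw [coeff_X]
    split_ifs <;> simp
  · rw [coeff_X, if_neg (by omega)]

theorem WDeg.pow (hf : WDeg D f) (n : ℕ) : WDeg (n * D) (f ^ n) := by
  induction n with
  | zero => exact WDeg.C (by simp)
  | succ n ih =>
    rw [pow_succ, Nat.succ_mul]
    exact ih.mul hf

theorem WDeg.sum {ι : Type*} (s : Finset ι) (F : ι → (MvPolynomial E ℚ)[X])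
    (h : ∀ i ∈ s, WDeg D (F i)) : WDeg D (∑ i ∈ s, F i) :=
  Finset.sum_induction F (WDeg D) (fun _ _ => WDeg.add) WDeg.zero h

theorem WDeg.taylor (hf : WDeg D f) {K : MvPolynomial E ℚ} (hK : K.totalDegree ≤ 1) :
    WDeg D (Polynomial.taylor K f) := by
  rw [taylor_apply, comp_eq_sum_left]
  refine WDeg.sum _ _ fun n hn => ?_
  rcases hf n with h | h
  · simp [h, WDeg.zero]
  · have h1 : WDeg (f.coeff n).totalDegree (Polynomial.C (f.coeff n)) := WDeg.C le_rfl
    have h2 : WDeg 1 (Polynomial.X + Polynomial.C K) := WDeg.X.add (WDeg.C hK)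
    exact (h1.mul (h2.pow n)).mono (by omega)

end WDeg

/-- A one-body operator with polynomial shift and weight, together with a degree bound. -/
structure SymOp (E : Type) where
  /-- the shift -/
  K : MvPolynomial E ℚ
  /-- the weight, a polynomial in the position -/
  f : Polynomial (MvPolynomial E ℚ)
  /-- the degree bound -/
  D : ℕ

namespace SymOp

variable {E : Type}

/-- The degree bounds hold. -/
def Valid (a : SymOp E) : Prop := a.K.totalDegree ≤ 1 ∧ WDeg a.D a.f

/-- The symbolic commutator. -/
noncomputable def comm (a c : SymOp E) : SymOp E :=
  ⟨a.K + c.K, a.f * Polynomial.taylor a.K c.f - c.f * Polynomial.taylor c.K a.f, a.D + c.D⟩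

theorem Valid.comm {a c : SymOp E} (ha : a.Valid) (hc : c.Valid) : (comm a c).Valid :=
  ⟨(MvPolynomial.totalDegree_add _ _).trans (max_le ha.1 hc.1),
    (ha.2.mul (hc.2.taylor ha.1)).sub ((hc.2.mul (ha.2.taylor hc.1)).mono (add_comm _ _).le)⟩

/-- The symbolic commutator with the diagonal operator of weight `(j + 1/2)² / 2`. -/
noncomputable def diag (c : SymOp E) : SymOp E :=
  ⟨c.K, c.f * (-(Polynomial.C c.K * (Polynomial.X + Polynomial.C (MvPolynomial.C (1 / 2)))) -
    Polynomial.C (c.K * c.K * MvPolynomial.C (1 / 2))), c.D + 2⟩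

theorem Valid.diag {c : SymOp E} (hc : c.Valid) : c.diag.Valid := by
  refine ⟨hc.1, hc.2.mul (WDeg.sub (WDeg.neg (D := 1 + 1) ((WDeg.C hc.1).mul
    (WDeg.X.add (WDeg.C (by simp))))) (WDeg.C ?_))⟩
  refine (MvPolynomial.totalDegree_mul _ _).trans ?_
  have := MvPolynomial.totalDegree_mul c.K c.K
  have := hc.1
  rw [MvPolynomial.totalDegree_C]
  omega

/-- Sufficient condition on a list of operators for the vacuum expectation to be divisible
by `q`. -/
def Killed (q : MvPolynomial E ℚ) (l : List (SymOp E)) : Prop :=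
  ∃ a ∈ l, a.f.map (Ideal.Quotient.mk (Ideal.span {q})) = 0 ∨
    (q ∣ a.K ∧ ∃ c, a.f.map (Ideal.Quotient.mk (Ideal.span {q})) = Polynomial.C c)

theorem mk_eq_zero_iff_dvd {q a : MvPolynomial E ℚ} :
    Ideal.Quotient.mk (Ideal.span {q}) a = 0 ↔ q ∣ a := by
  rw [Ideal.Quotient.eq_zero_iff_mem, Ideal.mem_span_singleton]

theorem comm_map (a c : SymOp E) (q : MvPolynomial E ℚ)
    (h : (a.f.map (Ideal.Quotient.mk (Ideal.span {q})) = 0 ∨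
      (q ∣ a.K ∧ ∃ r, a.f.map (Ideal.Quotient.mk (Ideal.span {q})) = Polynomial.C r)) ∨
      (c.f.map (Ideal.Quotient.mk (Ideal.span {q})) = 0 ∨
      (q ∣ c.K ∧ ∃ r, c.f.map (Ideal.Quotient.mk (Ideal.span {q})) = Polynomial.C r))) :
    (comm a c).f.map (Ideal.Quotient.mk (Ideal.span {q})) = 0 := by
  simp only [← mk_eq_zero_iff_dvd] at h
  simp only [comm, Polynomial.map_sub, Polynomial.map_mul, Polynomial.map_taylor]
  rcases h with (h | ⟨h, r, hr⟩) | (h | ⟨h, r, hr⟩)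
  · simp [h]
  · rw [h, hr, Polynomial.taylor_C, Polynomial.taylor_zero]
    ring
  · simp [h]
  · rw [h, hr, Polynomial.taylor_C, Polynomial.taylor_zero]
    ring

theorem Killed.cons {q : MvPolynomial E ℚ} {l : List (SymOp E)} (h : Killed q l)
    (a : SymOp E) : Killed q (a :: l) :=
  h.imp fun _ h => ⟨List.mem_cons_of_mem _ h.1, h.2⟩

theorem killed_mergeAll {q : MvPolynomial E ℚ} {a : SymOp E} {l : List (SymOp E)}
    (h : Killed q (a :: l)) : ∀ l' ∈ mergeAll comm a l, Killed q l' := by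
  induction l with
  | nil => simp [mergeAll]
  | cons c l ih =>
    intro l' hl'
    simp only [mergeAll, List.mem_cons, List.mem_map] at hl'
    obtain ⟨x, hx, hxq⟩ := h
    have hx' : x = a ∨ x = c ∨ x ∈ l := by simpa using hx
    rcases hl' with rfl | ⟨l'', hl'', rfl⟩
    · rcases hx' with rfl | rfl | hx'
      · exact ⟨_, List.mem_cons_self, Or.inl (comm_map _ _ q (Or.inl hxq))⟩
      · exact ⟨_, List.mem_cons_self, Or.inl (comm_map _ _ q (Or.inr hxq))⟩
      · exact ⟨x, List.mem_cons_of_mem _ hx', hxq⟩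
    · rcases hx' with rfl | rfl | hx'
      · exact (ih ⟨x, by simp, hxq⟩ l'' hl'').cons c
      · exact ⟨x, by simp, hxq⟩
      · exact (ih ⟨x, by simp [hx'], hxq⟩ l'' hl'').cons c

theorem killed_modifyAll_diag {q : MvPolynomial E ℚ} {l : List (SymOp E)}
    (p : List (SymOp E)) (h : Killed q (p ++ l)) :
    ∀ l' ∈ modifyAll diag l, Killed q (p ++ l') := by
  induction l generalizing p with
  | nil => simp [modifyAll]
  | cons c l ih =>
    intro l' hl'
    simp only [modifyAll, List.mem_cons, List.mem_map] at hl'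
    rcases hl' with rfl | ⟨l₂, hl₂, rfl⟩
    · obtain ⟨x, hx, hxq⟩ := h
      have hx' : x ∈ p ∨ x = c ∨ x ∈ l := by simpa using hx
      rcases hx' with hx' | rfl | hx'
      · exact ⟨x, by simp [hx'], hxq⟩
      · refine ⟨x.diag, by simp, ?_⟩
        left
        rcases hxq with hxq | ⟨hxq, -⟩
        · simp [diag, hxq]
        · rw [← mk_eq_zero_iff_dvd] at hxq
          simp [diag, hxq]
      · exact ⟨x, by simp [hx'], hxq⟩
    · simpa using ih (p ++ [c]) (by simpa using h) l₂ hl₂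

/-- The data of a numeric one-body operator for every size of the sea. -/
abbrev NumOp := ℤ × (ℕ → ℤ → ℚ)

/-- The numeric operator for a fixed size of the sea. -/
def NumOp.at (N : ℕ) (a : NumOp) : ℤ × (ℤ → ℚ) := (a.1, a.2 N)

/-- The commutator of families of numeric operators. -/
def NumOp.comm (a c : NumOp) : NumOp := (a.1 + c.1, fun N => commWeight a.1 (a.2 N) c.1 (c.2 N))

/-- A family of numeric operators is the specialisation of a symbolic operator at `z`, up to
boundary terms near the bottom of the sea. -/
def Rep (z : E → ℚ) (a : SymOp E) (x : NumOp) : Prop :=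
  (x.1 : ℚ) = MvPolynomial.eval z a.K ∧ (∀ (N : ℕ) (j : ℤ), j < -N → x.2 N j = 0) ∧
    ∃ s : ℕ, ∀ (N : ℕ) (j : ℤ), -(N : ℤ) + s ≤ j →
      x.2 N j = (a.f.map (MvPolynomial.eval z)).eval (j : ℚ)

theorem Rep.comm {z : E → ℚ} {a c : SymOp E} {x y : NumOp} (hx : Rep z a x) (hy : Rep z c y) :
    Rep z (SymOp.comm a c) (NumOp.comm x y) := by
  obtain ⟨hx1, hx2, s, hs⟩ := hx
  obtain ⟨hy1, hy2, t, ht⟩ := hy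
  refine ⟨?_, fun N j hj => ?_, s + t + x.1.natAbs + y.1.natAbs, fun N j hj => ?_⟩
  · simp [SymOp.comm, NumOp.comm, hx1, hy1]
  · simp [NumOp.comm, commWeight, hx2 N j hj, hy2 N j hj]
  · simp only [NumOp.comm, commWeight, SymOp.comm, Polynomial.map_sub, Polynomial.map_mul,
      Polynomial.map_taylor, Polynomial.eval_sub, Polynomial.eval_mul, Polynomial.taylor_eval,
      ← hx1, ← hy1]
    simp only [Nat.cast_add] at hj
    rw [hs N j (by omega), ht N j (by omega), hs N _ (by omega), ht N _ (by omega)]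
    push_cast
    rfl

/-- The action of the diagonal operator on families of numeric operators. -/
def NumOp.diag (u : ℕ → ℤ → ℚ) (c : NumOp) : NumOp :=
  (c.1, fun N j => c.2 N j * (u N j - u N (j + c.1)))

theorem Rep.diag {z : E → ℚ} {c : SymOp E} {y : NumOp} (hy : Rep z c y) (κ : ℕ → ℚ) :
    Rep z c.diag (NumOp.diag (fun N j => ((j : ℚ) + 1 / 2) ^ 2 / 2 + κ N) y) := by
  obtain ⟨hy1, hy2, t, ht⟩ := hy
  refine ⟨hy1, fun N j hj => by simp [NumOp.diag, hy2 N j hj], t, fun N j hj => ?_⟩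
  simp only [NumOp.diag, SymOp.diag, Polynomial.map_mul, Polynomial.map_sub, Polynomial.map_neg,
    Polynomial.map_add, Polynomial.map_C, Polynomial.map_X, Polynomial.eval_mul,
    Polynomial.eval_sub, Polynomial.eval_neg, Polynomial.eval_add, Polynomial.eval_C,
    Polynomial.eval_X, map_mul, MvPolynomial.eval_C, ← hy1, ht N j hj]
  push_cast
  ring

end SymOp

theorem mergeAll_map {α β : Type*} (f : α → α → α) (f' : β → β → β) (φ : α → β)
    (h : ∀ a c, φ (f a c) = f' (φ a) (φ c)) (a : α) (l : List α) :
    mergeAll f' (φ a) (l.map φ) = (mergeAll f a l).map (List.map φ) := by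
  induction l with
  | nil => rfl
  | cons c l ih => simp [mergeAll, ih, h, Function.comp_def]

theorem modifyAll_map {α β : Type*} (f : α → α) (f' : β → β) (φ : α → β)
    (h : ∀ a, φ (f a) = f' (φ a)) (l : List α) :
    modifyAll f' (l.map φ) = (modifyAll f l).map (List.map φ) := by
  induction l with
  | nil => rfl
  | cons c l ih => simp [modifyAll, ih, h, Function.comp_def]

theorem modifyIter_map {α β : Type*} (f : α → α) (f' : β → β) (φ : α → β)
    (h : ∀ a, φ (f a) = f' (φ a)) (b : ℕ) (l : List α) :
    modifyIter f' b (l.map φ) = (modifyIter f b l).map (List.map φ) := by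
  induction b with
  | zero => rfl
  | succ b ih =>
    rw [modifyIter_succ, modifyIter_succ, ih, List.map_flatMap, List.flatMap_map]
    congr 1
    funext l
    exact modifyAll_map f f' φ h l

theorem forall₂_mergeAll {α β : Type*} {S : α → β → Prop} {f : α → α → α} {f' : β → β → β}
    (h : ∀ a c x y, S a x → S c y → S (f a c) (f' x y)) {a : α} {x : β} (hax : S a x)
    {l : List α} {l' : List β} (hl : List.Forall₂ S l l') :
    List.Forall₂ (List.Forall₂ S) (mergeAll f a l) (mergeAll f' x l') := by
  induction hl with
  | nil => exact .nil
  | cons h1 h2 ih =>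
    refine .cons (.cons (h _ _ _ _ hax h1) h2) ?_
    rw [List.forall₂_map_left_iff, List.forall₂_map_right_iff]
    exact ih.imp fun _ _ h => .cons h1 h

theorem forall₂_modifyAll {α β : Type*} {S : α → β → Prop} {f : α → α} {f' : β → β}
    (h : ∀ a x, S a x → S (f a) (f' x))
    {l : List α} {l' : List β} (hl : List.Forall₂ S l l') :
    List.Forall₂ (List.Forall₂ S) (modifyAll f l) (modifyAll f' l') := by
  induction hl with
  | nil => exact .nil
  | cons h1 h2 ih =>
    refine .cons (.cons (h _ _ h1) h2) ?_
    rw [List.forall₂_map_left_iff, List.forall₂_map_right_iff]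
    exact ih.imp fun _ _ h => .cons h1 h

theorem forall₂_modifyIter {α β : Type*} {S : α → β → Prop} {f : α → α} {f' : β → β}
    (h : ∀ a x, S a x → S (f a) (f' x)) (b : ℕ)
    {l : List α} {l' : List β} (hl : List.Forall₂ S l l') :
    List.Forall₂ (List.Forall₂ S) (modifyIter f b l) (modifyIter f' b l') := by
  induction b with
  | zero => exact .cons hl .nil
  | succ b ih =>
    rw [modifyIter_succ, modifyIter_succ]
    generalize modifyIter f b l = L at ih
    generalize modifyIter f' b l' = L' at ih
    induction ih with
    | nil => exact .nil
    | cons h1 h2 ih =>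
      simp only [List.flatMap_cons]
      exact List.rel_append (forall₂_modifyAll h h1) ih

theorem length_of_mem_mergeAll {α : Type*} {f : α → α → α} {a : α} {l l' : List α}
    (h : l' ∈ mergeAll f a l) : l'.length = l.length := by
  induction l generalizing l' with
  | nil => simp [mergeAll] at h
  | cons c l ih =>
    simp only [mergeAll, List.mem_cons, List.mem_map] at h
    rcases h with rfl | ⟨l'', h, rfl⟩
    · rfl
    · simp [ih h]

theorem map_of_mem_modifyAll {α β : Type*} {f : α → α} {φ : α → β} (hf : ∀ a, φ (f a) = φ a)
    {l l' : List α} (h : l' ∈ modifyAll f l) : l'.map φ = l.map φ := by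
  induction l generalizing l' with
  | nil => simp [modifyAll] at h
  | cons c l ih =>
    simp only [modifyAll, List.mem_cons, List.mem_map] at h
    rcases h with rfl | ⟨l'', h, rfl⟩
    · simp [hf]
    · simp [ih h]

theorem forall_mem_of_mem_mergeAll {α : Type*} {f : α → α → α} {p : α → Prop}
    (hf : ∀ a c, p a → p c → p (f a c)) {a : α} (ha : p a) {l l' : List α}
    (hl : ∀ c ∈ l, p c) (h : l' ∈ mergeAll f a l) : ∀ c ∈ l', p c := by
  induction l generalizing l' with
  | nil => simp [mergeAll] at h
  | cons c l ih =>
    simp only [mergeAll, List.mem_cons, List.mem_map] at h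
    rw [List.forall_mem_cons] at hl
    rcases h with rfl | ⟨l'', h, rfl⟩
    · exact List.forall_mem_cons.2 ⟨hf _ _ ha hl.1, hl.2⟩
    · exact List.forall_mem_cons.2 ⟨hl.1, ih hl.2 h⟩

theorem forall_mem_of_mem_modifyAll {α : Type*} {f : α → α} {p : α → Prop}
    (hf : ∀ a, p a → p (f a)) {l l' : List α}
    (hl : ∀ c ∈ l, p c) (h : l' ∈ modifyAll f l) : ∀ c ∈ l', p c := by
  induction l generalizing l' with
  | nil => simp [modifyAll] at h
  | cons c l ih =>
    simp only [modifyAll, List.mem_cons, List.mem_map] at h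
    rw [List.forall_mem_cons] at hl
    rcases h with rfl | ⟨l'', h, rfl⟩
    · exact List.forall_mem_cons.2 ⟨hf _ hl.1, hl.2⟩
    · exact List.forall_mem_cons.2 ⟨hl.1, ih hl.2 h⟩

/-- An additive invariant of the operation is preserved by merging. -/
theorem sum_map_of_mem_mergeAll {α M : Type*} [AddCommMonoid M] {f : α → α → α} {φ : α → M}
    (hf : ∀ a c, φ (f a c) = φ a + φ c) {a : α} {l l' : List α}
    (h : l' ∈ mergeAll f a l) : (l'.map φ).sum = φ a + (l.map φ).sum := by
  induction l generalizing l' with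
  | nil => simp [mergeAll] at h
  | cons c l ih =>
    simp only [mergeAll, List.mem_cons, List.mem_map] at h
    rcases h with rfl | ⟨l'', h, rfl⟩
    · simp [hf, add_assoc]
    · simp [ih h, add_left_comm]

/-- Sublists of a merged list come from sublists of the original one. -/
theorem exists_sublist_of_mergeAll {α M : Type*} [AddCommMonoid M] {f : α → α → α} {φ : α → M}
    (hf : ∀ a c, φ (f a c) = φ a + φ c) {a : α} {l l' s : List α}
    (h : l' ∈ mergeAll f a l) (hs : s.Sublist l') :
    ∃ t : List α, t.Sublist (a :: l) ∧ (t.map φ).sum = (s.map φ).sum ∧ s.length ≤ t.length ∧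
      t.length ≤ s.length + 1 := by
  induction l generalizing l' s with
  | nil => simp [mergeAll] at h
  | cons c l ih =>
    simp only [mergeAll, List.mem_cons, List.mem_map] at h
    rcases h with rfl | ⟨l'', h, rfl⟩
    · rcases List.sublist_cons_iff.1 hs with hs | ⟨r, rfl, hr⟩
      · exact ⟨s, (hs.cons c).cons a, rfl, le_rfl, Nat.le_succ _⟩
      · exact ⟨a :: c :: r, (hr.cons_cons c).cons_cons a, by simp [hf, add_assoc], by simp, by simp⟩
    · rcases List.sublist_cons_iff.1 hs with hs | ⟨r, rfl, hr⟩
      · obtain ⟨t, ht, h1, h2, h3⟩ := ih h hs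
        exact ⟨t, ht.trans ((List.sublist_cons_self c l).cons_cons a), h1, h2, h3⟩
      · obtain ⟨t, ht, h1, h2, h3⟩ := ih h hr
        rcases List.sublist_cons_iff.1 ht with ht | ⟨r', rfl, hr'⟩
        · exact ⟨c :: t, (ht.cons_cons c).cons a, by simp [h1], by simpa using h2, by simpa using h3⟩
        · refine ⟨a :: c :: r', (hr'.cons_cons c).cons_cons a, ?_, by simpa using h2, by simpa using h3⟩
          simp only [List.map_cons, List.sum_cons] at h1 ⊢
          rw [← h1, add_left_comm]

end Fermion

namespace Fermion

open SymOp

variable {E : Type}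

theorem sum_Ico_pow_eq_bernoulli (k n : ℕ) :
    ∑ j ∈ Finset.Ico (-k : ℤ) 0, (j : ℚ) ^ n =
      ((Polynomial.bernoulli (n + 1)).eval 0 - (Polynomial.bernoulli (n + 1)).eval (-k : ℚ)) *
        (1 / (n + 1 : ℚ)) := by
  induction k with
  | zero => simp
  | succ k ih =>
    have h1 : Finset.Ico (-(k + 1 : ℕ) : ℤ) 0 =
        insert (-(k + 1 : ℕ) : ℤ) (Finset.Ico (-k : ℤ) 0) := by
      ext j
      simp only [Finset.mem_insert, Finset.mem_Ico]
      push_cast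
      omega
    have h2 : (-(k + 1 : ℕ) : ℤ) ∉ Finset.Ico (-k : ℤ) 0 := by
      simp only [Finset.mem_Ico]
      push_cast
      omega
    rw [h1, Finset.sum_insert h2, ih]
    have h3 := Polynomial.bernoulli_eval_one_add (n + 1) (-(k + 1 : ℕ) : ℚ)
    rw [show (1 + -((k + 1 : ℕ) : ℚ)) = -k by push_cast; ring] at h3
    rw [h3]
    have : (n + 1 : ℚ) ≠ 0 := by positivity
    push_cast
    field_simp
    ring_nf

/-- The polynomial expressing the sum of `F j` over `-K ≤ j < 0`. -/
noncomputable def sumBelow (F : Polynomial (MvPolynomial E ℚ)) (K : MvPolynomial E ℚ) :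
    MvPolynomial E ℚ :=
  ∑ n ∈ Finset.range (F.natDegree + 1), F.coeff n *
    ((Polynomial.aeval 0 (Polynomial.bernoulli (n + 1)) -
      Polynomial.aeval (-K) (Polynomial.bernoulli (n + 1))) * MvPolynomial.C (1 / (n + 1 : ℚ)))

theorem eval_sumBelow (F : Polynomial (MvPolynomial E ℚ)) (K : MvPolynomial E ℚ) (z : E → ℚ)
    (k : ℕ) (hk : (k : ℚ) = MvPolynomial.eval z K) :
    MvPolynomial.eval z (sumBelow F K) =
      ∑ j ∈ Finset.Ico (-k : ℤ) 0, (F.map (MvPolynomial.eval z)).eval (j : ℚ) := by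
  have h : ∀ (x : MvPolynomial E ℚ) (p : Polynomial ℚ),
      MvPolynomial.eval z (Polynomial.aeval x p) = p.eval (MvPolynomial.eval z x) := by
    intro x p
    rw [Polynomial.aeval_def, Polynomial.hom_eval₂, Polynomial.eval]
    congr 1
    ext
    simp
  simp only [sumBelow, map_sum, map_mul, map_sub, h, map_neg, map_zero, ← hk,
    MvPolynomial.eval_C, Polynomial.eval_map, Polynomial.eval₂_eq_sum_range]
  rw [Finset.sum_comm]
  refine Finset.sum_congr rfl fun n _ => ?_
  rw [← Finset.mul_sum, sum_Ico_pow_eq_bernoulli]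

theorem totalDegree_aeval_le {K : MvPolynomial E ℚ} (hK : K.totalDegree ≤ 1) (p : Polynomial ℚ) :
    (Polynomial.aeval K p).totalDegree ≤ p.natDegree := by
  rw [Polynomial.aeval_eq_sum_range]
  refine MvPolynomial.totalDegree_finsetSum_le fun i hi => ?_
  have := Finset.mem_range.1 hi
  refine (MvPolynomial.totalDegree_smul_le _ _).trans
    ((MvPolynomial.totalDegree_pow _ _).trans ?_)
  have := Nat.mul_le_mul_left i hK
  omega

theorem natDegree_bernoulli_le (n : ℕ) : (Polynomial.bernoulli n).natDegree ≤ n := by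
  rw [Polynomial.bernoulli_def]
  refine Polynomial.natDegree_sum_le_of_forall_le _ _ fun i hi => ?_
  have := Finset.mem_range.1 hi
  exact (Polynomial.natDegree_monomial_le _).trans (by omega)

theorem totalDegree_sumBelow {D : ℕ} {F : Polynomial (MvPolynomial E ℚ)} {K : MvPolynomial E ℚ}
    (hF : WDeg D F) (hK : K.totalDegree ≤ 1) : (sumBelow F K).totalDegree ≤ D + 1 := by
  refine MvPolynomial.totalDegree_finsetSum_le fun n hn => ?_
  rcases hF n with h | h
  · simp [h]
  refine (MvPolynomial.totalDegree_mul _ _).trans ?_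
  have h1 := natDegree_bernoulli_le (n + 1)
  have h2 := totalDegree_aeval_le (E := E) (K := 0) (by simp) (Polynomial.bernoulli (n + 1))
  have h3 := totalDegree_aeval_le (E := E) (K := -K)
    (by rwa [MvPolynomial.totalDegree_neg]) (Polynomial.bernoulli (n + 1))
  have h4 := MvPolynomial.totalDegree_sub (Polynomial.aeval 0 (Polynomial.bernoulli (n + 1)))
    (Polynomial.aeval (-K) (Polynomial.bernoulli (n + 1)))
  have h5 := MvPolynomial.totalDegree_mul
    (Polynomial.aeval 0 (Polynomial.bernoulli (n + 1)) -
      Polynomial.aeval (-K) (Polynomial.bernoulli (n + 1)))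
    (MvPolynomial.C (1 / (n + 1 : ℚ)))
  rw [MvPolynomial.totalDegree_C] at h5
  have h6 := max_le (h2.trans h1) (h3.trans h1)
  omega

theorem dvd_sumBelow_of_coeff {F : Polynomial (MvPolynomial E ℚ)} {K q : MvPolynomial E ℚ}
    (h : F.map (Ideal.Quotient.mk (Ideal.span {q})) = 0) : q ∣ sumBelow F K := by
  refine Finset.dvd_sum fun n _ => Dvd.dvd.mul_right ?_ _
  rw [← mk_eq_zero_iff_dvd, ← Polynomial.coeff_map, h, Polynomial.coeff_zero]

theorem dvd_sumBelow_of_dvd {F : Polynomial (MvPolynomial E ℚ)} {K q : MvPolynomial E ℚ}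
    (h : q ∣ K) : q ∣ sumBelow F K := by
  refine Finset.dvd_sum fun n _ => Dvd.dvd.mul_left (Dvd.dvd.mul_right (h.trans ?_) _) _
  have := Polynomial.sub_dvd_eval_sub (0 : MvPolynomial E ℚ) (-K)
    ((Polynomial.bernoulli (n + 1)).map (algebraMap ℚ (MvPolynomial E ℚ)))
  simp only [Polynomial.eval_map_algebraMap, zero_sub, neg_neg] at this
  exact this

/-- A real-valued polynomial has constant nonzero sign on a set. -/
def ConstSign (Z : Set (E → ℚ)) (K : MvPolynomial E ℚ) : Prop :=
  (∀ z ∈ Z, 0 < MvPolynomial.eval z K) ∨ (∀ z ∈ Z, MvPolynomial.eval z K < 0)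

/-- The sum of the vacuum expectations of a list of operator products is polynomial on `Z`,
with control of the degree and of the divisibility. -/
def PolyVev (Z : Set (E → ℚ)) (D : ℕ) (L : List (List (SymOp E))) : Prop :=
  ∃ P : MvPolynomial E ℚ, P.totalDegree ≤ D ∧ (∀ q, (∀ l ∈ L, Killed q l) → q ∣ P) ∧
    ∀ z ∈ Z, ∀ L' : List (List NumOp), List.Forall₂ (List.Forall₂ (Rep z)) L L' →
      ∃ N₀, ∀ N ≥ N₀, (L'.map fun l => vev N (l.map (NumOp.at N))).sum = MvPolynomial.eval z P

theorem PolyVev.nil (Z : Set (E → ℚ)) (D : ℕ) : PolyVev Z D [] := by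
  refine ⟨0, by simp, by simp, fun z _ L' h => ⟨0, fun N _ => ?_⟩⟩
  rw [List.forall₂_nil_left_iff] at h
  simp [h]

theorem PolyVev.cons {Z : Set (E → ℚ)} {D : ℕ} {l : List (SymOp E)} {L : List (List (SymOp E))}
    (h1 : PolyVev Z D [l]) (h2 : PolyVev Z D L) : PolyVev Z D (l :: L) := by
  obtain ⟨P, hP1, hP2, hP3⟩ := h1
  obtain ⟨Q, hQ1, hQ2, hQ3⟩ := h2
  refine ⟨P + Q, (MvPolynomial.totalDegree_add _ _).trans (max_le hP1 hQ1), fun q hq => ?_,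
    fun z hz L' hL' => ?_⟩
  · rw [List.forall_mem_cons] at hq
    exact dvd_add (hP2 q (by simpa using hq.1)) (hQ2 q hq.2)
  · obtain ⟨l', L', h1, h2, rfl⟩ := List.forall₂_cons_left_iff.1 hL'
    obtain ⟨N₁, hN₁⟩ := hP3 z hz [l'] (.cons h1 .nil)
    obtain ⟨N₂, hN₂⟩ := hQ3 z hz L' h2
    refine ⟨max N₁ N₂, fun N hN => ?_⟩
    rw [map_add, ← hN₁ N (le_of_max_le_left hN), ← hN₂ N (le_of_max_le_right hN)]
    simp

theorem PolyVev.of_forall {Z : Set (E → ℚ)} {D : ℕ} {L : List (List (SymOp E))}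
    (h : ∀ l ∈ L, PolyVev Z D [l]) : PolyVev Z D L := by
  induction L with
  | nil => exact .nil Z D
  | cons l L ih =>
    rw [List.forall_mem_cons] at h
    exact h.1.cons (ih h.2)

theorem Rep.support {z : E → ℚ} {l : List (SymOp E)} {l' : List NumOp}
    (h : List.Forall₂ (Rep z) l l') (N : ℕ) :
    ∀ a ∈ l'.map (NumOp.at N), ∀ j : ℤ, j < -N → a.2 j = 0 := by
  induction h with
  | nil => simp
  | cons h1 _ ih =>
    rw [List.map_cons, List.forall_mem_cons]
    exact ⟨h1.2.1 N, ih⟩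

theorem polyVev_of_neg {Z : Set (E → ℚ)} {D : ℕ} {a : SymOp E} {l : List (SymOp E)}
    (h : ∀ z ∈ Z, MvPolynomial.eval z a.K < 0) : PolyVev Z D [a :: l] := by
  refine ⟨0, by simp, by simp, fun z hz L' hL' => ⟨0, fun N _ => ?_⟩⟩
  obtain ⟨l', L', h1, h2, rfl⟩ := List.forall₂_cons_left_iff.1 hL'
  obtain ⟨x, l', hx, hl', rfl⟩ := List.forall₂_cons_left_iff.1 h1
  rw [List.forall₂_nil_left_iff] at h2
  subst h2
  have hx1 : x.1 < 0 := by
    have := h z hz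
    rw [← hx.1] at this
    exact_mod_cast this
  simpa using vev_cons_of_neg (NumOp.at N x) hx1 _ (Rep.support hl' N)

theorem polyVev_pair {Z : Set (E → ℚ)} {a c : SymOp E} (ha : a.Valid) (hc : c.Valid)
    (hK : a.K + c.K = 0) (h : ∀ z ∈ Z, 0 < MvPolynomial.eval z a.K) :
    PolyVev Z (a.D + c.D + 1) [[a, c]] := by
  have hcK : c.K = -a.K := by linear_combination hK
  refine ⟨sumBelow (a.f * Polynomial.taylor a.K c.f) a.K,
    totalDegree_sumBelow (ha.2.mul (hc.2.taylor ha.1)) ha.1, fun q hq => ?_,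
    fun z hz L' hL' => ?_⟩
  · obtain ⟨x, hx, hxq⟩ := hq [a, c] (by simp)
    simp only [List.mem_cons, List.not_mem_nil, or_false] at hx
    rcases hxq with hxq | ⟨hxq, -⟩
    · refine dvd_sumBelow_of_coeff ?_
      rw [Polynomial.map_mul, Polynomial.map_taylor]
      rcases hx with rfl | rfl <;> simp [hxq]
    · refine dvd_sumBelow_of_dvd ?_
      rcases hx with rfl | rfl
      · exact hxq
      · rwa [hcK, dvd_neg] at hxq
  · obtain ⟨l', L', h1, h2, rfl⟩ := List.forall₂_cons_left_iff.1 hL'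
    rw [List.forall₂_nil_left_iff] at h2
    subst h2
    obtain ⟨x, l', hx, hl', rfl⟩ := List.forall₂_cons_left_iff.1 h1
    obtain ⟨y, l', hy, hl'', rfl⟩ := List.forall₂_cons_left_iff.1 hl'
    rw [List.forall₂_nil_left_iff] at hl''
    subst hl''
    obtain ⟨k, w⟩ := x
    obtain ⟨k', w'⟩ := y
    obtain ⟨hx1, hx2, s, hs⟩ := hx
    obtain ⟨hy1, hy2, t, ht⟩ := hy
    simp only at hx1 hs hy1 ht
    have hpos : 0 < k := by
      have := h z hz
      rw [← hx1] at this
      exact_mod_cast this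
    obtain rfl : k' = -k := by
      rw [hcK, map_neg, ← hx1] at hy1
      exact_mod_cast hy1
    lift k to ℕ using hpos.le
    refine ⟨k + s + t, fun N hN => ?_⟩
    rw [eval_sumBelow _ _ z k (by exact_mod_cast hx1)]
    simp only [List.map_cons, List.map_nil, List.sum_cons, List.sum_nil, add_zero, vev,
      state_cons, state_nil, NumOp.at]
    rw [oneBody_oneBody_vac_sea (by exact_mod_cast hpos) (by omega)]
    refine Finset.sum_congr rfl fun j hj => ?_
    rw [Finset.mem_Ico] at hj
    rw [hs N j (by omega), ht N _ (by omega)]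
    simp only [Polynomial.map_mul, Polynomial.map_taylor, Polynomial.eval_mul,
      Polynomial.taylor_eval, ← hx1]
    push_cast
    rfl

theorem polyVev_cons_of_pos {Z : Set (E → ℚ)} {D : ℕ} {a : SymOp E} {l : List (SymOp E)}
    (h : ∀ z ∈ Z, 0 < MvPolynomial.eval z a.K) (hl : PolyVev Z D (mergeAll SymOp.comm a l)) :
    PolyVev Z D [a :: l] := by
  obtain ⟨P, hP1, hP2, hP3⟩ := hl
  refine ⟨P, hP1, fun q hq => hP2 q (killed_mergeAll (hq (a :: l) (by simp))),
    fun z hz L' hL' => ?_⟩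
  obtain ⟨l', L', h1, h2, rfl⟩ := List.forall₂_cons_left_iff.1 hL'
  rw [List.forall₂_nil_left_iff] at h2
  subst h2
  obtain ⟨x, l', hx, hl', rfl⟩ := List.forall₂_cons_left_iff.1 h1
  have hx1 : 0 < x.1 := by
    have := h z hz
    rw [← hx.1] at this
    exact_mod_cast this
  obtain ⟨N₀, hN₀⟩ := hP3 z hz (mergeAll NumOp.comm x l')
    (forall₂_mergeAll (fun _ _ _ _ => Rep.comm) hx hl')
  refine ⟨N₀, fun N hN => ?_⟩
  rw [← hN₀ N hN, List.map_cons, List.map_nil, List.sum_cons, List.sum_nil, add_zero, List.map_cons,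
    vev_cons_of_pos (NumOp.at N x) hx1 (hx.2.1 N),
    mergeAll_map NumOp.comm comm (NumOp.at N) (fun _ _ => rfl), List.map_map]
  rfl

theorem polyVev_of_chamber (Z : Set (E → ℚ)) (r : ℕ) : ∀ l : List (SymOp E), l.length = r + 2 →
    (∀ a ∈ l, a.Valid) → (l.map SymOp.K).sum = 0 →
    (∀ s : List (SymOp E), s.Sublist l → s ≠ [] → s.length < l.length →
      ConstSign Z (s.map SymOp.K).sum) →
    PolyVev Z ((l.map SymOp.D).sum + 1) [l] := by
  induction r with
  | zero =>
    intro l hlen hval hsum hsign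
    match l, hlen with
    | [a, c], _ =>
      rcases hsign [a] (by simp) (by simp) (by simp) with h | h
      · simpa using polyVev_pair (hval a (by simp)) (hval c (by simp)) (by simpa using hsum)
          (by simpa using h)
      · exact polyVev_of_neg (by simpa using h)
  | succ r ih =>
    intro l hlen hval hsum hsign
    match l, hlen with
    | a :: l, hlen =>
      have hlen' : l.length = r + 2 := by simpa using hlen
      rw [List.forall_mem_cons] at hval
      rcases hsign [a] (by simp) (by simp) (by simp; omega) with h | h
      · refine polyVev_cons_of_pos (by simpa using h) (PolyVev.of_forall fun l' hl' => ?_)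
        have hlen2 := length_of_mem_mergeAll hl'
        have hD := sum_map_of_mem_mergeAll (φ := SymOp.D) (fun _ _ => rfl) hl'
        have hK := sum_map_of_mem_mergeAll (φ := SymOp.K) (fun _ _ => rfl) hl'
        rw [List.map_cons, List.sum_cons, ← hD]
        refine ih l' (hlen2.trans hlen')
          (forall_mem_of_mem_mergeAll (fun _ _ => Valid.comm) hval.1 hval.2 hl') ?_ ?_
        · rw [hK]
          simpa using hsum
        · intro s hs hs0 hslen
          obtain ⟨t, ht, h1, h2, h3⟩ :=
            exists_sublist_of_mergeAll (φ := SymOp.K) (fun _ _ => rfl) hl' hs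
          rw [← h1]
          have := List.length_pos_of_ne_nil hs0
          refine hsign t ht (List.ne_nil_of_length_pos (by omega)) ?_
          simp only [List.length_cons]
          omega
      · exact polyVev_of_neg (by simpa using h)

end Fermion

namespace Fermion

open SymOp

variable {E : Type}

/-- The one-body operator with constant weight one. -/
noncomputable def SymOp.plain (K : MvPolynomial E ℚ) : SymOp E := ⟨K, 1, 0⟩

/-- The weight one above the bottom of the sea. -/
def bulk (N : ℕ) (j : ℤ) : ℚ := if j < -N then 0 else 1

/-- The numeric shift operator. -/
def NumOp.plain (k : ℤ) : NumOp := (k, bulk)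

theorem rep_plain {z : E → ℚ} {K : MvPolynomial E ℚ} {k : ℤ}
    (h : (k : ℚ) = MvPolynomial.eval z K) : Rep z (SymOp.plain K) (NumOp.plain k) := by
  refine ⟨h, fun N j hj => if_pos hj, 0, fun N j hj => ?_⟩
  have : ¬ j < -(N : ℤ) := by
    push_cast at hj
    omega
  simp [SymOp.plain, NumOp.plain, bulk, this]

/-- The shift making the diagonal operator annihilate the vacuum. -/
def vacShift (N : ℕ) : ℚ := -(∑ i : Fin N, ((sea N i : ℚ) + 1 / 2) ^ 2 / 2) / N

/-- The weight of the cut-and-join operator in the one-body picture. -/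
def diagWeight (N : ℕ) (j : ℤ) : ℚ := ((j : ℚ) + 1 / 2) ^ 2 / 2 + vacShift N

theorem oneBody_diagWeight_vac (N : ℕ) : oneBody 0 (diagWeight N) (vac N) = 0 := by
  funext v
  rw [diag_apply]
  by_cases hv : vac N v = 0
  · simp [hv]
  choose p hp using exists_sea_of_vac_ne_zero hv
  have hps : Function.Surjective p := by
    intro b
    obtain ⟨a, ha⟩ := sea_mem_of_vac_ne_zero hv b
    exact ⟨a, sea_injective ((hp a).symm.trans ha)⟩
  have hpb : Function.Bijective p := Finite.injective_iff_bijective.1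
    (Finite.injective_iff_surjective.2 hps)
  have h1 : ∑ i, diagWeight N (v i) = ∑ i, diagWeight N (sea N i) := by
    rw [← hpb.sum_comp (fun i => diagWeight N (sea N i))]
    simp [hp]
  have h2 : ∑ i, diagWeight N (sea N i) = 0 := by
    simp only [diagWeight, Finset.sum_add_distrib, Finset.sum_const, Finset.card_univ,
      Fintype.card_fin, nsmul_eq_mul, vacShift]
    rcases Nat.eq_zero_or_pos N with rfl | hN
    · simp
    · have : (N : ℚ) ≠ 0 := by positivity
      rw [mul_div_cancel₀ _ this, add_neg_cancel]
  rw [h1, h2, zero_mul]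
  rfl

theorem map_K_of_mem_modifyIter {b : ℕ} {l l' : List (SymOp E)}
    (h : l' ∈ modifyIter SymOp.diag b l) : l'.map SymOp.K = l.map SymOp.K := by
  induction b generalizing l' with
  | zero =>
    obtain rfl : l' = l := by simpa [modifyIter] using h
    rfl
  | succ b ih =>
    rw [modifyIter_succ, List.mem_flatMap] at h
    obtain ⟨l'', h1, h2⟩ := h
    rw [map_of_mem_modifyAll (f := SymOp.diag) (fun _ => rfl) h2, ih h1]

theorem valid_of_mem_modifyIter {b : ℕ} {l l' : List (SymOp E)}
    (hl : ∀ a ∈ l, a.Valid) (h : l' ∈ modifyIter SymOp.diag b l) : ∀ a ∈ l', a.Valid := by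
  induction b generalizing l' with
  | zero =>
    obtain rfl : l' = l := by simpa [modifyIter] using h
    exact hl
  | succ b ih =>
    rw [modifyIter_succ, List.mem_flatMap] at h
    obtain ⟨l'', h1, h2⟩ := h
    exact forall_mem_of_mem_modifyAll (p := SymOp.Valid) (fun _ => Valid.diag) (ih h1) h2

theorem sum_D_of_mem_modifyAll {l l' : List (SymOp E)}
    (h : l' ∈ modifyAll SymOp.diag l) : (l'.map SymOp.D).sum = (l.map SymOp.D).sum + 2 := by
  induction l generalizing l' with
  | nil => simp [modifyAll] at h
  | cons c l ih =>
    simp only [modifyAll, List.mem_cons, List.mem_map] at h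
    rcases h with rfl | ⟨l'', h, rfl⟩
    · simp [SymOp.diag]
      omega
    · simp [ih h]
      omega

theorem sum_D_of_mem_modifyIter {b : ℕ} {l l' : List (SymOp E)}
    (h : l' ∈ modifyIter SymOp.diag b l) :
    (l'.map SymOp.D).sum = (l.map SymOp.D).sum + 2 * b := by
  induction b generalizing l' with
  | zero =>
    obtain rfl : l' = l := by simpa [modifyIter] using h
    simp
  | succ b ih =>
    rw [modifyIter_succ, List.mem_flatMap] at h
    obtain ⟨l'', h1, h2⟩ := h
    rw [sum_D_of_mem_modifyAll h2, ih h1]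
    omega

theorem killed_modifyIter {q : MvPolynomial E ℚ} {b : ℕ} {p l l' : List (SymOp E)}
    (hk : Killed q (p ++ l)) (h : l' ∈ modifyIter SymOp.diag b l) : Killed q (p ++ l') := by
  induction b generalizing l' with
  | zero =>
    obtain rfl : l' = l := by simpa [modifyIter] using h
    exact hk
  | succ b ih =>
    rw [modifyIter_succ, List.mem_flatMap] at h
    obtain ⟨l'', h1, h2⟩ := h
    exact killed_modifyAll_diag p (ih h1) l' h2

theorem killed_plain {q : MvPolynomial E ℚ} {l : List (MvPolynomial E ℚ)}
    (h : ∃ K ∈ l, q ∣ K) : Killed q (l.map SymOp.plain) := by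
  obtain ⟨K, hK, hq⟩ := h
  refine ⟨SymOp.plain K, List.mem_map_of_mem hK, Or.inr ⟨hq, 1, ?_⟩⟩
  simp [SymOp.plain]

/-- The lowering operators of `lν`, the `b`-th power of the diagonal operator and the raising
operators of `lμ`, evaluated between vacua. -/
def correlator (N b : ℕ) (lν lμ : List ℤ) : ℚ :=
  (lν.map fun k => (k, bulk N)).foldr (fun a F => oneBody a.1 a.2 F)
    ((oneBody 0 (diagWeight N))^[b] (state N (lμ.map fun k => (k, bulk N)))) (sea N)

theorem correlator_eq_sum (N b : ℕ) (lν lμ : List ℤ) :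
    correlator N b lν lμ = (((modifyIter (NumOp.diag diagWeight) b (lμ.map NumOp.plain)).map
      (lν.map NumOp.plain ++ ·)).map fun l => vev N (l.map (NumOp.at N))).sum := by
  rw [correlator, foldr_diag_iterate_state _ (oneBody_diagWeight_vac N)]
  have h : lμ.map (fun k => (k, bulk N)) = (lμ.map NumOp.plain).map (NumOp.at N) := by
    rw [List.map_map]
    rfl
  rw [h, modifyIter_map (NumOp.diag diagWeight) (diagComm (diagWeight N)) (NumOp.at N)
    (fun _ => rfl), List.map_map, List.map_map]
  congr 1
  refine List.map_congr_left fun l' _ => ?_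
  simp [Function.comp_def, NumOp.plain, NumOp.at]

theorem exists_correlator_poly (Z : Set (E → ℚ)) (b : ℕ) (lν lμ : List (MvPolynomial E ℚ))
    (hlen : 2 ≤ (lν ++ lμ).length) (hdeg : ∀ K ∈ lν ++ lμ, K.totalDegree ≤ 1)
    (hsum : (lν ++ lμ).sum = 0)
    (hsign : ∀ s : List (MvPolynomial E ℚ), s.Sublist (lν ++ lμ) → s ≠ [] →
      s.length < (lν ++ lμ).length → ConstSign Z s.sum) :
    ∃ P : MvPolynomial E ℚ, P.totalDegree ≤ 2 * b + 1 ∧ (∀ K ∈ lν ++ lμ, K ∣ P) ∧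
      ∀ z ∈ Z, ∀ kν kμ : List ℤ,
        List.Forall₂ (fun K (k : ℤ) => (k : ℚ) = MvPolynomial.eval z K) lν kν →
        List.Forall₂ (fun K (k : ℤ) => (k : ℚ) = MvPolynomial.eval z K) lμ kμ →
        ∃ N₀, ∀ N ≥ N₀, correlator N b kν kμ = MvPolynomial.eval z P := by
  have key : PolyVev Z (2 * b + 1) ((modifyIter SymOp.diag b (lμ.map SymOp.plain)).map
      (lν.map SymOp.plain ++ ·)) := by
    refine PolyVev.of_forall fun l hl => ?_
    obtain ⟨l', hl', rfl⟩ := List.mem_map.1 hl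
    have hD := sum_D_of_mem_modifyIter hl'
    have hK := map_K_of_mem_modifyIter hl'
    have hplainK : ∀ l : List (MvPolynomial E ℚ), (l.map SymOp.plain).map SymOp.K = l := by
      intro l
      simp [Function.comp_def, SymOp.plain]
    have hplainD : ∀ l : List (MvPolynomial E ℚ), ((l.map SymOp.plain).map SymOp.D).sum = 0 := by
      intro l
      simp [Function.comp_def, SymOp.plain]
    have hplainV : ∀ l : List (MvPolynomial E ℚ), (∀ K ∈ l, K.totalDegree ≤ 1) →
        ∀ a ∈ l.map SymOp.plain, a.Valid := by
      intro l hl a ha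
      obtain ⟨K, hK, rfl⟩ := List.mem_map.1 ha
      exact ⟨hl K hK, WDeg.C (by simp)⟩
    have hKall : (lν.map SymOp.plain ++ l').map SymOp.K = lν ++ lμ := by
      rw [List.map_append, hK, hplainK, hplainK]
    have hlen' : (lν.map SymOp.plain ++ l').length = (lν ++ lμ).length := by
      rw [← hKall, List.length_map]
    have := polyVev_of_chamber Z ((lν ++ lμ).length - 2) (lν.map SymOp.plain ++ l')
      (by omega) ?_ (by rw [hKall, hsum]) ?_
    · rw [List.map_append, List.sum_append, hD, hplainD, hplainD, zero_add, zero_add] at this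
      exact this
    · intro a ha
      rcases List.mem_append.1 ha with ha | ha
      · exact hplainV lν (fun K hK => hdeg K (List.mem_append_left _ hK)) a ha
      · exact valid_of_mem_modifyIter (hplainV lμ
          (fun K hK => hdeg K (List.mem_append_right _ hK))) hl' a ha
    · intro s hs hs0 hslen
      refine hsign _ (hKall ▸ hs.map _) (by simpa using hs0) ?_
      rw [List.length_map]
      omega
  obtain ⟨P, hP1, hP2, hP3⟩ := key
  refine ⟨P, hP1, fun K hK => hP2 K fun l hl => ?_, fun z hz kν kμ hν hμ => ?_⟩
  · obtain ⟨l', hl', rfl⟩ := List.mem_map.1 hl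
    refine killed_modifyIter ?_ hl'
    rw [← List.map_append]
    exact killed_plain ⟨K, hK, dvd_rfl⟩
  · have hplain : ∀ (l : List (MvPolynomial E ℚ)) (k : List ℤ),
        List.Forall₂ (fun K (k : ℤ) => (k : ℚ) = MvPolynomial.eval z K) l k →
        List.Forall₂ (Rep z) (l.map SymOp.plain) (k.map NumOp.plain) := by
      intro l k h
      rw [List.forall₂_map_left_iff, List.forall₂_map_right_iff]
      exact h.imp fun _ _ => rep_plain
    obtain ⟨N₀, hN₀⟩ := hP3 z hz _ (by
      rw [List.forall₂_map_left_iff, List.forall₂_map_right_iff]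
      exact (forall₂_modifyIter (fun a x h => Rep.diag h vacShift) b (hplain lμ kμ hμ)).imp
        fun _ _ h => List.rel_append (hplain lν kν hν) h)
    refine ⟨N₀, fun N hN => ?_⟩
    rw [← hN₀ N hN, correlator_eq_sum]
    rfl

/-- A finite set of distinct variables and a polynomial not divisible by any of them. -/
theorem prod_X_mul_dvd {P ℓ : MvPolynomial E ℚ} (S : Finset E) (hS : ∀ e ∈ S, MvPolynomial.X e ∣ P)
    (hℓ : ℓ ∣ P) (hX : ∀ e ∈ S, ¬ MvPolynomial.X e ∣ ℓ) :
    (∏ e ∈ S, MvPolynomial.X e) * ℓ ∣ P := by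
  classical
  induction S using Finset.induction_on with
  | empty => simpa using hℓ
  | insert e S he ih =>
    obtain ⟨Q, hQ⟩ := ih (fun e h => hS e (Finset.mem_insert_of_mem h))
      (fun e h => hX e (Finset.mem_insert_of_mem h))
    have hp := MvPolynomial.X_prime (R := ℚ) (i := e)
    have h1 := hS e (Finset.mem_insert_self _ _)
    rw [hQ] at h1
    rcases hp.dvd_or_dvd h1 with h1 | ⟨T, rfl⟩
    · exfalso
      rcases hp.dvd_or_dvd h1 with h1 | h1
      · obtain ⟨e', he', h2⟩ := (hp.dvd_finsetProd_iff _).1 h1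
        rw [MvPolynomial.X_dvd_X] at h2
        exact he (h2 ▸ he')
      · exact hX e (Finset.mem_insert_self _ _) h1
    · refine ⟨T, ?_⟩
      rw [hQ, Finset.prod_insert he]
      ring

end Fermion

namespace Fermion

variable {N : ℕ}

theorem sum_eq_of_vac_ne_zero {v : Fin N → ℤ} (hv : vac N v ≠ 0) :
    ∑ i, v i = ∑ i, sea N i := by
  choose p hp using exists_sea_of_vac_ne_zero hv
  have hps : Function.Surjective p := by
    intro b
    obtain ⟨a, ha⟩ := sea_mem_of_vac_ne_zero hv b
    exact ⟨a, sea_injective ((hp a).symm.trans ha)⟩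
  have hpb : Function.Bijective p := Finite.injective_iff_bijective.1
    (Finite.injective_iff_surjective.2 hps)
  rw [← hpb.sum_comp (sea N)]
  simp [hp]

theorem sum_eq_of_injective {v : Fin N → ℤ} (hv : Function.Injective v)
    (h1 : ∀ i, -(N : ℤ) ≤ v i) (h2 : ∀ i, v i < 0) : ∑ i, v i = ∑ i, sea N i := by
  choose p hp using fun i => exists_sea_eq (h1 i) (h2 i)
  have hpi : Function.Injective p := fun a b h => hv (by rw [← hp a, ← hp b, h])
  have hpb : Function.Bijective p := Finite.injective_iff_bijective.1 hpi
  rw [← hpb.sum_comp (sea N)]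
  simp [hp]

theorem vac_eq_zero_of_nonneg {v : Fin N → ℤ} {i : Fin N} (h : 0 ≤ v i) : vac N v = 0 := by
  by_contra hv
  obtain ⟨b, hb⟩ := exists_sea_of_vac_ne_zero hv i
  have := sea_mem_Ico b
  omega

theorem vac_eq_zero_of_sum_ne {v : Fin N → ℤ} (h : ∑ i, v i ≠ ∑ i, sea N i) : vac N v = 0 := by
  by_contra hv
  exact h (sum_eq_of_vac_ne_zero hv)

theorem vac_swap_pair (v : Fin N → ℤ) {n n' : Fin N} (h : n ≠ n') (a b : ℤ) :
    vac N (v - Pi.single n a - Pi.single n' b) =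
      -vac N (v - Pi.single n (v n - v n' + b) - Pi.single n' (v n' - v n + a)) := by
  rw [← vac_alt N _ n n' h]
  congr 1
  funext x
  simp only [Pi.sub_apply, Function.comp_apply, Equiv.swap_apply_def]
  split_ifs with h1 h2
  · subst h1
    simp [h, h.symm]
    ring
  · subst h2
    simp [h, h.symm]
    ring
  · simp [h1, h2]

theorem comp_swap_sub_single (v : Fin N → ℤ) (i j n : Fin N) (a : ℤ) :
    v ∘ Equiv.swap i j - Pi.single n a =
      (v - Pi.single (Equiv.swap i j n) a : Fin N → ℤ) ∘ Equiv.swap i j := by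
  funext x
  simp only [Pi.sub_apply, Function.comp_apply, Pi.single_apply, EmbeddingLike.apply_eq_iff_eq]

theorem isAlt_sum_single (c : ℤ → ℚ) (k : ℤ) :
    IsAlt fun v : Fin N → ℤ => ∑ n, c (v n) * vac N (v - Pi.single n k) := by
  intro v i j hij
  simp only [comp_swap_sub_single, vac_alt N _ i j hij, Function.comp_apply, mul_neg,
    Finset.sum_neg_distrib]
  rw [Equiv.sum_comp (Equiv.swap i j) fun n => c (v n) * vac N (v - (Pi.single n k : Fin N → ℤ))]

theorem vac_double_swap (v : Fin N → ℤ) {i j : Fin N} (hij : i ≠ j) (l l' : ℤ) (n n' : Fin N) :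
    vac N (v ∘ Equiv.swap i j - Pi.single n l - Pi.single n' l') =
      -vac N (v - Pi.single (Equiv.swap i j n) l - Pi.single (Equiv.swap i j n') l') := by
  rw [comp_swap_sub_single, comp_swap_sub_single, vac_alt N _ i j hij]

theorem isAlt_sum_double (k : ℤ) :
    IsAlt fun v : Fin N → ℤ => ∑ l ∈ Finset.Ioo 0 k, ∑ n, ∑ n' ∈ Finset.univ.erase n,
      vac N (v - Pi.single n l - Pi.single n' (k - l)) := by
  intro v i j hij
  rw [← Finset.sum_neg_distrib]
  refine Finset.sum_congr rfl fun l _ => ?_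
  rw [← Equiv.sum_comp (Equiv.swap i j) fun n => ∑ n' ∈ Finset.univ.erase n,
    vac N (v - (Pi.single n l : Fin N → ℤ) - (Pi.single n' (k - l) : Fin N → ℤ)),
    ← Finset.sum_neg_distrib]
  refine Finset.sum_congr rfl fun n _ => ?_
  rw [← Finset.sum_neg_distrib]
  refine Finset.sum_equiv (Equiv.swap i j) (fun a => ?_) fun n' _ => vac_double_swap v hij _ _ _ _
  simp

theorem sum_vac_single_outside {k : ℤ} {v : Fin N → ℤ} (hv : Function.Injective v)
    (hN : ∀ i, -(N : ℤ) ≤ v i) {m : Fin N} (hm : ∀ n, n ≠ m → v n < 0) (h0 : 0 ≤ v m)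
    {l : ℤ} (hl : l < k) :
    ∑ n ∈ Finset.univ.erase m, vac N (v - Pi.single m l - Pi.single n (k - l)) =
      if v m < l then -vac N (v - Pi.single m k) else 0 := by
  split_ifs with h
  · by_cases hlow : v m - l < -N
    · rw [vac_supp N (v - (Pi.single m k : Fin N → ℤ)) m (by simp; omega), neg_zero]
      refine Finset.sum_eq_zero fun n hn => vac_supp N _ m ?_
      have := (Finset.mem_erase.1 hn).1
      simp [this.symm]
      omega
    by_cases hex : ∃ n', v n' = v m - l
    · obtain ⟨n', hn'⟩ := hex
      have hne : n' ≠ m := by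
        rintro rfl
        omega
      rw [Finset.sum_eq_single n']
      · rw [vac_swap_pair v hne.symm]
        congr 2
        funext x
        simp only [Pi.sub_apply, Pi.single_apply]
        split_ifs <;> omega
      · intro n hn hnn'
        refine (vac_alt N).eq_zero hne ?_
        have := (Finset.mem_erase.1 hn).1
        simp [hne, this.symm, hnn'.symm, hn']
      · simp [hne]
    · push Not at hex
      have hsum : ∑ i, (v - (Pi.single m l : Fin N → ℤ)) i = ∑ i, sea N i := by
        refine sum_eq_of_injective ?_ ?_ ?_
        · intro a b hab
          by_contra hne
          simp only [Pi.sub_apply, Pi.single_apply] at hab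
          split_ifs at hab with h1 h2 h2
          · exact hne (h1.trans h2.symm)
          · subst h1
            exact hex b (by omega)
          · subst h2
            exact hex a (by omega)
          · exact hne (hv (by omega))
        · intro i
          have := hN i
          simp only [Pi.sub_apply, Pi.single_apply]
          split_ifs with h1
          · subst h1
            omega
          · omega
        · intro i
          simp only [Pi.sub_apply, Pi.single_apply]
          split_ifs with h1
          · subst h1
            omega
          · have := hm i h1
            omega
      have hsum' : ∑ i, v i - l = ∑ i, sea N i := by
        rw [← hsum]
        simp
      rw [vac_eq_zero_of_sum_ne (v := v - (Pi.single m k : Fin N → ℤ)), neg_zero]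
      · refine Finset.sum_eq_zero fun n hn => vac_eq_zero_of_sum_ne ?_
        simp
        omega
      · simp
        omega
  · refine Finset.sum_eq_zero fun n hn => vac_eq_zero_of_nonneg (i := m) ?_
    have := (Finset.mem_erase.1 hn).1
    simp [this.symm]
    omega

theorem sum_vac_double_outside {k : ℤ} {v : Fin N → ℤ} {m m' : Fin N} (hm : m ≠ m')
    (h0 : 0 ≤ v m) (h0' : 0 ≤ v m') :
    ∑ l ∈ Finset.Ioo 0 k, vac N (v - Pi.single m l - Pi.single m' (k - l)) = 0 := by
  have h1 : ∑ l ∈ Finset.Ioo 0 k, vac N (v - Pi.single m l - Pi.single m' (k - l)) =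
      ∑ l ∈ Finset.Ioo (v m) (k - v m'), vac N (v - Pi.single m l - Pi.single m' (k - l)) := by
    symm
    refine Finset.sum_subset (fun l hl => ?_) fun l hl hl' => ?_
    · rw [Finset.mem_Ioo] at hl ⊢
      omega
    · rw [Finset.mem_Ioo] at hl hl'
      by_cases h : v m < l
      · refine vac_eq_zero_of_nonneg (i := m') ?_
        simp [hm.symm]
        omega
      · refine vac_eq_zero_of_nonneg (i := m) ?_
        simp [hm]
        omega
  rw [h1]
  have h2 : ∑ l ∈ Finset.Ioo (v m) (k - v m'), vac N (v - Pi.single m l - Pi.single m' (k - l)) =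
      -∑ l ∈ Finset.Ioo (v m) (k - v m'),
        vac N (v - Pi.single m l - Pi.single m' (k - l)) := by
    rw [← Finset.sum_neg_distrib]
    refine Finset.sum_nbij' (fun l => v m - v m' + (k - l)) (fun l => v m - v m' + (k - l))
      ?_ ?_ ?_ ?_ ?_
    · intro l hl
      rw [Finset.mem_Ioo] at hl ⊢
      omega
    · intro l hl
      rw [Finset.mem_Ioo] at hl ⊢
      omega
    · intro l _
      ring
    · intro l _
      ring
    · intro l _
      rw [vac_swap_pair v hm]
      congr 4
      ring
  linarith

theorem vac_cut_identity (k : ℤ) (hk : 0 < k) (v : Fin N → ℤ) :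
    ∑ l ∈ Finset.Ioo 0 k, ∑ n, ∑ n' ∈ Finset.univ.erase n,
        vac N (v - Pi.single n l - Pi.single n' (k - l)) =
      2 * ∑ n, (v n + 1 - k : ℚ) * vac N (v - Pi.single n k) := by
  by_cases hN : ∀ i, -(N : ℤ) ≤ v i
  swap
  · push Not at hN
    obtain ⟨i, hi⟩ := hN
    rw [Finset.sum_eq_zero, Finset.sum_eq_zero, mul_zero]
    · intro n _
      rw [vac_supp N _ i, mul_zero]
      simp only [Pi.sub_apply, Pi.single_apply]
      split_ifs <;> omega
    · intro l hl
      rw [Finset.mem_Ioo] at hl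
      refine Finset.sum_eq_zero fun n _ => Finset.sum_eq_zero fun n' _ => vac_supp N _ i ?_
      simp only [Pi.sub_apply, Pi.single_apply]
      split_ifs <;> omega
  by_cases hinj : Function.Injective v
  swap
  · rw [Function.Injective] at hinj
    push Not at hinj
    obtain ⟨i, j, hij, hne⟩ := hinj
    rw [(isAlt_sum_double k).eq_zero hne hij,
      (isAlt_sum_single (fun x => (x + 1 - k : ℚ)) k).eq_zero hne hij, mul_zero]
  by_cases hneg : ∀ i, v i < 0
  · have hs := sum_eq_of_injective hinj hN hneg
    rw [Finset.sum_eq_zero, Finset.sum_eq_zero, mul_zero]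
    · intro n _
      rw [vac_eq_zero_of_sum_ne, mul_zero]
      simp
      omega
    · intro l hl
      refine Finset.sum_eq_zero fun n _ => Finset.sum_eq_zero fun n' _ =>
        vac_eq_zero_of_sum_ne ?_
      simp
      omega
  push Not at hneg
  obtain ⟨m, h0⟩ := hneg
  by_cases hm : ∀ n, n ≠ m → v n < 0
  · have hr : ∑ n, (v n + 1 - k : ℚ) * vac N (v - Pi.single n k) =
        (v m + 1 - k : ℚ) * vac N (v - Pi.single m k) := by
      refine Finset.sum_eq_single m (fun n _ hn => ?_) (by simp)
      rw [vac_eq_zero_of_nonneg (i := m), mul_zero]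
      simpa [Pi.single_apply, hn.symm] using h0
    have hl : ∀ l ∈ Finset.Ioo 0 k, ∑ n, ∑ n' ∈ Finset.univ.erase n,
        vac N (v - Pi.single n l - Pi.single n' (k - l)) =
        (if v m < l then -vac N (v - Pi.single m k) else 0) +
        (if v m < k - l then -vac N (v - Pi.single m k) else 0) := by
      intro l hl
      rw [Finset.mem_Ioo] at hl
      rw [← sum_vac_single_outside hinj hN hm h0 hl.2,
        ← sum_vac_single_outside hinj hN hm h0 (l := k - l) (k := k) (by omega),
        ← Finset.add_sum_erase _ _ (Finset.mem_univ m)]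
      congr 1
      refine Finset.sum_congr rfl fun n hn => ?_
      have hn' := (Finset.mem_erase.1 hn).1
      rw [Finset.sum_eq_single m]
      · congr 1
        rw [sub_right_comm]
        congr 2
        ring
      · intro n' hn'' hne
        refine vac_eq_zero_of_nonneg (i := m) ?_
        simpa [Pi.single_apply, hn'.symm, hne.symm] using h0
      · simp [hn'.symm]
    rw [hr, Finset.sum_congr rfl hl, Finset.sum_add_distrib]
    have hrefl : ∑ l ∈ Finset.Ioo 0 k, (if v m < k - l then -vac N (v - Pi.single m k) else 0) =
        ∑ l ∈ Finset.Ioo 0 k, (if v m < l then -vac N (v - Pi.single m k) else 0) := by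
      refine Finset.sum_nbij' (fun l => k - l) (fun l => k - l) ?_ ?_ ?_ ?_ ?_
      · intro l hl
        rw [Finset.mem_Ioo] at hl ⊢
        omega
      · intro l hl
        rw [Finset.mem_Ioo] at hl ⊢
        omega
      · intro l _
        ring
      · intro l _
        ring
      · intro l _
        rfl
    rw [hrefl, ← two_mul]
    congr 1
    by_cases hkm : k ≤ v m
    · rw [vac_eq_zero_of_nonneg (v := v - (Pi.single m k : Fin N → ℤ)) (i := m) (by simp; omega)]
      simp
    · rw [← Finset.sum_filter, Finset.sum_const]
      have hf : (Finset.Ioo 0 k).filter (fun l => v m < l) = Finset.Ioo (v m) k := by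
        ext l
        simp only [Finset.mem_filter, Finset.mem_Ioo]
        omega
      rw [hf, Int.card_Ioo, nsmul_eq_mul]
      have : (((k - v m - 1).toNat : ℤ) : ℚ) = k - v m - 1 := by
        rw [Int.toNat_of_nonneg (by omega)]
        push_cast
        ring
      rw [Int.cast_natCast] at this
      rw [this]
      ring
  · push Not at hm
    obtain ⟨m', hmm, h0'⟩ := hm
    rw [Finset.sum_eq_zero (s := Finset.univ), mul_zero]
    · rw [Finset.sum_comm]
      refine Finset.sum_eq_zero fun n _ => ?_
      rw [Finset.sum_comm]
      refine Finset.sum_eq_zero fun n' hn' => ?_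
      have hnn := (Finset.mem_erase.1 hn').1
      by_cases h1 : m = n ∨ m = n'
      · by_cases h2 : m' = n ∨ m' = n'
        · refine sum_vac_double_outside hnn.symm ?_ ?_
          · rcases h1 with rfl | rfl
            · exact h0
            · rcases h2 with rfl | rfl
              · exact h0'
              · exact absurd rfl hmm
          · rcases h1 with rfl | rfl
            · rcases h2 with rfl | rfl
              · exact absurd rfl hmm
              · exact h0'
            · exact h0
        · refine Finset.sum_eq_zero fun l _ => vac_eq_zero_of_nonneg (i := m') ?_
          push Not at h2
          simpa [Pi.single_apply, h2.1, h2.2] using h0'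
      · refine Finset.sum_eq_zero fun l _ => vac_eq_zero_of_nonneg (i := m) ?_
        push Not at h1
        simpa [Pi.single_apply, h1.1, h1.2] using h0
    · intro n _
      by_cases h1 : m = n
      · rw [vac_eq_zero_of_nonneg (i := m'), mul_zero]
        simpa [Pi.single_apply, h1 ▸ hmm] using h0'
      · rw [vac_eq_zero_of_nonneg (i := m), mul_zero]
        simpa [Pi.single_apply, h1] using h0

end Fermion

namespace Fermion

variable {N : ℕ} {X ι : Type*} [Fintype X] [DecidableEq X]

/-- The number of points sent to each position. -/
def cnt (w : X → Fin N) : Fin N → ℤ := ∑ a, Pi.single (w a) 1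

theorem cnt_apply (w : X → Fin N) (n : Fin N) :
    cnt w n = ∑ a, if w a = n then 1 else 0 := by
  simp [cnt, Finset.sum_apply, Pi.single_apply, eq_comm]

/-- The vacuum shifted along the cycles of `σ`, summed over all assignments of cycles to
positions. -/
def shiftState (N : ℕ) (σ : Equiv.Perm X) : (Fin N → ℤ) → ℚ :=
  fun v => ∑ w : X → Fin N with w ∘ σ = w, vac N (v - cnt w)

theorem sum_cnt_mul (w : X → Fin N) (f : Fin N → ℚ) :
    ∑ n, (cnt w n : ℚ) * f n = ∑ a, f (w a) := by
  simp only [cnt_apply, Int.cast_sum, Finset.sum_mul]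
  rw [Finset.sum_comm]
  simp

theorem sum_diagWeight_mul_vac (w : X → Fin N) (v : Fin N → ℤ) :
    (∑ i, diagWeight N (v i)) * vac N (v - cnt w) =
      (1 / 2) * ∑ a, (2 * ((v (w a) - cnt w (w a) : ℚ) + 1) +
        ∑ b ∈ Finset.univ.erase a, if w a = w b then 1 else 0) * vac N (v - cnt w) := by
  by_cases hv : vac N (v - cnt w) = 0
  · simp [hv]
  have h0 := congrFun (oneBody_diagWeight_vac N) (v - cnt w)
  rw [diag_apply, Pi.zero_apply, mul_eq_zero, or_iff_left hv] at h0
  rw [← Finset.sum_mul, ← mul_assoc]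
  congr 1
  have h1 : ∀ i, diagWeight N (v i) = diagWeight N ((v - cnt w) i) +
      (cnt w i * ((v i - cnt w i : ℚ) + 1 / 2 + cnt w i / 2)) := by
    intro i
    simp only [diagWeight, Pi.sub_apply]
    push_cast
    ring
  rw [Finset.sum_congr rfl fun i _ => h1 i, Finset.sum_add_distrib, h0, zero_add, sum_cnt_mul,
    Finset.mul_sum]
  refine Finset.sum_congr rfl fun a _ => ?_
  have h2 : (cnt w (w a) : ℚ) = 1 + ∑ b ∈ Finset.univ.erase a, if w a = w b then 1 else 0 := by
    rw [cnt_apply, ← Finset.add_sum_erase _ _ (Finset.mem_univ a)]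
    simp [eq_comm]
  linear_combination (1 / 2 : ℚ) * h2

open Classical in
theorem sum_swap_offDiag (f : Equiv.Perm X → ℚ) :
    ∑ a, ∑ b ∈ Finset.univ.erase a, f (Equiv.swap a b) =
      2 * ∑ τ : Equiv.Perm X with τ.IsSwap, f τ := by
  rw [Finset.sum_sigma', Finset.mul_sum,
    ← Finset.sum_fiberwise_of_maps_to (t := Finset.univ.filter Equiv.Perm.IsSwap)
      (g := fun p : (_ : X) × X => Equiv.swap p.1 p.2)]
  · refine Finset.sum_congr rfl fun τ hτ => ?_
    obtain ⟨x, y, hxy, rfl⟩ := (Finset.mem_filter.1 hτ).2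
    have hs : ((Finset.univ.sigma fun a : X => Finset.univ.erase a).filter
        fun p : (_ : X) × X => Equiv.swap p.1 p.2 = Equiv.swap x y) =
        {⟨x, y⟩, ⟨y, x⟩} := by
      ext ⟨a, b⟩
      simp only [Finset.mem_filter, Finset.mem_sigma, Finset.mem_univ, Finset.mem_erase,
        and_true, true_and, Finset.mem_insert, Finset.mem_singleton, Sigma.mk.injEq, heq_eq_eq]
      constructor
      · rintro ⟨hab, h⟩
        have ha : Equiv.swap x y a = b := by rw [← h, Equiv.swap_apply_left]
        rw [Equiv.swap_apply_def] at ha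
        split_ifs at ha with h1 h2
        · exact Or.inl ⟨h1, ha.symm⟩
        · exact Or.inr ⟨h2, ha.symm⟩
        · exact absurd ha.symm hab
      · rintro (⟨rfl, rfl⟩ | ⟨rfl, rfl⟩)
        · exact ⟨hxy.symm, rfl⟩
        · exact ⟨hxy, Equiv.swap_comm _ _⟩
    rw [hs, Finset.sum_pair, Equiv.swap_comm y x]
    · ring
    · simp [hxy]
  · rintro ⟨a, b⟩ h
    simp only [Finset.mem_sigma, Finset.mem_univ, Finset.mem_erase, and_true, true_and] at h
    exact Finset.mem_filter.2 ⟨Finset.mem_univ _, a, b, h.symm, rfl⟩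

/-- `L` enumerates the cycles of `σ`. -/
structure Cycles (σ : Equiv.Perm X) (L : X → ι) : Prop where
  surj : Function.Surjective L
  inv : ∀ x, L (σ x) = L x
  same : ∀ x y, L x = L y → σ.SameCycle x y

theorem apply_eq_of_sameCycle {α : Type*} {σ : Equiv.Perm X} {w : X → α}
    (hw : ∀ x, w (σ x) = w x) {x y : X} (h : σ.SameCycle x y) : w x = w y := by
  obtain ⟨i, hi⟩ := h
  rw [← hi]
  have h1 : ∀ (n : ℕ) z, w ((σ ^ n) z) = w z := by
    intro n
    induction n with
    | zero => simp
    | succ n ih => intro z; rw [pow_succ', Equiv.Perm.mul_apply, hw, ih]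
  obtain ⟨n, rfl | rfl⟩ := i.eq_nat_or_neg
  · simp [h1]
  · have := h1 n ((σ ^ (-(n : ℤ))) x)
    rw [← this]
    simp

theorem sum_invariant [Fintype ι] [DecidableEq ι] {σ : Equiv.Perm X} {L : X → ι}
    (hL : Cycles σ L) (f : (X → Fin N) → ℚ) :
    ∑ w : X → Fin N with w ∘ σ = w, f w = ∑ w : ι → Fin N, f (w ∘ L) := by
  symm
  refine Finset.sum_bij' (fun w _ => w ∘ L) (fun w _ => w ∘ Function.surjInv hL.surj)
    ?_ ?_ ?_ ?_ ?_
  · intro w _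
    rw [Finset.mem_filter]
    refine ⟨Finset.mem_univ _, ?_⟩
    funext x
    simp [hL.inv]
  · simp
  · intro w _
    funext i
    simp [Function.surjInv_eq hL.surj]
  · intro w hw
    rw [Finset.mem_filter] at hw
    funext x
    exact apply_eq_of_sameCycle (fun x => congrFun hw.2 x)
      (hL.same _ _ (Function.surjInv_eq hL.surj _))
  · intro w _
    rfl

theorem cnt_comp [Fintype ι] [DecidableEq ι] (w : ι → Fin N) (L : X → ι) :
    cnt (w ∘ L) = ∑ i, Pi.single (w i) ((Finset.univ.filter fun x => L x = i).card : ℤ) := by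
  rw [cnt, ← Finset.sum_fiberwise (s := Finset.univ) (g := L)]
  refine Finset.sum_congr rfl fun i _ => ?_
  rw [Finset.sum_congr rfl (g := fun _ => (Pi.single (w i) 1 : Fin N → ℤ))]
  · rw [Finset.sum_const]
    funext n
    simp [Pi.single_apply]
  · intro x hx
    rw [← (Finset.mem_filter.1 hx).2]
    rfl

theorem invariant_swap_mul_iff {σ : Equiv.Perm X} {a b : X} (hab : ¬σ.SameCycle a b)
    (w : X → Fin N) :
    w ∘ (Equiv.swap a b * σ : Equiv.Perm X) = w ↔ w ∘ σ = w ∧ w a = w b := by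
  have key : ∀ (w : X → Fin N), w a = w b → ∀ x, w (Equiv.swap a b x) = w x := by
    intro w h x
    rw [Equiv.swap_apply_def]
    split_ifs with h1 h2
    · rw [h1, h]
    · rw [h2, h]
    · rfl
  constructor
  · intro h
    have h' : ∀ x, w (Equiv.swap a b (σ x)) = w x := fun x => congrFun h x
    have hwab : w a = w b := by
      have hper := Function.minimalPeriod_pos_of_mem_periodicPts
        (Function.Injective.mem_periodicPts σ.injective a)
      have hk : ∀ j < Function.minimalPeriod σ a, w (σ^[j] a) = w a := by
        intro j hj
        induction j with
        | zero => rfl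
        | succ j ih =>
          rw [← ih (by omega), ← h' (σ^[j] a), ← Function.iterate_succ_apply' σ,
            Equiv.swap_apply_of_ne_of_ne]
          · exact Function.not_isPeriodicPt_of_pos_of_lt_minimalPeriod (Nat.succ_ne_zero j) hj
          · intro h
            exact hab ⟨(j + 1 : ℕ), by rw [← h, zpow_natCast, ← Equiv.Perm.iterate_eq_pow]⟩
      obtain ⟨k, hk'⟩ : ∃ k, Function.minimalPeriod σ a = k + 1 :=
        ⟨_, (Nat.succ_pred_eq_of_pos hper).symm⟩
      have h1 := h' (σ^[k] a)
      rw [hk k (by omega), ← Function.iterate_succ_apply' σ, Nat.succ_eq_add_one, ← hk', Function.iterate_minimalPeriod, Equiv.swap_apply_left] at h1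
      exact h1.symm
    refine ⟨?_, hwab⟩
    funext x
    rw [← h' x, key w hwab]
    rfl
  · rintro ⟨h1, h2⟩
    funext x
    have := key w h2 (σ x)
    simp only [Function.comp_apply, Equiv.Perm.mul_apply]
    rw [this]
    exact congrFun h1 x

end Fermion

namespace Fermion

universe u

variable {N : ℕ} {X : Type u} [Fintype X] [DecidableEq X]

open Classical in
theorem exists_cycles_option (σ : Equiv.Perm X) (a : X) :
    ∃ (κ : Type u) (_ : Fintype κ) (_ : DecidableEq κ) (L : X → Option κ),
      Cycles σ L ∧ L a = none := by
  let s := Equiv.Perm.SameCycle.setoid σ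
  have : Fintype (Quotient s) := Fintype.ofFinite _
  refine ⟨{c : Quotient s // c ≠ Quotient.mk s a}, inferInstance, inferInstance,
    fun x => if h : Quotient.mk s x = Quotient.mk s a then none else some ⟨Quotient.mk s x, h⟩,
    ⟨?_, ?_, ?_⟩, by simp⟩
  · rintro (_ | ⟨c, hc⟩)
    · exact ⟨a, by simp⟩
    · obtain ⟨x, rfl⟩ := Quotient.exists_rep c
      exact ⟨x, by simp [hc]⟩
  · intro x
    have : Quotient.mk s (σ x) = Quotient.mk s x :=
      Quotient.sound (show σ.SameCycle (σ x) x from Equiv.Perm.sameCycle_apply_left.2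
        (Equiv.Perm.SameCycle.refl _ _))
    simp only [this]
  · intro x y h
    split_ifs at h with h1 h2 h2
    · exact Quotient.exact (h1.trans h2.symm)
    · have h3 := congrArg Subtype.val (Option.some.inj h)
      exact Quotient.exact h3

theorem minimalPeriod_pos (σ : Equiv.Perm X) (a : X) : 0 < Function.minimalPeriod σ a :=
  Function.minimalPeriod_pos_of_mem_periodicPts
    (Function.Injective.mem_periodicPts σ.injective a)

theorem sameCycle_iff_exists_lt (σ : Equiv.Perm X) (a x : X) :
    σ.SameCycle a x ↔ ∃ j < Function.minimalPeriod σ a, σ^[j] a = x := by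
  constructor
  · intro h
    obtain ⟨n, _, hn⟩ := h.exists_pow_eq''
    refine ⟨n % Function.minimalPeriod σ a, Nat.mod_lt _ (minimalPeriod_pos σ a), ?_⟩
    rw [Function.iterate_mod_minimalPeriod_eq, Equiv.Perm.iterate_eq_pow, hn.2]
  · rintro ⟨j, _, rfl⟩
    exact ⟨(j : ℕ), by rw [zpow_natCast, Equiv.Perm.iterate_eq_pow]⟩

theorem iterate_inj_of_lt {σ : Equiv.Perm X} {a : X} {i j : ℕ}
    (hi : i < Function.minimalPeriod σ a) (hj : j < Function.minimalPeriod σ a)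
    (h : σ^[i] a = σ^[j] a) : i = j :=
  Function.iterate_injOn_Iio_minimalPeriod hi hj h

theorem card_fiber_none {κ : Type*} [DecidableEq κ] {σ : Equiv.Perm X} {L : X → Option κ}
    (hL : Cycles σ L) {a : X} (ha : L a = none) :
    (Finset.univ.filter fun x => L x = none).card = Function.minimalPeriod σ a := by
  have : (Finset.univ.filter fun x => L x = none) =
      (Finset.range (Function.minimalPeriod σ a)).image fun j => σ^[j] a := by
    ext x
    simp only [Finset.mem_filter, Finset.mem_univ, true_and, Finset.mem_image, Finset.mem_range]
    rw [← sameCycle_iff_exists_lt]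
    constructor
    · intro h
      exact hL.same _ _ (ha.trans h.symm)
    · intro h
      rw [← ha]
      exact (apply_eq_of_sameCycle hL.inv h).symm
  rw [this, Finset.card_image_of_injOn, Finset.card_range]
  intro i hi j hj h
  exact iterate_inj_of_lt (Finset.mem_range.1 hi) (Finset.mem_range.1 hj) h

/-- The first `l` points of the cycle of `a`. -/
def arc (σ : Equiv.Perm X) (a : X) (l : ℕ) : Finset X :=
  (Finset.range l).image fun j => σ^[j] a

theorem mem_arc {σ : Equiv.Perm X} {a : X} {l : ℕ} {x : X} :
    x ∈ arc σ a l ↔ ∃ j < l, σ^[j] a = x := by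
  simp [arc]

theorem iterate_mem_arc {σ : Equiv.Perm X} {a : X} {l j : ℕ}
    (hl : l ≤ Function.minimalPeriod σ a) (hj : j < Function.minimalPeriod σ a) :
    σ^[j] a ∈ arc σ a l ↔ j < l := by
  rw [mem_arc]
  constructor
  · rintro ⟨i, hi, h⟩
    rwa [← iterate_inj_of_lt (hi.trans_le hl) hj h]
  · intro h
    exact ⟨j, h, rfl⟩

theorem card_arc {σ : Equiv.Perm X} {a : X} {l : ℕ}
    (hl : l ≤ Function.minimalPeriod σ a) : (arc σ a l).card = l := by
  rw [arc, Finset.card_image_of_injOn, Finset.card_range]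
  intro i hi j hj h
  exact iterate_inj_of_lt ((Finset.mem_range.1 hi).trans_le hl)
    ((Finset.mem_range.1 hj).trans_le hl) h

theorem cycles_cut {κ : Type*} {σ : Equiv.Perm X} {L : X → Option κ}
    (hL : Cycles σ L) {a : X} (ha : L a = none) {l : ℕ} (hl0 : 0 < l)
    (hl : l < Function.minimalPeriod σ a) :
    Cycles (Equiv.swap a (σ^[l] a) * σ)
      (fun x => if x ∈ arc σ a l then none else some (L x)) := by
  set k := Function.minimalPeriod σ a with hk
  set ρ := Equiv.swap a (σ^[l] a) * σ with hρ
  have hsucc : ∀ j, j + 1 < k → j + 1 ≠ l → ρ (σ^[j] a) = σ^[j + 1] a := by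
    intro j hj hjl
    rw [hρ, Equiv.Perm.mul_apply, Function.iterate_succ_apply' σ,
      Equiv.swap_apply_of_ne_of_ne]
    · rw [← Function.iterate_succ_apply' σ]
      exact Function.not_isPeriodicPt_of_pos_of_lt_minimalPeriod (Nat.succ_ne_zero j) hj
    · rw [← Function.iterate_succ_apply' σ]
      intro h
      exact hjl (iterate_inj_of_lt hj hl h)
  have hend1 : ρ (σ^[l - 1] a) = a := by
    rw [hρ, Equiv.Perm.mul_apply, ← Function.iterate_succ_apply' σ,
      show (l - 1).succ = l by omega, Equiv.swap_apply_right]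
  have hend2 : ρ (σ^[k - 1] a) = σ^[l] a := by
    rw [hρ, Equiv.Perm.mul_apply, ← Function.iterate_succ_apply' σ,
      show (k - 1).succ = k by omega, hk, Function.iterate_minimalPeriod, Equiv.swap_apply_left]
  have hLj : ∀ j, L (σ^[j] a) = none := by
    intro j
    rw [← ha]
    exact (apply_eq_of_sameCycle hL.inv ⟨(j : ℕ), by
      rw [zpow_natCast, Equiv.Perm.iterate_eq_pow]⟩).symm
  have hmem : ∀ j, j < k → (σ^[j] a ∈ arc σ a l ↔ j < l) := fun j hj => iterate_mem_arc hl.le hj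
  have hnone : ∀ x, L x = none → ∃ j < k, σ^[j] a = x := fun x hx =>
    (sameCycle_iff_exists_lt σ a x).1 (hL.same _ _ (ha.trans hx.symm))
  have harc : ∀ x, x ∈ arc σ a l → L x = none := by
    intro x hx
    obtain ⟨j, _, rfl⟩ := mem_arc.1 hx
    exact hLj j
  have hout : ∀ x, L x ≠ none → ρ x = σ x := by
    intro x hx
    rw [hρ, Equiv.Perm.mul_apply, Equiv.swap_apply_of_ne_of_ne]
    · intro h
      exact hx (by rw [← hL.inv, h, ha])
    · intro h
      exact hx (by rw [← hL.inv, h, hLj])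
  have hc1 : ∀ j < l, ρ.SameCycle a (σ^[j] a) := by
    intro j hj
    induction j with
    | zero => exact Equiv.Perm.SameCycle.refl _ _
    | succ j ih =>
      rw [← hsucc j (by omega) (by omega)]
      exact Equiv.Perm.sameCycle_apply_right.2 (ih (by omega))
  have hc2 : ∀ j, l + j < k → ρ.SameCycle (σ^[l] a) (σ^[l + j] a) := by
    intro j hj
    induction j with
    | zero => exact Equiv.Perm.SameCycle.refl _ _
    | succ j ih =>
      rw [← add_assoc, ← hsucc (l + j) (by omega) (by omega)]
      exact Equiv.Perm.sameCycle_apply_right.2 (ih (by omega))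
  have hself : a ∈ arc σ a l := mem_arc.2 ⟨0, hl0, rfl⟩
  refine ⟨?_, ?_, ?_⟩
  · rintro (_ | _ | c)
    · exact ⟨a, if_pos hself⟩
    · refine ⟨σ^[l] a, ?_⟩
      have : ¬ σ^[l] a ∈ arc σ a l := by
        rw [hmem l hl]
        omega
      simp only [this, if_false, hLj]
    · obtain ⟨x, hx⟩ := hL.surj (some c)
      refine ⟨x, ?_⟩
      have : ¬ x ∈ arc σ a l := by
        intro h
        rw [harc x h] at hx
        cases hx
      simp only [this, if_false, hx]
  · intro x
    by_cases hx : L x = none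
    · obtain ⟨j, hj, rfl⟩ := hnone x hx
      by_cases h1 : j + 1 = l
      · have h2 : j = l - 1 := by omega
        subst h2
        rw [hend1, if_pos ((hmem _ hj).2 (by omega)), if_pos hself]
      by_cases h2 : j + 1 = k
      · have h3 : j = k - 1 := by omega
        subst h3
        rw [hend2, if_neg, if_neg, hLj, hLj]
        · rw [hmem _ hj]
          omega
        · rw [hmem _ hl]
          omega
      · rw [hsucc j (by omega) h1]
        simp only [hmem (j + 1) (by omega), hmem j hj, hLj]
        simp only [show j + 1 < l ↔ j < l by omega]
    · rw [hout x hx, hL.inv, if_neg (fun h => hx (harc x h)), if_neg]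
      intro h
      exact hx (by rw [← hL.inv]; exact harc _ h)
  · intro x y h
    by_cases hx : L x = none
    · obtain ⟨i, hi, rfl⟩ := hnone x hx
      by_cases hil : i < l
      · rw [if_pos ((hmem i hi).2 hil)] at h
        split_ifs at h with h1
        obtain ⟨j, hj, rfl⟩ := mem_arc.1 h1
        exact (hc1 i hil).symm.trans (hc1 j hj)
      · rw [if_neg (by rwa [hmem i hi]), hLj] at h
        split_ifs at h with h1
        obtain ⟨j, hj, rfl⟩ := hnone y (Option.some.inj h).symm
        rw [hmem j hj] at h1
        have e1 := hc2 (i - l) (by omega)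
        have e2 := hc2 (j - l) (by omega)
        rw [show l + (i - l) = i by omega] at e1
        rw [show l + (j - l) = j by omega] at e2
        exact e1.symm.trans e2
    · rw [if_neg (fun h' => hx (harc x h'))] at h
      split_ifs at h with h1
      obtain ⟨n, _, _, hn⟩ := (hL.same _ _ (Option.some.inj h)).exists_pow_eq''
      have hpow : ∀ n : ℕ, (ρ ^ n) x = (σ ^ n) x := by
        intro n
        induction n with
        | zero => rfl
        | succ n ih =>
          rw [pow_succ', pow_succ', Equiv.Perm.mul_apply, Equiv.Perm.mul_apply, ih]
          refine hout _ ?_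
          rwa [← apply_eq_of_sameCycle hL.inv (x := x) ⟨(n : ℕ), by rw [zpow_natCast]⟩]
      exact ⟨(n : ℕ), by rw [zpow_natCast, hpow, hn]⟩

theorem sum_option_fun {κ β : Type*} [Fintype κ] [Fintype β] [DecidableEq κ]
    (f : (Option κ → β) → ℚ) :
    ∑ w, f w = ∑ n, ∑ w : κ → β, f fun o => o.elim n w := by
  rw [← Fintype.sum_prod_type' (f := fun n (w : κ → β) => f fun o => o.elim n w)]
  refine Fintype.sum_equiv Equiv.piOptionEquivProd _ _ fun w => ?_
  congr 1
  funext o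
  cases o <;> rfl

theorem card_cut_fiber_none {κ : Type*} [DecidableEq κ] {σ : Equiv.Perm X} {L : X → Option κ}
    {a : X} {l : ℕ} (hl : l < Function.minimalPeriod σ a) :
    (Finset.univ.filter fun x => (if x ∈ arc σ a l then none else some (L x)) = none).card = l := by
  refine (congrArg Finset.card ?_).trans (card_arc (σ := σ) (a := a) hl.le)
  ext x
  simp

theorem arc_subset_fiber {κ : Type*} {σ : Equiv.Perm X} {L : X → Option κ}
    (hL : Cycles σ L) {a : X} (ha : L a = none) {l : ℕ} {x : X} (hx : x ∈ arc σ a l) :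
    L x = none := by
  obtain ⟨j, _, rfl⟩ := mem_arc.1 hx
  rw [← ha]
  exact (apply_eq_of_sameCycle hL.inv ⟨(j : ℕ), by
    rw [zpow_natCast, Equiv.Perm.iterate_eq_pow]⟩).symm

theorem card_cut_fiber_some_none {κ : Type*} [DecidableEq κ] {σ : Equiv.Perm X}
    {L : X → Option κ} (hL : Cycles σ L)
    {a : X} (ha : L a = none) {l : ℕ} (hl : l < Function.minimalPeriod σ a) :
    (Finset.univ.filter fun x =>
      (if x ∈ arc σ a l then none else some (L x)) = some none).card =
      Function.minimalPeriod σ a - l := by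
  rw [← card_fiber_none hL ha]
  conv_rhs => rw [← card_arc (σ := σ) (a := a) hl.le]
  rw [← Finset.card_sdiff_of_subset]
  · congr 1
    ext x
    simp only [Finset.mem_filter, Finset.mem_univ, true_and, Finset.mem_sdiff]
    split_ifs with h <;> simp [h]
  · intro x hx
    exact Finset.mem_filter.2 ⟨Finset.mem_univ _, arc_subset_fiber hL ha hx⟩

theorem card_cut_fiber_some_some {κ : Type*} [DecidableEq κ] {σ : Equiv.Perm X}
    {L : X → Option κ} (hL : Cycles σ L)
    {a : X} (ha : L a = none) {l : ℕ} (c : κ) :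
    (Finset.univ.filter fun x =>
      (if x ∈ arc σ a l then none else some (L x)) = some (some c)).card =
      (Finset.univ.filter fun x => L x = some c).card := by
  congr 1
  ext x
  simp only [Finset.mem_filter, Finset.mem_univ, true_and]
  split_ifs with h
  · simp [arc_subset_fiber hL ha h]
  · simp

theorem shiftState_cut {κ : Type*} [Fintype κ] [DecidableEq κ] {σ : Equiv.Perm X}
    {L : X → Option κ} (hL : Cycles σ L) {a : X} (ha : L a = none) {l : ℕ} (hl0 : 0 < l)
    (hl : l < Function.minimalPeriod σ a) (v : Fin N → ℤ) :
    shiftState N (Equiv.swap a (σ^[l] a) * σ) v = ∑ w : κ → Fin N, ∑ n, ∑ n',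
      vac N ((v - ∑ c, Pi.single (w c) ((Finset.univ.filter fun x => L x = some c).card : ℤ)) -
        Pi.single n (l : ℤ) - Pi.single n' ((Function.minimalPeriod σ a : ℤ) - l)) := by
  rw [shiftState, sum_invariant (cycles_cut hL ha hl0 hl), sum_option_fun]
  rw [Finset.sum_congr rfl fun n _ => sum_option_fun _]
  rw [Finset.sum_congr rfl fun n _ => Finset.sum_comm, Finset.sum_comm]
  refine Finset.sum_congr rfl fun w _ => Finset.sum_congr rfl fun n _ =>
    Finset.sum_congr rfl fun n' _ => ?_
  rw [cnt_comp, Fintype.sum_option, Fintype.sum_option]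
  simp only [Option.elim_none, Option.elim_some, card_cut_fiber_none hl,
    card_cut_fiber_some_none hL ha hl, card_cut_fiber_some_some hL ha, Nat.cast_sub hl.le]
  congr 1
  abel

theorem sum_same_cycle (σ : Equiv.Perm X) (a : X) (v : Fin N → ℤ) [DecidableRel σ.SameCycle] :
    ∑ b ∈ (Finset.univ.erase a).filter (σ.SameCycle a),
      shiftState N (Equiv.swap a b * σ) v =
    ∑ w : X → Fin N with w ∘ σ = w, (2 * ((v (w a) - cnt w (w a) : ℚ) + 1) +
      ∑ b ∈ (Finset.univ.erase a).filter (σ.SameCycle a), if w a = w b then 1 else 0) *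
        vac N (v - cnt w) := by
  obtain ⟨κ, _, _, L, hL, ha⟩ := exists_cycles_option σ a
  set k := Function.minimalPeriod σ a with hk
  have hs : (Finset.univ.erase a).filter (σ.SameCycle a) =
      (Finset.Ioo 0 k).image fun j => σ^[j] a := by
    ext x
    simp only [Finset.mem_filter, Finset.mem_erase, Finset.mem_univ, and_true, Finset.mem_image,
      Finset.mem_Ioo, sameCycle_iff_exists_lt]
    constructor
    · rintro ⟨hx, j, hj, rfl⟩
      refine ⟨j, ⟨Nat.pos_of_ne_zero ?_, hj⟩, rfl⟩
      rintro rfl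
      exact hx rfl
    · rintro ⟨j, ⟨h0, hj⟩, rfl⟩
      exact ⟨Function.not_isPeriodicPt_of_pos_of_lt_minimalPeriod h0.ne' hj, j, hj, rfl⟩
  have hinj : Set.InjOn (fun j => σ^[j] a) (Finset.Ioo 0 k : Finset ℕ) := by
    intro i hi j hj h
    exact iterate_inj_of_lt (Finset.mem_Ioo.1 hi).2 (Finset.mem_Ioo.1 hj).2 h
  have hcount : ∀ w ∈ Finset.univ.filter (fun w : X → Fin N => w ∘ σ = w),
      (∑ b ∈ (Finset.univ.erase a).filter (σ.SameCycle a), if w a = w b then (1 : ℚ) else 0) =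
        k - 1 := by
    intro w hw
    rw [Finset.sum_congr rfl (g := fun _ => (1 : ℚ))]
    · rw [Finset.sum_const, hs, Finset.card_image_of_injOn hinj, Nat.card_Ioo, nsmul_one,
        Nat.sub_zero, Nat.cast_sub (minimalPeriod_pos σ a), Nat.cast_one]
    · intro b hb
      rw [if_pos]
      exact apply_eq_of_sameCycle (fun x => congrFun (Finset.mem_filter.1 hw).2 x)
        (Finset.mem_filter.1 hb).2
  have hR : ∑ w : X → Fin N with w ∘ σ = w, (2 * ((v (w a) - cnt w (w a) : ℚ) + 1) +
      ∑ b ∈ (Finset.univ.erase a).filter (σ.SameCycle a), if w a = w b then 1 else 0) *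
        vac N (v - cnt w) =
      ∑ w : X → Fin N with w ∘ σ = w, (2 * ((v (w a) - cnt w (w a) : ℚ) + 1) + (k - 1)) *
        vac N (v - cnt w) :=
    Finset.sum_congr rfl fun w hw => by rw [hcount w hw]
  have hS : ∑ b ∈ (Finset.univ.erase a).filter (σ.SameCycle a),
      shiftState N (Equiv.swap a b * σ) v = ∑ l ∈ Finset.Ioo 0 k, ∑ w : κ → Fin N, ∑ n, ∑ n',
        vac N ((v - ∑ c, Pi.single (w c) ((Finset.univ.filter fun x => L x = some c).card : ℤ)) -
          Pi.single n (l : ℤ) - Pi.single n' ((k : ℤ) - l)) := by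
    rw [hs, Finset.sum_image hinj]
    exact Finset.sum_congr rfl fun l hl => shiftState_cut hL ha (Finset.mem_Ioo.1 hl).1
      (Finset.mem_Ioo.1 hl).2 v
  rw [hR, hS, sum_invariant hL, sum_option_fun, Finset.sum_comm]
  conv_rhs => rw [Finset.sum_comm]
  refine Finset.sum_congr rfl fun w _ => ?_
  set v' : Fin N → ℤ :=
    v - ∑ c, Pi.single (w c) ((Finset.univ.filter fun x => L x = some c).card : ℤ) with hv'
  have hcnt : ∀ n : Fin N, v - cnt ((fun o : Option κ => o.elim n w) ∘ L) =
      v' - Pi.single n (k : ℤ) := by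
    intro n
    rw [cnt_comp, Fintype.sum_option, hv']
    simp only [Option.elim_none, Option.elim_some, card_fiber_none hL ha]
    abel
  have hcast : ∀ f : ℤ → ℚ, ∑ l ∈ Finset.Ioo 0 k, f l = ∑ l ∈ Finset.Ioo 0 (k : ℤ), f l := by
    intro f
    refine Finset.sum_bij (fun l _ => (l : ℤ)) ?_ ?_ ?_ ?_
    · intro l hl
      rw [Finset.mem_Ioo] at hl ⊢
      omega
    · intro i _ j _ h
      exact_mod_cast h
    · intro l hl
      rw [Finset.mem_Ioo] at hl
      exact ⟨l.toNat, by rw [Finset.mem_Ioo]; omega, by omega⟩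
    · intro l _
      rfl
  have hsplit : ∀ (l : ℤ) (n : Fin N),
      ∑ n', vac N (v' - Pi.single n l - Pi.single n' ((k : ℤ) - l)) =
      vac N (v' - Pi.single n (k : ℤ)) +
        ∑ n' ∈ Finset.univ.erase n, vac N (v' - Pi.single n l - Pi.single n' ((k : ℤ) - l)) := by
    intro l n
    rw [← Finset.add_sum_erase _ _ (Finset.mem_univ n)]
    congr 2
    rw [sub_sub, ← Pi.single_add, add_sub_cancel]
  rw [hcast fun l => ∑ n, ∑ n', vac N (v' - (Pi.single n l : Fin N → ℤ) -
    (Pi.single n' ((k : ℤ) - l) : Fin N → ℤ))]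
  simp only [hsplit, Finset.sum_add_distrib]
  rw [vac_cut_identity k (by exact_mod_cast minimalPeriod_pos σ a) v', Finset.sum_const,
    Int.card_Ioo, Finset.mul_sum, Finset.smul_sum, ← Finset.sum_add_distrib]
  refine Finset.sum_congr rfl fun n _ => ?_
  have h1 : (v ((fun o : Option κ => o.elim n w) (L a)) : ℚ) -
      cnt ((fun o : Option κ => o.elim n w) ∘ L) ((fun o : Option κ => o.elim n w) (L a)) =
      v' n - k := by
    have := congrFun (hcnt n) n
    simp only [Pi.sub_apply, Pi.single_eq_same] at this
    simp only [ha, Option.elim_none]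
    exact_mod_cast this
  have h2 : (((k : ℤ) - 0 - 1).toNat : ℚ) = k - 1 := by
    have : 0 < k := minimalPeriod_pos σ a
    rw [show ((k : ℤ) - 0 - 1).toNat = k - 1 by omega, Nat.cast_sub this, Nat.cast_one]
  simp only [Function.comp_apply] at h1 ⊢
  rw [hcnt, h1, nsmul_eq_mul, h2]
  push_cast
  ring

open Classical in
/-- The cut-and-join equation. -/
theorem oneBody_diagWeight_shiftState (σ : Equiv.Perm X) :
    oneBody 0 (diagWeight N) (shiftState N σ) =
      ∑ τ : Equiv.Perm X with τ.IsSwap, shiftState N (τ * σ) := by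
  funext v
  rw [diag_apply, Finset.sum_apply]
  have h := sum_swap_offDiag (X := X) fun τ => shiftState N (τ * σ) v
  have h2 : (∑ i, diagWeight N (v i)) * shiftState N σ v =
      (1 / 2) * ∑ a, ∑ b ∈ Finset.univ.erase a, shiftState N (Equiv.swap a b * σ) v := by
    rw [shiftState, Finset.mul_sum, Finset.sum_congr rfl fun w _ => sum_diagWeight_mul_vac w v,
      ← Finset.mul_sum, Finset.sum_comm]
    congr 1
    refine Finset.sum_congr rfl fun a _ => ?_
    rw [← Finset.sum_filter_add_sum_filter_not (Finset.univ.erase a) (σ.SameCycle a)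
      (fun b => shiftState N (Equiv.swap a b * σ) v), sum_same_cycle]
    have h3 : ∑ b ∈ (Finset.univ.erase a).filter fun b => ¬σ.SameCycle a b,
        shiftState N (Equiv.swap a b * σ) v =
        ∑ w : X → Fin N with w ∘ σ = w,
          (∑ b ∈ (Finset.univ.erase a).filter fun b => ¬σ.SameCycle a b,
            if w a = w b then (1 : ℚ) else 0) * vac N (v - cnt w) := by
      simp only [Finset.sum_mul]
      rw [Finset.sum_comm]
      refine Finset.sum_congr rfl fun b hb => ?_
      simp only [shiftState, invariant_swap_mul_iff (Finset.mem_filter.1 hb).2, ite_mul, one_mul,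
        zero_mul]
      rw [← Finset.sum_filter, Finset.filter_filter]
    rw [h3, ← Finset.sum_add_distrib]
    refine Finset.sum_congr rfl fun w _ => ?_
    rw [← Finset.sum_filter_add_sum_filter_not (Finset.univ.erase a) (σ.SameCycle a)
      (fun b => if w a = w b then (1 : ℚ) else 0)]
    ring
  rw [h2, h]
  ring

end Fermion

namespace Fermion

universe u

variable {N : ℕ}

/-- The vacuum acted on by raising operators. -/
def raise (N : ℕ) (l : List ℤ) : (Fin N → ℤ) → ℚ := state N (l.map fun k => (-k, bulk N))

@[simp] theorem raise_nil : raise N [] = vac N := rfl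

@[simp] theorem raise_cons (k : ℤ) (l : List ℤ) :
    raise N (k :: l) = oneBody (-k) (bulk N) (raise N l) := rfl

theorem bulk_of_lt {j : ℤ} (h : j < -N) : bulk N j = 0 := if_pos h

theorem bulk_of_le {j : ℤ} (h : -(N : ℤ) ≤ j) : bulk N j = 1 := if_neg (not_lt.2 h)

theorem raise_alt (l : List ℤ) : IsAlt (raise N l) := state_alt _

theorem raise_supp (l : List ℤ) : IsSupp (raise N l) := by
  refine state_supp _ fun a ha j hj => ?_
  obtain ⟨k, _, rfl⟩ := List.mem_map.1 ha
  exact bulk_of_lt hj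

theorem oneBody_bulk_of_supp {F : (Fin N → ℤ) → ℚ} (hF : IsSupp F) {k : ℤ} (hk : 0 < k)
    (v : Fin N → ℤ) : oneBody (-k) (bulk N) F v = ∑ n, F (v - Pi.single n k) := by
  refine Finset.sum_congr rfl fun n _ => ?_
  have : Function.update v n (v n + -k) = v - Pi.single n k := by
    funext x
    by_cases hx : x = n
    · subst hx
      simp
      ring
    · simp [hx]
  rw [this]
  by_cases h : v n < -N
  · rw [hF _ n, mul_zero]
    simp
    omega
  · rw [bulk_of_le (by omega), one_mul]

theorem oneBody_bulk_comm {F : (Fin N → ℤ) → ℚ} (hF : IsSupp F) {k l : ℤ} (hk : 0 < k)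
    (hl : 0 < l) : oneBody (-k) (bulk N) (oneBody (-l) (bulk N) F) =
      oneBody (-l) (bulk N) (oneBody (-k) (bulk N) F) := by
  rw [oneBody_comm, add_eq_left]
  funext v
  refine Finset.sum_eq_zero fun i _ => ?_
  simp only [commWeight]
  by_cases h : v i + (-k + -l) < -N
  · rw [hF _ i (by simpa using h), mul_zero]
  · rw [bulk_of_le (j := v i) (by omega), bulk_of_le (j := v i + -k) (by omega),
      bulk_of_le (j := v i + -l) (by omega)]
    ring

theorem raise_perm {l l' : List ℤ} (h : l.Perm l') (hl : ∀ k ∈ l, 0 < k) :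
    raise N l = raise N l' := by
  induction h with
  | nil => rfl
  | cons k _ ih =>
    rw [raise_cons, raise_cons, ih fun k' hk' => hl k' (List.mem_cons_of_mem _ hk')]
  | swap k k' l =>
    simp only [raise_cons]
    exact oneBody_bulk_comm (raise_supp l) (hl _ (by simp)) (hl _ (by simp))
  | trans h1 _ ih1 ih2 =>
    rw [ih1 hl, ih2 fun k hk => hl k (h1.mem_iff.2 hk)]

variable {ι : Type*}

/-- The state obtained by raising with the sizes indexed by a finite set. -/
noncomputable def genState (N : ℕ) (lam : ι → ℤ) (S : Finset ι) : (Fin N → ℤ) → ℚ :=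
  raise N (S.toList.map lam)

theorem genState_empty (lam : ι → ℤ) : genState N lam ∅ = vac N := by
  simp [genState]

theorem genState_insert [DecidableEq ι] {lam : ι → ℤ} (hlam : ∀ i, 0 < lam i) {i : ι}
    {S : Finset ι} (hi : i ∉ S) :
    genState N lam (insert i S) = oneBody (-(lam i)) (bulk N) (genState N lam S) := by
  rw [genState, genState, ← raise_cons, ← List.map_cons]
  refine raise_perm ((Finset.toList_insert hi).map lam) fun k hk => ?_
  obtain ⟨j, _, rfl⟩ := List.mem_map.1 hk
  exact hlam j

theorem genState_alt (lam : ι → ℤ) (S : Finset ι) : IsAlt (genState N lam S) := raise_alt _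

theorem genState_supp (lam : ι → ℤ) (S : Finset ι) : IsSupp (genState N lam S) := raise_supp _

/-- All of the `M` lowest positions are filled wherever `F` does not vanish. -/
def Filled (M : ℤ) (F : (Fin N → ℤ) → ℚ) : Prop :=
  ∀ v, F v ≠ 0 → ∀ j : ℤ, -(N : ℤ) ≤ j → j < -N + M → ∃ i, v i = j

theorem vac_filled : Filled (N : ℤ) (vac N) := by
  intro v hv j h1 h2
  obtain ⟨b, rfl⟩ := exists_sea_eq h1 (by omega)
  exact sea_mem_of_vac_ne_zero hv b

theorem IsAlt.injective_of_ne_zero {F : (Fin N → ℤ) → ℚ} (hF : IsAlt F) {v : Fin N → ℤ}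
    (hv : F v ≠ 0) : Function.Injective v := by
  intro i j hij
  by_contra h
  exact hv (hF.eq_zero h hij)

theorem Filled.oneBody {F : (Fin N → ℤ) → ℚ} {M : ℤ} (hF : Filled M F) (hA : IsAlt F) {k : ℤ}
    (hk : 0 < k) (w : ℤ → ℚ) : Filled (M - k) (oneBody (-k) w F) := by
  intro v hv j h1 h2
  have hinj := (hA.oneBody (-k) w).injective_of_ne_zero hv
  obtain ⟨i, _, hi⟩ := Finset.exists_ne_zero_of_sum_ne_zero hv
  have hi' := right_ne_zero_of_mul hi
  obtain ⟨a, ha⟩ := hF _ hi' j h1 (by omega)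
  by_cases hai : a = i
  · subst hai
    obtain ⟨a', ha'⟩ := hF _ hi' (j + k) (by omega) (by omega)
    rw [Function.update_self] at ha
    by_cases haa : a' = a
    · subst haa
      rw [Function.update_self] at ha'
      omega
    · rw [Function.update_of_ne haa] at ha'
      exact absurd (hinj (ha'.trans (by omega))) haa
  · rw [Function.update_of_ne hai] at ha
    exact ⟨a, ha⟩

theorem genState_filled [DecidableEq ι] {lam : ι → ℤ} (hlam : ∀ i, 0 < lam i) (S : Finset ι) :
    Filled (N - ∑ i ∈ S, lam i) (genState N lam S) := by
  induction S using Finset.induction_on with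
  | empty => simpa [genState_empty] using vac_filled
  | insert i S hi ih =>
    rw [genState_insert hlam hi, Finset.sum_insert hi, add_comm, ← sub_sub]
    exact ih.oneBody (genState_alt _ _) (hlam i) _

theorem oneBody_comm_filled {F : (Fin N → ℤ) → ℚ} {M : ℤ} (hF : Filled M F) (hA : IsAlt F)
    (hS : IsSupp F) {k s : ℤ} (hk : 0 < k) (hs : 0 < s) (hM : s ≤ M) :
    oneBody (k + -s) (commWeight k (bulk N) (-s) (bulk N)) F =
      if s = k then (k : ℚ) • F else 0 := by
  have hw : ∀ j : ℤ, -(N : ℤ) + s ≤ j → commWeight k (bulk N) (-s) (bulk N) j = 0 := by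
    intro j hj
    rw [commWeight, bulk_of_le (j := j) (by omega), bulk_of_le (j := j + k) (by omega),
      bulk_of_le (j := j + -s) (by omega)]
    ring
  have hw1 : ∀ j : ℤ, -(N : ℤ) ≤ j → j < -N + s →
      commWeight k (bulk N) (-s) (bulk N) j = 1 := by
    intro j hj hj'
    rw [commWeight, bulk_of_le (j := j) (by omega), bulk_of_le (j := j + k) (by omega),
      bulk_of_lt (j := j + -s) (by omega)]
    ring
  have hw0 : ∀ j : ℤ, j < -N → commWeight k (bulk N) (-s) (bulk N) j = 0 := by
    intro j hj
    rw [commWeight, bulk_of_lt (j := j) (by omega)]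
    ring
  funext v
  split_ifs with hsk
  · subst hsk
    rw [add_neg_cancel, diag_apply, Pi.smul_apply, smul_eq_mul]
    by_cases hv : F v = 0
    · simp [hv]
    congr 1
    have hinj := hA.injective_of_ne_zero hv
    have h1 : ∀ i, commWeight s (bulk N) (-s) (bulk N) (v i) =
        if v i ∈ Finset.Ico (-(N : ℤ)) (-N + s) then 1 else 0 := by
      intro i
      split_ifs with h
      · rw [Finset.mem_Ico] at h
        exact hw1 _ h.1 h.2
      · rw [Finset.mem_Ico] at h
        by_cases h2 : v i < -N
        · exact hw0 _ h2
        · exact hw _ (by omega)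
    rw [Finset.sum_congr rfl fun i _ => h1 i, ← Finset.sum_filter, Finset.sum_const, nsmul_one]
    have h2 : (Finset.univ.filter fun i => v i ∈ Finset.Ico (-(N : ℤ)) (-N + s)).image v =
        Finset.Ico (-(N : ℤ)) (-N + s) := by
      ext j
      simp only [Finset.mem_image, Finset.mem_filter, Finset.mem_univ, true_and]
      constructor
      · rintro ⟨i, hi, rfl⟩
        exact hi
      · intro hj
        have hj' := Finset.mem_Ico.1 hj
        obtain ⟨i, rfl⟩ := hF v hv j hj'.1 (by omega)
        exact ⟨i, hj, rfl⟩
    rw [← Finset.card_image_of_injective _ hinj, h2, Int.card_Ico]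
    have : ((-(N : ℤ) + s - -N).toNat : ℤ) = s := by omega
    exact_mod_cast congrArg (Int.cast : ℤ → ℚ) this
  · rw [Pi.zero_apply]
    by_cases hinj : Function.Injective v
    · refine Finset.sum_eq_zero fun i _ => ?_
      by_cases h1 : -(N : ℤ) ≤ v i ∧ v i < -N + s
      · by_contra h
        have h2 := right_ne_zero_of_mul h
        obtain ⟨a, ha⟩ := hF _ h2 (v i) h1.1 (by omega)
        by_cases hai : a = i
        · subst hai
          rw [Function.update_self] at ha
          omega
        · rw [Function.update_of_ne hai] at ha
          exact hai (hinj ha)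
      · by_cases h2 : v i < -N
        · rw [hw0 _ h2, zero_mul]
        · rw [hw _ (by omega), zero_mul]
    · by_contra h
      exact hinj ((hA.oneBody _ _).injective_of_ne_zero h)

theorem oneBody_finset_sum {α : Type*} (k : ℤ) (w : ℤ → ℚ) (s : Finset α)
    (f : α → (Fin N → ℤ) → ℚ) : oneBody k w (∑ i ∈ s, f i) = ∑ i ∈ s, oneBody k w (f i) := by
  classical
  induction s using Finset.induction_on with
  | empty => simp [oneBody_zero]
  | insert i s hi ih => rw [Finset.sum_insert hi, Finset.sum_insert hi, oneBody_add, ih]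

theorem lower_vac {k : ℤ} (hk : 0 < k) : oneBody k (bulk N) (vac N) = 0 :=
  oneBody_vac_of_pos hk (fun j hj => bulk_of_lt hj)

theorem lower_genState [DecidableEq ι] {lam : ι → ℤ} (hlam : ∀ i, 0 < lam i) {k : ℤ} (hk : 0 < k)
    (S : Finset ι) (hN : ∑ i ∈ S, lam i ≤ N) :
    oneBody k (bulk N) (genState N lam S) =
      ∑ i ∈ S with lam i = k, (k : ℚ) • genState N lam (S.erase i) := by
  induction S using Finset.induction_on with
  | empty => simp [genState_empty, lower_vac hk]
  | insert i S hi ih =>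
    rw [Finset.sum_insert hi] at hN
    have hi0 := hlam i
    rw [genState_insert hlam hi, oneBody_comm, ih (by omega),
      oneBody_comm_filled (genState_filled hlam S) (genState_alt _ _) (genState_supp _ _) hk
      (hlam i) (by omega), Finset.filter_insert]
    have h1 : oneBody (-(lam i)) (bulk N)
        (∑ i' ∈ S with lam i' = k, (k : ℚ) • genState N lam (S.erase i')) =
        ∑ i' ∈ S with lam i' = k, (k : ℚ) • genState N lam ((insert i S).erase i') := by
      rw [oneBody_finset_sum]
      refine Finset.sum_congr rfl fun i' hi' => ?_
      have hne : i' ≠ i := by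
        rintro rfl
        exact hi (Finset.mem_filter.1 hi').1
      rw [oneBody_smul, Finset.erase_insert_of_ne hne.symm, genState_insert hlam]
      exact fun h => hi (Finset.mem_of_mem_erase h)
    rw [h1]
    split_ifs with h2
    · rw [Finset.sum_insert, Finset.erase_insert hi, add_comm]
      exact fun h => hi (Finset.mem_filter.1 h).1
    · rw [add_zero]

end Fermion

namespace Fermion

universe u

variable {N : ℕ} {ι κ : Type*}

/-- Successive application of lowering operators. -/
def lowerAll (N : ℕ) (l : List ℤ) (F : (Fin N → ℤ) → ℚ) : (Fin N → ℤ) → ℚ :=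
  (l.map fun k => (k, bulk N)).foldr (fun a F => oneBody a.1 a.2 F) F

@[simp] theorem lowerAll_nil (F : (Fin N → ℤ) → ℚ) : lowerAll N [] F = F := rfl

@[simp] theorem lowerAll_cons (k : ℤ) (l : List ℤ) (F : (Fin N → ℤ) → ℚ) :
    lowerAll N (k :: l) F = oneBody k (bulk N) (lowerAll N l F) := rfl

theorem lowerAll_finset_sum {α : Type*} (l : List ℤ) (s : Finset α)
    (f : α → (Fin N → ℤ) → ℚ) : lowerAll N l (∑ i ∈ s, f i) = ∑ i ∈ s, lowerAll N l (f i) := by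
  induction l with
  | nil => simp
  | cons k l ih =>
    simp only [lowerAll_cons]
    rw [ih, oneBody_finset_sum]

open Classical in
theorem lowerAll_genState [Fintype ι] {lam : ι → ℤ} (hlam : ∀ i, 0 < lam i)
    (hN : ∑ i, lam i ≤ N) {r : ℕ} (nu : Fin r → ℤ) (hnu : ∀ t, 0 < nu t) :
    lowerAll N (List.ofFn nu) (genState N lam Finset.univ) =
      ∑ e : Fin r → ι with Function.Injective e ∧ ∀ t, lam (e t) = nu t,
        ((∏ t, nu t : ℤ) : ℚ) • genState N lam (Finset.univ \ Finset.univ.image e) := by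
  induction r with
  | zero =>
    rw [Finset.sum_eq_single_of_mem (fun t => t.elim0)]
    · have : (Finset.univ.image fun t : Fin 0 => (t.elim0 : ι)) = ∅ := rfl
      rw [this]
      simp
    · exact Finset.mem_filter.2 ⟨Finset.mem_univ _, fun t => t.elim0, fun t => t.elim0⟩
    · intro b _ hb
      exact absurd (Subsingleton.elim _ _) hb
  | succ r ih =>
    rw [List.ofFn_succ, lowerAll_cons, ih _ fun t => hnu _, oneBody_finset_sum]
    have hle : ∀ T : Finset ι, ∑ i ∈ T, lam i ≤ N := fun T =>
      (Finset.sum_le_univ_sum_of_nonneg fun i => (hlam i).le).trans hN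
    have h1 : ∀ e : Fin r → ι, oneBody (nu 0) (bulk N) (((∏ t, nu (Fin.succ t) : ℤ) : ℚ) •
        genState N lam (Finset.univ \ Finset.univ.image e)) =
        ∑ i ∈ (Finset.univ \ Finset.univ.image e).filter (fun i => lam i = nu 0),
          ((∏ t, nu t : ℤ) : ℚ) •
            genState N lam ((Finset.univ \ Finset.univ.image e).erase i) := by
      intro e
      rw [oneBody_smul, lower_genState hlam (hnu 0) _ (hle _), Finset.smul_sum]
      refine Finset.sum_congr rfl fun i _ => ?_
      rw [smul_smul, Fin.prod_univ_succ, mul_comm]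
      push_cast
      rfl
    rw [Finset.sum_congr rfl fun e _ => h1 e, Finset.sum_sigma']
    refine Finset.sum_bij' (fun p _ => Fin.cons p.2 p.1) (fun e _ => ⟨Fin.tail e, e 0⟩)
      ?_ ?_ ?_ ?_ ?_
    · rintro ⟨e, i⟩ h
      simp only [Finset.mem_sigma, Finset.mem_filter, Finset.mem_univ, true_and, Finset.mem_sdiff,
        Finset.mem_image, not_exists] at h ⊢
      refine ⟨Fin.cons_injective_iff.2 ⟨fun ⟨t, ht⟩ => h.2.1 t ht, h.1.1⟩, ?_⟩
      intro t
      refine Fin.cases ?_ (fun t => ?_) t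
      · exact h.2.2
      · exact h.1.2 t
    · intro e h
      simp only [Finset.mem_sigma, Finset.mem_filter, Finset.mem_univ, true_and, Finset.mem_sdiff,
        Finset.mem_image, not_exists] at h ⊢
      refine ⟨⟨h.1.comp (Fin.succ_injective r), fun t => h.2 _⟩, fun t ht => ?_, h.2 0⟩
      exact Fin.succ_ne_zero t (h.1 ht)
    · rintro ⟨e, i⟩ _
      simp
    · intro e _
      simp
    · rintro ⟨e, i⟩ _
      congr 2
      ext x
      simp only [Finset.mem_erase, Finset.mem_sdiff, Finset.mem_univ, true_and, Finset.mem_image,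
        not_exists, Fin.forall_fin_succ, Fin.cons_zero, Fin.cons_succ]
      tauto

theorem genState_sea [DecidableEq ι] {lam : ι → ℤ} (hlam : ∀ i, 0 < lam i) (T : Finset ι) :
    genState N lam T (sea N) = if T = ∅ then 1 else 0 := by
  split_ifs with h
  · rw [h, genState_empty, vac_sea]
  · obtain ⟨i, hi⟩ := Finset.nonempty_iff_ne_empty.2 h
    rw [← Finset.insert_erase hi, genState_insert hlam (Finset.notMem_erase i T)]
    exact oneBody_sea_of_neg (genState_alt _ _) (genState_supp _ _) (by have := hlam i; omega) _

theorem lowerAll_genState_sea [Fintype ι] {lam : ι → ℤ} (hlam : ∀ i, 0 < lam i)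
    (hN : ∑ i, lam i ≤ N) {r : ℕ} (nu : Fin r → ℤ) (hnu : ∀ t, 0 < nu t) :
    lowerAll N (List.ofFn nu) (genState N lam Finset.univ) (sea N) =
      ((∏ t, nu t : ℤ) : ℚ) *
        Nat.card {e : Fin r → ι // Function.Bijective e ∧ ∀ t, lam (e t) = nu t} := by
  classical
  rw [lowerAll_genState hlam hN nu hnu, Finset.sum_apply]
  simp only [Pi.smul_apply, genState_sea hlam, smul_eq_mul, mul_ite, mul_one, mul_zero]
  rw [← Finset.sum_filter, Finset.sum_const, nsmul_eq_mul, mul_comm, Nat.card_eq_fintype_card,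
    Fintype.card_subtype, Finset.filter_filter]
  congr 4
  ext e
  rw [Finset.sdiff_eq_empty_iff_subset, Function.Bijective, and_right_comm]
  refine and_congr_left fun _ => and_congr_right fun _ => ?_
  constructor
  · intro h i
    obtain ⟨t, _, ht⟩ := Finset.mem_image.1 (h (Finset.mem_univ i))
    exact ⟨t, ht⟩
  · intro h i _
    obtain ⟨t, ht⟩ := h i
    exact Finset.mem_image.2 ⟨t, Finset.mem_univ _, ht⟩

theorem genState_eq_of_perm {α : Type*} {lam : ι → ℤ} {lam' : α → ℤ} (hlam : ∀ i, 0 < lam i)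
    {S : Finset ι} {T : Finset α} (h : S.val.map lam = T.val.map lam') :
    genState N lam S = genState N lam' T := by
  refine raise_perm ?_ fun k hk => ?_
  · rw [← Multiset.coe_eq_coe, ← Multiset.map_coe, ← Multiset.map_coe, Finset.coe_toList,
      Finset.coe_toList, h]
  · obtain ⟨j, _, rfl⟩ := List.mem_map.1 hk
    exact hlam j

theorem genState_univ_apply (ι : Type u) [Fintype ι] :
    ∀ [DecidableEq ι] (lam : ι → ℤ), (∀ i, 0 < lam i) → ∀ v : Fin N → ℤ,
    genState N lam Finset.univ v =
      ∑ w : ι → Fin N, vac N (v - ∑ i, (Pi.single (w i) (lam i) : Fin N → ℤ)) := by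
  refine Fintype.induction_empty_option (P := fun ι _ => ∀ [DecidableEq ι] (lam : ι → ℤ), (∀ i, 0 < lam i) →
    ∀ v : Fin N → ℤ, genState N lam Finset.univ v =
      ∑ w : ι → Fin N, vac N (v - ∑ i, (Pi.single (w i) (lam i) : Fin N → ℤ))) ?_ ?_ ?_ ι
  · intro α β _ e h _ lam hlam v
    let _ : Fintype α := Fintype.ofEquiv β e.symm
    have : DecidableEq α := e.injective.decidableEq
    have h1 := h (lam ∘ e) (fun i => hlam _) v
    rw [genState_eq_of_perm hlam (T := Finset.univ) (lam' := lam ∘ e), h1]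
    · refine Fintype.sum_equiv (Equiv.arrowCongr e (Equiv.refl _)) _ _ fun w => ?_
      congr 2
      refine Fintype.sum_equiv e _ _ fun i => ?_
      simp
    · rw [← Multiset.map_map]
      congr 1
      have := Finset.map_univ_equiv e
      exact (congrArg Finset.val this).symm
  · intro _ lam _ v
    have : (Finset.univ : Finset PEmpty) = ∅ := rfl
    rw [this, genState_empty]
    simp
  · intro α _ ih instO lam hlam v
    classical
    have instO_eq : instO = Option.instDecidableEq := Subsingleton.elim _ _
    subst instO_eq
    have h1 : genState N lam Finset.univ =
        oneBody (-(lam none)) (bulk N) (genState N (lam ∘ some) Finset.univ) := by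
      have h2 : (Finset.univ : Finset (Option α)) =
          insert none (Finset.univ.map Function.Embedding.some) := by
        ext x
        cases x <;> simp
      rw [h2, genState_insert hlam (by simp)]
      congr 1
      refine genState_eq_of_perm hlam ?_
      rw [Finset.map_val, Multiset.map_map]
      rfl
    rw [h1, oneBody_bulk_of_supp (genState_supp _ _) (hlam none), sum_option_fun]
    refine Finset.sum_congr rfl fun n _ => ?_
    rw [ih (lam ∘ some) fun i => hlam _]
    refine Finset.sum_congr rfl fun w _ => ?_
    rw [Fintype.sum_option, sub_sub]
    rfl

end Fermion

namespace Fermion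

variable {N : ℕ} {X : Type} {ι κ : Type}

/-- `L` labels the cycles of `σ` by the indices `j` with `ν j ≠ 0`, the cycle labelled `j`
having length `ν j`. -/
structure Lab (σ : Equiv.Perm X) (ν : κ → ℕ) (L : X → κ) : Prop where
  inv : ∀ x, L (σ x) = L x
  card : ∀ j, Nat.card {x // L x = j} = ν j
  same : ∀ x y, L x = L y → σ.SameCycle x y

theorem Lab.pos [Finite X] {σ : Equiv.Perm X} {ν : κ → ℕ} {L : X → κ} (h : Lab σ ν L) (x : X) :
    0 < ν (L x) := by
  rw [← h.card]
  have : Nonempty {y // L y = L x} := ⟨⟨x, rfl⟩⟩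
  exact Nat.card_pos

theorem Lab.sum_eq [Fintype X] [Fintype κ] {σ : Equiv.Perm X} {ν : κ → ℕ} {L : X → κ}
    (h : Lab σ ν L) : ∑ j, ν j = Fintype.card X := by
  rw [← Nat.card_eq_fintype_card, ← Nat.card_congr (Equiv.sigmaFiberEquiv L), Nat.card_sigma]
  exact Finset.sum_congr rfl fun j _ => (h.card j).symm

theorem card_lab_comp [Finite X] (σ : Equiv.Perm X) (ν : κ → ℕ) {f : ι → κ}
    (hf : Function.Injective f) (h0 : ∀ j, ν j ≠ 0 → j ∈ Set.range f) :
    Nat.card {L : X → ι // Lab σ (ν ∘ f) L} = Nat.card {L : X → κ // Lab σ ν L} := by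
  refine Nat.card_eq_of_bijective (fun L => ⟨f ∘ L.1, ?_, ?_, ?_⟩) ⟨?_, ?_⟩
  · exact fun x => congrArg f (L.2.inv x)
  · intro j
    by_cases hj : ν j = 0
    · rw [hj, Nat.card_eq_zero]
      refine Or.inl ⟨fun x => ?_⟩
      have := L.2.pos x.1
      have hx : f (L.1 x.1) = j := x.2
      simp only [Function.comp, hx, hj] at this
      exact lt_irrefl _ this
    · obtain ⟨i, rfl⟩ := h0 j hj
      simp only [Function.comp, hf.eq_iff]
      exact L.2.card i
  · exact fun x y h => L.2.same x y (hf h)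
  · intro L L' h
    ext x
    exact hf (congrFun (congrArg Subtype.val h) x)
  · rintro ⟨L, hL⟩
    have hr : ∀ x, L x ∈ Set.range f := fun x => h0 _ (hL.pos x).ne'
    choose g hg using hr
    have hgL : f ∘ g = L := funext hg
    refine ⟨⟨g, ?_, ?_, ?_⟩, Subtype.ext hgL⟩
    · exact fun x => hf (by rw [hg, hg, hL.inv])
    · intro i
      rw [Function.comp, ← hL.card]
      simp only [← hg, hf.eq_iff]
    · exact fun x y h => hL.same x y (by rw [← hg, ← hg, h])

theorem exists_cycles [Finite X] (σ : Equiv.Perm X) :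
    ∃ (κ : Type) (_ : Fintype κ) (_ : DecidableEq κ) (L : X → κ), Cycles σ L := by
  classical
  let s := Equiv.Perm.SameCycle.setoid σ
  refine ⟨Quotient s, Fintype.ofFinite _, Classical.decEq _, Quotient.mk s, ?_, ?_, ?_⟩
  · exact Quotient.mk_surjective
  · intro x
    exact Quotient.sound (Equiv.Perm.sameCycle_apply_left.2 (Equiv.Perm.SameCycle.refl σ x))
  · intro x y h
    exact Quotient.exact h

section

variable [Fintype X] [DecidableEq X]

theorem shiftState_eq_genState [Fintype ι] [DecidableEq ι] {σ : Equiv.Perm X} {L : X → ι}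
    (hL : Cycles σ L) :
    shiftState N σ =
      genState N (fun i => ((Finset.univ.filter fun x => L x = i).card : ℤ)) Finset.univ := by
  funext v
  rw [genState_univ_apply, shiftState, sum_invariant hL]
  · simp only [cnt_comp]
  · intro i
    obtain ⟨x, hx⟩ := hL.surj i
    exact_mod_cast Finset.card_pos.2 ⟨x, by simp [hx]⟩

theorem card_matchings [Fintype ι] [DecidableEq ι] {σ : Equiv.Perm X} {L : X → ι}
    (hL : Cycles σ L) (nu : κ → ℕ) (hnu : ∀ t, 0 < nu t) :
    Nat.card {e : κ → ι // Function.Bijective e ∧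
      ∀ t, ((Finset.univ.filter fun x => L x = e t).card : ℤ) = nu t} =
    Nat.card {L : X → κ // Lab σ nu L} := by
  have hc : ∀ i, Nat.card {x // L x = i} = (Finset.univ.filter fun x => L x = i).card := by
    intro i
    rw [Nat.card_eq_fintype_card, Fintype.card_subtype]
  refine Nat.card_eq_of_bijective
    (fun e => ⟨fun x => (Equiv.ofBijective e.1 e.2.1).symm (L x), ?_, ?_, ?_⟩) ⟨?_, ?_⟩
  · exact fun x => by rw [hL.inv]
  · intro t
    simp only [Equiv.symm_apply_eq, Equiv.ofBijective_apply]
    rw [hc]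
    exact_mod_cast e.2.2 t
  · exact fun x y h => hL.same x y ((Equiv.injective _) h)
  · rintro ⟨e, he, he'⟩ ⟨f, hf, hf'⟩ h
    have h1 := fun x => congrFun (congrArg Subtype.val h) x
    ext t
    obtain ⟨x, hx⟩ := hL.surj (e t)
    have h2 := h1 x
    simp only [hx] at h2
    have h3 := Equiv.ofBijective_apply_symm_apply f hf (e t)
    rw [← h2] at h3
    have h4 : (Equiv.ofBijective e he).symm (e t) = t := Equiv.ofBijective_symm_apply_apply e he t
    rw [h4] at h3
    exact h3.symm
  · rintro ⟨M, hM⟩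
    have hs : Function.Surjective M := by
      intro t
      have := hnu t
      rw [← hM.card, Nat.card_pos_iff] at this
      obtain ⟨⟨x, hx⟩⟩ := this.1
      exact ⟨x, hx⟩
    have hML : ∀ x y, M x = M y ↔ L x = L y := fun x y =>
      ⟨fun h => apply_eq_of_sameCycle hL.inv (hM.same _ _ h),
        fun h => apply_eq_of_sameCycle hM.inv (hL.same _ _ h)⟩
    have he : ∀ x, L (Function.surjInv hs (M x)) = L x := fun x =>
      (hML _ _).1 (Function.surjInv_eq hs _)
    have hb : Function.Bijective fun t => L (Function.surjInv hs t) := by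
      constructor
      · intro t t' h
        have := (hML _ _).2 h
        rwa [Function.surjInv_eq hs, Function.surjInv_eq hs] at this
      · intro i
        obtain ⟨x, rfl⟩ := hL.surj i
        exact ⟨M x, he x⟩
    refine ⟨⟨fun t => L (Function.surjInv hs t), hb, ?_⟩, ?_⟩
    · intro t
      rw [← hc, ← hM.card t]
      simp only [← hML, Function.surjInv_eq hs]
    · ext x
      simp only [Equiv.symm_apply_eq, Equiv.ofBijective_apply, he]

theorem lowerAll_shiftState (σ : Equiv.Perm X) {r : ℕ} (nu : Fin r → ℕ) (hnu : ∀ t, 0 < nu t)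
    (hN : Fintype.card X ≤ N) :
    lowerAll N (List.ofFn fun t => (nu t : ℤ)) (shiftState N σ) (sea N) =
      ((∏ t, nu t : ℕ) : ℚ) * Nat.card {L : X → Fin r // Lab σ nu L} := by
  obtain ⟨ι, _, _, L, hL⟩ := exists_cycles σ
  rw [shiftState_eq_genState hL, lowerAll_genState_sea, card_matchings hL nu hnu]
  · push_cast
    rfl
  · intro i
    obtain ⟨x, hx⟩ := hL.surj i
    exact_mod_cast Finset.card_pos.2 ⟨x, by simp [hx]⟩
  · have := Finset.card_eq_sum_card_fiberwise (f := L) (s := Finset.univ) (t := Finset.univ)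
      (fun _ _ => Finset.mem_coe.2 (Finset.mem_univ _))
    rw [Finset.card_univ] at this
    exact_mod_cast this ▸ hN
  · exact fun t => by exact_mod_cast hnu t

end

section

variable [Fintype X] [DecidableEq X]

open Classical in
/-- The sum of `f` over the ends of all sequences of `b` left multiplications of `σ` by
transpositions. -/
noncomputable def pathSum {M : Type*} [AddCommMonoid M] : ℕ → (Equiv.Perm X → M) → Equiv.Perm X → M
  | 0, f, σ => f σ
  | b + 1, f, σ => ∑ τ : Equiv.Perm X with τ.IsSwap, pathSum b f (τ * σ)

theorem pathSum_map {M M' : Type*} [AddCommMonoid M] [AddCommMonoid M'] (φ : M → M')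
    (hφ : ∀ (s : Finset (Equiv.Perm X)) (f : Equiv.Perm X → M),
      φ (∑ i ∈ s, f i) = ∑ i ∈ s, φ (f i)) (b : ℕ) (f : Equiv.Perm X → M) (σ : Equiv.Perm X) :
    φ (pathSum b f σ) = pathSum b (fun σ => φ (f σ)) σ := by
  induction b generalizing σ with
  | zero => rfl
  | succ b ih => simp only [pathSum, hφ, ih]

theorem iterate_diagWeight_finset_sum {α : Type*} (b : ℕ) (s : Finset α)
    (f : α → (Fin N → ℤ) → ℚ) :
    (oneBody 0 (diagWeight N))^[b] (∑ i ∈ s, f i) =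
      ∑ i ∈ s, (oneBody 0 (diagWeight N))^[b] (f i) := by
  induction b generalizing f with
  | zero => rfl
  | succ b ih => simp only [Function.iterate_succ_apply, oneBody_finset_sum, ih]

theorem iterate_shiftState (b : ℕ) (σ : Equiv.Perm X) :
    (oneBody 0 (diagWeight N))^[b] (shiftState N σ) = pathSum b (shiftState N) σ := by
  induction b generalizing σ with
  | zero => rfl
  | succ b ih =>
    rw [Function.iterate_succ_apply, oneBody_diagWeight_shiftState,
      iterate_diagWeight_finset_sum, pathSum]
    exact Finset.sum_congr (by ext; simp) fun τ _ => ih _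

theorem pathSum_mul_left (c : ℚ) (b : ℕ) (f : Equiv.Perm X → ℚ) (σ : Equiv.Perm X) :
    pathSum b (fun σ => c * f σ) σ = c * pathSum b f σ :=
  (pathSum_map (c * ·) (fun _ _ => Finset.mul_sum _ _ _) b f σ).symm

theorem pathSum_natCast (b : ℕ) (f : Equiv.Perm X → ℕ) (σ : Equiv.Perm X) :
    pathSum b (fun σ => (f σ : ℚ)) σ = (pathSum b f σ : ℕ) :=
  (pathSum_map (fun n : ℕ => (n : ℚ)) (fun _ _ => Nat.cast_sum _ _) b f σ).symm

theorem correlator_eq_pathSum (b : ℕ) {σ : Equiv.Perm X} {μ : ι → ℕ} {ν : κ → ℕ}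
    {L : X → ι} (hL : Lab σ μ L) {I : Finset ι} {J : Finset κ} (hI : ∀ i, i ∈ I ↔ μ i ≠ 0)
    (hJ : ∀ j, j ∈ J ↔ ν j ≠ 0) (hN : Fintype.card X ≤ N) :
    correlator N b (J.toList.map fun j => (ν j : ℤ)) (I.toList.map fun i => -(μ i : ℤ)) =
      ((∏ j ∈ J, ν j : ℕ) : ℚ) *
        (pathSum b (fun σ' => Nat.card {L : X → κ // Lab σ' ν L}) σ : ℕ) := by
  classical
  let L' : X → {i // i ∈ I} := fun x => ⟨L x, (hI _).2 (hL.pos x).ne'⟩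
  have hL' : Cycles σ L' := by
    refine ⟨?_, fun x => Subtype.ext (hL.inv x), fun x y h => hL.same x y (congrArg Subtype.val h)⟩
    rintro ⟨i, hi⟩
    have := Nat.pos_of_ne_zero ((hI i).1 hi)
    rw [← hL.card, Nat.card_pos_iff] at this
    obtain ⟨⟨x, hx⟩⟩ := this.1
    exact ⟨x, Subtype.ext hx⟩
  have h1 : state N ((I.toList.map fun i => -(μ i : ℤ)).map fun k => (k, bulk N)) =
      shiftState N σ := by
    rw [shiftState_eq_genState hL', genState]
    have : (I.toList.map fun i => -(μ i : ℤ)).map (fun k => (k, bulk N)) =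
        (I.toList.map fun i => (μ i : ℤ)).map fun k => (-k, bulk N) := by
      simp [Function.comp_def]
    rw [this]
    refine raise_perm ?_ ?_
    · rw [← Multiset.coe_eq_coe, ← Multiset.map_coe, ← Multiset.map_coe, Finset.coe_toList,
        Finset.coe_toList, Finset.univ_eq_attach, Finset.attach_val]
      rw [← Multiset.attach_map_val' I.val fun i => (μ i : ℤ)]
      refine Multiset.map_congr rfl fun i _ => ?_
      rw [← hL.card, Nat.card_eq_fintype_card, Fintype.card_subtype]
      simp [L', Subtype.ext_iff]
    · intro k hk
      obtain ⟨i, hi, rfl⟩ := List.mem_map.1 hk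
      exact_mod_cast Nat.pos_of_ne_zero ((hI i).1 (Finset.mem_toList.1 hi))
  have h2 : (J.toList.map fun j => (ν j : ℤ)) =
      List.ofFn fun t : Fin J.toList.length => ((ν (J.toList.get t) : ℕ) : ℤ) := by
    rw [← List.ofFn_get (J.toList.map fun j => (ν j : ℤ))]
    apply List.ext_get <;> simp
  have h3 : ∀ t : Fin J.toList.length, 0 < ν (J.toList.get t) := fun t =>
    Nat.pos_of_ne_zero ((hJ _).1 (Finset.mem_toList.1 (List.get_mem _ _)))
  have h4 : ∏ t : Fin J.toList.length, ν (J.toList.get t) = ∏ j ∈ J, ν j := by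
    rw [← List.prod_ofFn, ← Finset.prod_map_toList]
    congr 1
    rw [← List.ofFn_get (J.toList.map ν)]
    apply List.ext_get <;> simp
  have h5 : ∀ σ' : Equiv.Perm X, Nat.card {L : X → Fin J.toList.length //
      Lab σ' (fun t => ν (J.toList.get t)) L} = Nat.card {L : X → κ // Lab σ' ν L} := by
    intro σ'
    refine card_lab_comp σ' ν (f := J.toList.get) J.nodup_toList.injective_get fun j hj => ?_
    obtain ⟨t, ht⟩ := List.get_of_mem (Finset.mem_toList.2 ((hJ j).2 hj))
    exact ⟨t, ht⟩
  change lowerAll N _ _ _ = _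
  rw [h1, iterate_shiftState, h2,
    pathSum_map (fun F => lowerAll N _ F (sea N)) (fun s f => by
      rw [lowerAll_finset_sum, Finset.sum_apply])]
  simp only [lowerAll_shiftState _ _ h3 hN, h4, h5]
  rw [pathSum_mul_left, pathSum_natCast]

end

end Fermion

namespace Fermion

open MvPolynomial

variable {ι κ : Type} [Fintype ι] [Fintype κ] [DecidableEq ι] [DecidableEq κ]

/-- The point of `ℚ^(ι ⊕ κ)` with coordinates `μ` and `ν`. -/
def pt (μ : ι → ℕ) (ν : κ → ℕ) : ι ⊕ κ → ℚ := Sum.elim (fun i => (μ i : ℚ)) fun j => (ν j : ℚ)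

/-- The point of `ℤ^(ι ⊕ κ)` with coordinates `-μ` and `ν`. -/
def sgnPt (μ : ι → ℕ) (ν : κ → ℕ) : ι ⊕ κ → ℤ := Sum.elim (fun i => -(μ i : ℤ)) fun j => (ν j : ℤ)

/-- All parts outside the finite set `C` of indices vanish, the parts in `C` do not, and the
signs of all partial sums over proper subsets of `C` are constant on `D`. -/
structure Wall (C : Finset (ι ⊕ κ)) (D : Set ((ι → ℕ) × (κ → ℕ))) : Prop where
  left : ∀ p ∈ D, ∀ i, Sum.inl i ∈ C ↔ p.1 i ≠ 0
  right : ∀ p ∈ D, ∀ j, Sum.inr j ∈ C ↔ p.2 j ≠ 0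
  sum : ∀ p ∈ D, ∑ i, p.1 i = ∑ j, p.2 j
  sign : ∀ S ⊆ C, S ≠ ∅ → S ≠ C → (∀ p ∈ D, 0 < ∑ e ∈ S, sgnPt p.1 p.2 e) ∨
    ∀ p ∈ D, ∑ e ∈ S, sgnPt p.1 p.2 e < 0

/-- The linear form expressing the part at `i₀` through the others. -/
noncomputable def lastPart (C : Finset (ι ⊕ κ)) (i₀ : ι) : MvPolynomial (ι ⊕ κ) ℚ :=
  ∑ e ∈ C.erase (Sum.inl i₀), Sum.elim (fun i => -X (Sum.inl i)) (fun j => X (Sum.inr j)) e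

/-- The momenta of the fermionic operators as linear forms. -/
noncomputable def momentum (C : Finset (ι ⊕ κ)) (i₀ : ι) : ι ⊕ κ → MvPolynomial (ι ⊕ κ) ℚ :=
  Sum.elim (fun i => if i = i₀ then -lastPart C i₀ else -X (Sum.inl i)) fun j => X (Sum.inr j)

variable {C : Finset (ι ⊕ κ)} {D : Set ((ι → ℕ) × (κ → ℕ))} {i₀ : ι}

theorem Wall.sum_sgnPt (hD : Wall C D) {p : (ι → ℕ) × (κ → ℕ)} (hp : p ∈ D) :
    ∑ e ∈ C, sgnPt p.1 p.2 e = 0 := by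
  have h1 : ∑ e ∈ C, sgnPt p.1 p.2 e = ∑ e, sgnPt p.1 p.2 e := by
    refine Finset.sum_subset (Finset.subset_univ _) fun e _ he => ?_
    rcases e with i | j
    · have := mt (hD.left p hp i).2 he
      simp only [sgnPt, Sum.elim_inl]
      omega
    · have := mt (hD.right p hp j).2 he
      simp only [sgnPt, Sum.elim_inr]
      omega
  have := hD.sum p hp
  rw [h1, Fintype.sum_sum_type]
  simp only [sgnPt, Sum.elim_inl, Sum.elim_inr, Finset.sum_neg_distrib]
  have h2 : (∑ i, (p.1 i : ℤ)) = ∑ j, (p.2 j : ℤ) := by exact_mod_cast this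
  omega

theorem eval_lastPart (hD : Wall C D) (hi : Sum.inl i₀ ∈ C) {p : (ι → ℕ) × (κ → ℕ)}
    (hp : p ∈ D) : eval (pt p.1 p.2) (lastPart C i₀) = p.1 i₀ := by
  have h := hD.sum_sgnPt hp
  rw [← Finset.add_sum_erase _ _ hi] at h
  have h1 : eval (pt p.1 p.2) (lastPart C i₀) =
      ((∑ e ∈ C.erase (Sum.inl i₀), sgnPt p.1 p.2 e : ℤ) : ℚ) := by
    rw [lastPart, map_sum, Int.cast_sum]
    refine Finset.sum_congr rfl fun e _ => ?_
    rcases e with i | j <;> simp [sgnPt, pt]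
  rw [h1]
  have h2 : ∑ e ∈ C.erase (Sum.inl i₀), sgnPt p.1 p.2 e = (p.1 i₀ : ℤ) := by
    simp only [sgnPt, Sum.elim_inl] at h ⊢
    omega
  rw [h2]
  simp

theorem eval_momentum (hD : Wall C D) (hi : Sum.inl i₀ ∈ C) {p : (ι → ℕ) × (κ → ℕ)}
    (hp : p ∈ D) (e : ι ⊕ κ) :
    eval (pt p.1 p.2) (momentum C i₀ e) = (sgnPt p.1 p.2 e : ℚ) := by
  rcases e with i | j
  · simp only [momentum, Sum.elim_inl, sgnPt]
    split_ifs with h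
    · rw [map_neg, eval_lastPart hD hi hp, h]
      simp
    · simp [pt]
  · simp [momentum, sgnPt, pt]

theorem lastPart_isHomogeneous : (lastPart C i₀).IsHomogeneous 1 := by
  refine IsHomogeneous.sum _ _ _ fun e _ => ?_
  rcases e with i | j
  · exact (isHomogeneous_X ℚ _).neg
  · exact isHomogeneous_X ℚ _

theorem momentum_isHomogeneous (e : ι ⊕ κ) : (momentum C i₀ e).IsHomogeneous 1 := by
  rcases e with i | j
  · simp only [momentum, Sum.elim_inl]
    split_ifs
    · exact lastPart_isHomogeneous.neg
    · exact (isHomogeneous_X ℚ _).neg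
  · exact isHomogeneous_X ℚ _

theorem sum_momentum (hi : Sum.inl i₀ ∈ C) : ∑ e ∈ C, momentum C i₀ e = 0 := by
  rw [← Finset.add_sum_erase _ _ hi, momentum, Sum.elim_inl, if_pos rfl, neg_add_eq_zero, lastPart]
  refine Finset.sum_congr rfl fun e he => ?_
  rcases e with i | j
  · have : i ≠ i₀ := fun h => (Finset.mem_erase.1 he).1 (congrArg _ h)
    simp [this]
  · rfl

theorem exists_pathSum_poly (b : ℕ) (hD : Wall C D) (hi : Sum.inl i₀ ∈ C) (hc : 2 ≤ C.card) :
    ∃ P : MvPolynomial (ι ⊕ κ) ℚ, P.totalDegree ≤ 2 * b + 1 ∧ (∀ e ∈ C, momentum C i₀ e ∣ P) ∧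
      ∀ p ∈ D, ∀ (X : Type) [Fintype X] [DecidableEq X] (σ : Equiv.Perm X) (L : X → ι),
        Lab σ p.1 L → ((∏ j ∈ C.toRight, p.2 j : ℕ) : ℚ) *
          (pathSum b (fun σ' => Nat.card {L : X → κ // Lab σ' p.2 L}) σ : ℕ) =
        eval (pt p.1 p.2) P := by
  let lE : List (ι ⊕ κ) := C.toRight.toList.map Sum.inr ++ C.toLeft.toList.map Sum.inl
  have hnd : lE.Nodup := by
    refine List.Nodup.append ?_ ?_ ?_
    · exact C.toRight.nodup_toList.map Sum.inr_injective
    · exact C.toLeft.nodup_toList.map Sum.inl_injective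
    · intro e h1 h2
      obtain ⟨j, _, rfl⟩ := List.mem_map.1 h1
      obtain ⟨i, _, h⟩ := List.mem_map.1 h2
      cases h
  have hmem : ∀ e, e ∈ lE ↔ e ∈ C := by
    rintro (i | j) <;> simp [lE]
  have hset : lE.toFinset = C := by
    ext e
    rw [List.mem_toFinset, hmem]
  have hK : (C.toRight.toList.map fun j => momentum C i₀ (Sum.inr j)) ++
      (C.toLeft.toList.map fun i => momentum C i₀ (Sum.inl i)) = lE.map (momentum C i₀) := by
    simp [lE, Function.comp_def]
  have hlE : lE.length = C.card := by rw [← hset, List.toFinset_card_of_nodup hnd]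
  have hsub : ∀ s : List (ι ⊕ κ), s.Sublist lE → ∀ {M : Type} [AddCommMonoid M] (f : ι ⊕ κ → M),
      (s.map f).sum = ∑ e ∈ s.toFinset, f e := by
    intro s hs M _ f
    rw [List.sum_toFinset _ (hnd.sublist hs)]
  obtain ⟨P, hP, hdvd, hev⟩ := exists_correlator_poly
    {z | ∃ p ∈ D, z = pt p.1 p.2} b (C.toRight.toList.map fun j => momentum C i₀ (Sum.inr j))
    (C.toLeft.toList.map fun i => momentum C i₀ (Sum.inl i))
    (by rw [hK, List.length_map, hlE]; exact hc)
    (by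
      rw [hK]
      intro K h
      obtain ⟨e, _, rfl⟩ := List.mem_map.1 h
      exact (momentum_isHomogeneous e).totalDegree_le)
    (by rw [hK, hsub _ (List.Sublist.refl _), hset, sum_momentum hi])
    (by
      rw [hK]
      intro s hs hne hlt
      obtain ⟨l, hl, rfl⟩ := List.sublist_map_iff.1 hs
      rw [hsub l hl]
      have hlS : l.toFinset.card = l.length :=
        List.toFinset_card_of_nodup (hnd.sublist hl)
      have hvals : ∀ p ∈ D, eval (pt p.1 p.2) (∑ e ∈ l.toFinset, momentum C i₀ e) =
          ((∑ e ∈ l.toFinset, sgnPt p.1 p.2 e : ℤ) : ℚ) := by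
        intro p hp
        rw [map_sum, Int.cast_sum]
        exact Finset.sum_congr rfl fun e _ => eval_momentum hD hi hp e
      have hS1 : l.toFinset ⊆ C := by
        intro e he
        rw [← hmem]
        exact hl.subset (List.mem_toFinset.1 he)
      have hS2 : l.toFinset ≠ ∅ := by
        intro h
        rw [h, Finset.card_empty] at hlS
        rw [List.length_eq_zero_iff.1 hlS.symm] at hne
        exact hne rfl
      have hS3 : l.toFinset ≠ C := by
        intro h
        rw [h, ← hlE] at hlS
        simp only [List.length_map] at hlt
        omega
      rcases hD.sign l.toFinset hS1 hS2 hS3 with h | h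
      · refine Or.inl ?_
        rintro _ ⟨p, hp, rfl⟩
        rw [hvals p hp]
        exact_mod_cast h p hp
      · refine Or.inr ?_
        rintro _ ⟨p, hp, rfl⟩
        rw [hvals p hp]
        exact_mod_cast h p hp)
  refine ⟨P, hP, fun e he => hdvd _ ?_, ?_⟩
  · rw [hK]
    exact List.mem_map_of_mem ((hmem e).2 he)
  · intro p hp X _ _ σ L hL
    obtain ⟨N₀, hN⟩ := hev _ ⟨p, hp, rfl⟩ (C.toRight.toList.map fun j => (p.2 j : ℤ))
      (C.toLeft.toList.map fun i => -(p.1 i : ℤ))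
      (by
        rw [List.forall₂_map_left_iff, List.forall₂_map_right_iff, List.forall₂_same]
        intro j _
        rw [eval_momentum hD hi hp]
        simp [sgnPt])
      (by
        rw [List.forall₂_map_left_iff, List.forall₂_map_right_iff, List.forall₂_same]
        intro j _
        rw [eval_momentum hD hi hp]
        simp [sgnPt])
    rw [← hN _ (le_max_left N₀ (Fintype.card X)), correlator_eq_pathSum b hL (I := C.toLeft)
      (J := C.toRight) ?_ ?_ (le_max_right _ _)]
    · intro i
      rw [Finset.mem_toLeft, hD.left p hp]
    · intro i
      rw [Finset.mem_toRight, hD.right p hp]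

/-- The number of ways to complete a labelled permutation to a factorisation is a polynomial
divisible by the product of the parts of the labelled permutation. -/
theorem exists_pathSum_eq (b : ℕ) (hD : Wall C D) (hi : Sum.inl i₀ ∈ C) (hc : 3 ≤ C.card) :
    ∃ Q : MvPolynomial (ι ⊕ κ) ℚ, Q.totalDegree ≤ 2 * b + 1 - C.card ∧
      ∀ p ∈ D, ∀ (X : Type) [Fintype X] [DecidableEq X] (σ : Equiv.Perm X) (L : X → ι),
        Lab σ p.1 L →
          ((pathSum b (fun σ' => Nat.card {L : X → κ // Lab σ' p.2 L}) σ : ℕ) : ℚ) =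
        ((∏ i ∈ C.toLeft, p.1 i : ℕ) : ℚ) * eval (pt p.1 p.2) Q := by
  obtain ⟨P, hP, hdvd, hev⟩ := exists_pathSum_poly b hD hi (by omega)
  have hcard : (C.erase (Sum.inl i₀)).card + 1 = C.card := Finset.card_erase_add_one hi
  have hother : ∀ e ∈ C.erase (Sum.inl i₀), ∃ e' ∈ C.erase (Sum.inl i₀), e' ≠ e := by
    intro e _
    exact Finset.exists_mem_ne (by omega) e
  have hsing : ∀ e' ∈ C.erase (Sum.inl i₀), eval (Pi.single e' 1) (lastPart C i₀) ≠ 0 := by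
    intro e' he'
    rw [lastPart, map_sum, Finset.sum_eq_single_of_mem e' he']
    · rcases e' with i | j <;> simp
    · intro e _ hne
      rcases e with i | j <;> simp [hne]
  have hdiv : (∏ e ∈ C.erase (Sum.inl i₀), X e) * lastPart C i₀ ∣ P := by
    refine prod_X_mul_dvd _ ?_ ?_ ?_
    · intro e he
      have h := hdvd e (Finset.mem_of_mem_erase he)
      rcases e with i | j
      · have : i ≠ i₀ := fun h => (Finset.mem_erase.1 he).1 (congrArg _ h)
        simpa [momentum, this] using h
      · exact h
    · simpa [momentum] using hdvd _ hi
    · intro e he h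
      obtain ⟨e', he', hne⟩ := hother e he
      refine hsing e' he' ?_
      obtain ⟨q, hq⟩ := h
      rw [hq, map_mul, eval_X, Pi.single_apply, if_neg hne.symm, zero_mul]
  obtain ⟨Q, rfl⟩ := hdiv
  have hl0 : lastPart C i₀ ≠ 0 := by
    intro h
    obtain ⟨e, he⟩ := Finset.card_pos.1 (by omega : 0 < (C.erase (Sum.inl i₀)).card)
    exact hsing e he (by rw [h, map_zero])
  have hhom : ((∏ e ∈ C.erase (Sum.inl i₀), X e) * lastPart C i₀ :
      MvPolynomial (ι ⊕ κ) ℚ).IsHomogeneous C.card := by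
    rw [← hcard]
    refine IsHomogeneous.mul ?_ lastPart_isHomogeneous
    have := IsHomogeneous.prod (C.erase (Sum.inl i₀)) (fun e => (X e : MvPolynomial (ι ⊕ κ) ℚ))
      (fun _ => 1) fun e _ => isHomogeneous_X ℚ e
    simpa using this
  have hne : ((∏ e ∈ C.erase (Sum.inl i₀), X e) * lastPart C i₀ :
      MvPolynomial (ι ⊕ κ) ℚ) ≠ 0 :=
    mul_ne_zero (Finset.prod_ne_zero_iff.2 fun e _ => X_ne_zero e) hl0
  refine ⟨Q, ?_, ?_⟩
  · by_cases hQ : Q = 0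
    · simp [hQ]
    · rw [totalDegree_mul_of_isDomain hne hQ, hhom.totalDegree hne] at hP
      omega
  · intro p hp X _ _ σ L hL
    have h := hev p hp X σ L hL
    have hJ : ((∏ j ∈ C.toRight, p.2 j : ℕ) : ℚ) ≠ 0 := by
      rw [Nat.cast_ne_zero, Finset.prod_ne_zero_iff]
      exact fun j hj => (hD.right p hp j).1 (Finset.mem_toRight.1 hj)
    have hprod : ∏ e ∈ C, pt p.1 p.2 e = ((∏ i ∈ C.toLeft, p.1 i : ℕ) : ℚ) *
        ((∏ j ∈ C.toRight, p.2 j : ℕ) : ℚ) := by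
      conv_lhs => rw [← Finset.toLeft_disjSum_toRight (u := C)]
      rw [Finset.prod_disjSum]
      push_cast
      rfl
    rw [map_mul, map_mul, map_prod, eval_lastPart hD hi hp] at h
    simp only [eval_X] at h
    rw [show (p.1 i₀ : ℚ) = pt p.1 p.2 (Sum.inl i₀) from rfl, Finset.prod_erase_mul (a := Sum.inl i₀) (f := pt p.1 p.2) (h := hi), hprod] at h
    refine mul_left_cancel₀ hJ (h.trans ?_)
    ring

/-- The number of ways to complete a full cycle to a factorisation ending in a full cycle is
a polynomial. -/
theorem exists_pathSum_eq_of_card_two (b : ℕ) (hD : Wall C D) {j₀ : κ}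
    (hC : C = {Sum.inl i₀, Sum.inr j₀}) :
    ∃ Q : MvPolynomial (ι ⊕ κ) ℚ, Q.totalDegree ≤ 2 * b ∧
      ∀ p ∈ D, ∀ (X : Type) [Fintype X] [DecidableEq X] (σ : Equiv.Perm X) (L : X → ι),
        Lab σ p.1 L →
          ((pathSum b (fun σ' => Nat.card {L : X → κ // Lab σ' p.2 L}) σ : ℕ) : ℚ) =
        eval (pt p.1 p.2) Q := by
  have hi : Sum.inl i₀ ∈ C := by simp [hC]
  have hj : Sum.inr j₀ ∈ C := by simp [hC]
  obtain ⟨P, hP, hdvd, hev⟩ := exists_pathSum_poly b hD hi (by simp [hC])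
  obtain ⟨Q, rfl⟩ := hdvd _ hj
  have hR : C.toRight = {j₀} := by
    ext j
    simp [hC]
  refine ⟨Q, ?_, ?_⟩
  · by_cases hQ : Q = 0
    · simp [hQ]
    · have hX : momentum C i₀ (Sum.inr j₀) ≠ 0 := X_ne_zero _
      rw [totalDegree_mul_of_isDomain hX hQ, (momentum_isHomogeneous _).totalDegree hX] at hP
      omega
  · intro p hp X _ _ σ L hL
    have h := hev p hp X σ L hL
    have hJ : ((p.2 j₀ : ℕ) : ℚ) ≠ 0 := by
      rw [Nat.cast_ne_zero]
      exact (hD.right p hp j₀).1 hj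
    rw [hR, Finset.prod_singleton, map_mul, eval_momentum hD hi hp] at h
    exact mul_left_cancel₀ hJ (h.trans (by simp [sgnPt]))

end Fermion

namespace Fermion

variable {X : Type} {ι κ : Type} {b : ℕ}

theorem perm_apply_inv (σ : Equiv.Perm X) (x : X) : σ (σ⁻¹ x) = x := σ.apply_symm_apply x

theorem perm_inv_apply (σ : Equiv.Perm X) (x : X) : σ⁻¹ (σ x) = x := σ.symm_apply_apply x

theorem Lab.eq_of_invariant [Finite X] {σ : Equiv.Perm X} {ν : κ → ℕ} {L : X → κ} (h : Lab σ ν L)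
    {α : Type} {f : X → α} (hf : ∀ x, f (σ x) = f x) {x y : X} (hxy : L x = L y) : f x = f y := by
  classical
  have := Fintype.ofFinite X
  exact apply_eq_of_sameCycle hf (h.same x y hxy)

theorem sameCycle_of_invariant {σ : Equiv.Perm X} {x y : X}
    (h : ∀ f : X → ℤ, (∀ z, f (σ z) = f z) → f x = f y) : σ.SameCycle x y := by
  classical
  have h1 := h (fun z => if σ.SameCycle x z then 1 else 0) fun z => by
    simp only [Equiv.Perm.sameCycle_apply_right]
  by_contra hxy
  simp [hxy, Equiv.Perm.SameCycle.refl] at h1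

/-- The label `j` is affected by the step `s` of the sequence `η`. -/
def Touches (η : Fin (b + 1) → Equiv.Perm X) (L : X → κ) (s : Fin b) (j : κ) : Prop :=
  ∃ v, L v = j ∧ η s.castSucc v ≠ η s.succ v

/-- The label `j` is affected by at most one step of the sequence `η`. -/
def Leaf (η : Fin (b + 1) → Equiv.Perm X) (L : X → κ) (j : κ) : Prop :=
  ∀ s t : Fin b, Touches η L s j → Touches η L t j → s = t

/-- Consecutive permutations differ by a left multiplication by a transposition. -/
def IsPath [DecidableEq X] (η : Fin (b + 1) → Equiv.Perm X) : Prop :=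
  ∀ s : Fin b, (η s.succ * (η s.castSucc)⁻¹).IsSwap

/-- Sequences starting at the labelled permutation `σ` and ending at a permutation labelled by
`L₂`, such that the cycles of `σ` with label in `I` are leaves attached to the cycles of the
last permutation prescribed by `α`, and the cycles of the last permutation with label in `J`
are leaves. -/
structure Adm [DecidableEq X] (σ : Equiv.Perm X) (L₁ : X → ι) (ν : κ → ℕ) (I : Finset ι)
    (α : ι → κ) (J : Finset κ) (η : Fin (b + 1) → Equiv.Perm X) (L₂ : X → κ) : Prop where
  start : η 0 = σ
  step : IsPath η
  lab : Lab (η (Fin.last b)) ν L₂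
  leaf : ∀ i ∈ I, Leaf (fun s => (η s)⁻¹) L₁ i
  dual : ∀ j ∈ J, Leaf η L₂ j
  label : ∀ x, L₁ x ∈ I → L₂ x = α (L₁ x)

theorem eq_of_forall_step {β : Type*} (f : Fin (b + 1) → β) {lo hi : Fin (b + 1)} (hle : lo ≤ hi)
    (h : ∀ s : Fin b, lo ≤ s.castSucc → s.succ ≤ hi → f s.castSucc = f s.succ) : f lo = f hi := by
  induction hi using Fin.induction with
  | zero => rw [Fin.le_zero_iff.1 hle]
  | succ s ih =>
    rcases hle.eq_or_lt with rfl | hlt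
    · rfl
    · have h1 : lo ≤ s.castSucc := by
        rw [Fin.lt_def] at hlt
        rw [Fin.le_def]
        simp only [Fin.val_succ, Fin.val_castSucc] at hlt ⊢
        omega
      rw [ih h1 fun s' a c => h s' a (c.trans (Fin.castSucc_lt_succ).le), h s h1 le_rfl]

theorem eq_zero_of_not_touches {η : Fin (b + 1) → Equiv.Perm X} {L : X → κ} {j : κ}
    (h : ∀ s, ¬ Touches η L s j) {v : X} (hv : L v = j) (s : Fin (b + 1)) : η s v = η 0 v := by
  refine (eq_of_forall_step (fun s => η s v) (Fin.zero_le s) fun s _ _ => ?_).symm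
  by_contra hne
  exact h s ⟨v, hv, hne⟩

theorem Leaf.eq_zero {η : Fin (b + 1) → Equiv.Perm X} {L : X → κ} {j : κ} (h : Leaf η L j)
    {t : Fin b} (ht : Touches η L t j) {v : X} (hv : L v = j) {s : Fin (b + 1)}
    (hs : s ≤ t.castSucc) : η s v = η 0 v := by
  refine (eq_of_forall_step (fun s => η s v) (Fin.zero_le s) fun s' _ h' => ?_).symm
  by_contra hne
  rw [h s' t ⟨v, hv, hne⟩ ht] at h'
  exact absurd (h'.trans hs) (not_le.2 (Fin.castSucc_lt_succ))

theorem Leaf.eq_last {η : Fin (b + 1) → Equiv.Perm X} {L : X → κ} {j : κ} (h : Leaf η L j)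
    {t : Fin b} (ht : Touches η L t j) {v : X} (hv : L v = j) {s : Fin (b + 1)}
    (hs : t.castSucc < s) : η s v = η (Fin.last b) v := by
  refine (eq_of_forall_step (fun s => η s v) (Fin.le_last s) fun s' h' _ => ?_)
  by_contra hne
  rw [h s' t ⟨v, hv, hne⟩ ht] at h'
  exact absurd hs (not_lt.2 h')

section Extend

variable {σ : Equiv.Perm X} {L : X → ι} {i₀ : ι}

/-- The restriction of `σ` to the complement of the cycle labelled `i₀`. -/
def rest (i₀ : ι) (hinv : ∀ x, L (σ x) = L x) : Equiv.Perm {x // L x ≠ i₀} :=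
  σ.subtypePerm fun x => by rw [hinv]

open Classical in
/-- The extension of a permutation of the complement of the cycle labelled `i₀` by `σ`. -/
noncomputable def extend (hinv : ∀ x, L (σ x) = L x) (ρ : Equiv.Perm {x // L x ≠ i₀}) :
    Equiv.Perm X :=
  Equiv.Perm.ofSubtype (ρ * (rest i₀ hinv)⁻¹) * σ

variable (hinv : ∀ x, L (σ x) = L x)

theorem extend_rest : extend hinv (rest i₀ hinv) = σ := by
  simp [extend]

theorem extend_apply_coe (ρ : Equiv.Perm {x // L x ≠ i₀}) (x : {x // L x ≠ i₀}) :
    extend hinv ρ x = ρ x := by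
  have h : σ x = (rest i₀ hinv x : X) := rfl
  rw [extend, Equiv.Perm.mul_apply, h]
  classical
  rw [Equiv.Perm.ofSubtype_apply_coe]
  simp

theorem extend_apply_of_eq (ρ : Equiv.Perm {x // L x ≠ i₀}) {x : X} (hx : L x = i₀) :
    extend hinv ρ x = σ x := by
  classical
  rw [extend, Equiv.Perm.mul_apply, Equiv.Perm.ofSubtype_apply_of_not_mem]
  rw [hinv, not_not]
  exact hx

theorem extend_inv_apply_coe (ρ : Equiv.Perm {x // L x ≠ i₀}) (x : {x // L x ≠ i₀}) :
    (extend hinv ρ)⁻¹ x = ρ⁻¹ x := by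
  rw [Equiv.Perm.inv_eq_iff_eq, extend_apply_coe]
  simp

theorem extend_inv_apply_of_eq (ρ : Equiv.Perm {x // L x ≠ i₀}) {x : X} (hx : L x = i₀) :
    (extend hinv ρ)⁻¹ x = σ⁻¹ x := by
  rw [Equiv.Perm.inv_eq_iff_eq, extend_apply_of_eq]
  · simp
  · rw [← hinv]
    simpa using hx

theorem extend_injective : Function.Injective (extend (i₀ := i₀) hinv) := by
  intro ρ ρ' h
  ext x
  rw [← extend_apply_coe hinv, h, extend_apply_coe]

open Classical in
theorem extend_mul_inv (ρ ρ' : Equiv.Perm {x // L x ≠ i₀}) :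
    extend hinv ρ * (extend hinv ρ')⁻¹ = Equiv.Perm.ofSubtype (ρ * ρ'⁻¹) := by
  have : ρ * ρ'⁻¹ = (ρ * (rest i₀ hinv)⁻¹) * (ρ' * (rest i₀ hinv)⁻¹)⁻¹ := by group
  rw [this, map_mul, map_inv, extend, extend, mul_inv_rev]
  group

theorem exists_extend_eq {ζ : Equiv.Perm X} (h : ∀ x, L x = i₀ → ζ x = σ x) :
    ∃ ρ, extend (i₀ := i₀) hinv ρ = ζ := by
  classical
  have h1 : ∀ x, L x = i₀ → (ζ * σ⁻¹) x = x := by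
    intro x hx
    rw [Equiv.Perm.mul_apply, h, perm_apply_inv]
    rw [← hinv]
    simpa using hx
  have h2 : ∀ x, L ((ζ * σ⁻¹) x) ≠ i₀ ↔ L x ≠ i₀ := by
    intro x
    rw [not_iff_not]
    constructor
    · intro hx
      have h3 := h1 _ hx
      have := (ζ * σ⁻¹).injective h3
      rw [← this]
      exact hx
    · intro hx
      rw [h1 x hx]
      exact hx
  refine ⟨(ζ * σ⁻¹).subtypePerm h2 * rest i₀ hinv, ?_⟩
  rw [extend, mul_inv_cancel_right, Equiv.Perm.ofSubtype_subtypePerm]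
  · group
  · intro x hx hx'
    exact hx (h1 x hx')

theorem isSwap_ofSubtype_iff [Finite X] [DecidableEq X] {p : X → Prop} [DecidablePred p]
    (τ : Equiv.Perm (Subtype p)) : (Equiv.Perm.ofSubtype τ).IsSwap ↔ τ.IsSwap := by
  have := Fintype.ofFinite X
  rw [← Equiv.Perm.card_support_eq_two, ← Equiv.Perm.card_support_eq_two]
  rw [Equiv.Perm.support_ofSubtype, Finset.card_map]

open Classical in
/-- The extension of a labeling to the cycle labelled `i₀`. -/
noncomputable def extendLab (L : X → ι) (i₀ : ι) (j : κ) (M : {x // L x ≠ i₀} → κ) (x : X) : κ :=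
  if h : L x ≠ i₀ then M ⟨x, h⟩ else j

theorem extendLab_coe (j : κ) (M : {x // L x ≠ i₀} → κ) (x : {x // L x ≠ i₀}) :
    extendLab L i₀ j M x = M x := dif_pos x.2

theorem extendLab_of_eq (j : κ) (M : {x // L x ≠ i₀} → κ) {x : X} (h : L x = i₀) :
    extendLab L i₀ j M x = j := dif_neg (not_not.2 h)

end Extend

end Fermion

namespace Fermion

variable {X : Type} {ι κ : Type} {b : ℕ}

theorem card_fiber_rest [Finite X] [DecidableEq κ] {L : X → ι} {i₀ : ι} {M : X → κ} {j : κ}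
    (hM : ∀ x, L x = i₀ → M x = j) (j' : κ) :
    Nat.card {x // M x = j'} = Nat.card {q : {x // L x ≠ i₀} // M q = j'} +
      if j' = j then Nat.card {x // L x = i₀} else 0 := by
  classical
  have := Fintype.ofFinite X
  rw [Nat.card_congr (Equiv.subtypeSubtypeEquivSubtypeInter (fun x => L x ≠ i₀) fun x => M x = j')]
  simp only [Nat.card_eq_fintype_card, Fintype.card_subtype]
  rw [← Finset.card_filter_add_card_filter_not (s := Finset.univ.filter fun x => M x = j')
    (fun x => L x ≠ i₀), Finset.filter_filter, Finset.filter_filter]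
  congr 1
  · congr 1
    ext x
    simp [and_comm]
  · split_ifs with h
    · congr 1
      ext x
      simp only [Finset.mem_filter, Finset.mem_univ, true_and, not_not]
      exact ⟨fun h => h.2, fun hx => ⟨h ▸ hM x hx, hx⟩⟩
    · rw [Finset.card_eq_zero, Finset.filter_eq_empty_iff]
      rintro x _ ⟨h1, h2⟩
      exact h (h1 ▸ hM x (not_not.1 h2))

/-- An integer-valued function which is invariant under `σ` along a cycle except possibly at one
place is invariant there, too. -/
theorem apply_eq_of_forall_ne [Finite X] {σ : Equiv.Perm X} {P : X → Prop}
    (hP : ∀ x, P (σ x) ↔ P x) {f : X → ℤ} {y : X} (hy : P y)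
    (h : ∀ x, P x → x ≠ y → f (σ x) = f x) : f (σ y) = f y := by
  classical
  have := Fintype.ofFinite X
  have h1 : ∑ x with P x, f (σ x) = ∑ x with P x, f x :=
    Finset.sum_equiv σ (by simp [hP]) fun _ _ => rfl
  have hy' : y ∈ Finset.univ.filter P := by simpa using hy
  rw [← Finset.add_sum_erase _ _ hy', ← Finset.add_sum_erase _ _ hy',
    Finset.sum_congr rfl fun x hx => h x ?_ ?_] at h1
  · exact add_right_cancel h1
  · simp only [Finset.mem_erase, Finset.mem_filter] at hx
    exact hx.2.2
  · simp only [Finset.mem_erase, Finset.mem_filter] at hx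
    exact hx.1

variable [DecidableEq X]

section

variable {σ : Equiv.Perm X} {L : X → ι} {i₀ : ι} (hinv : ∀ x, L (σ x) = L x)
  (ρ : Equiv.Perm {x // L x ≠ i₀}) {y : X} (p : {x // L x ≠ i₀})

theorem extend_swap_left : (extend hinv ρ * Equiv.swap y p) y = ρ p := by
  rw [Equiv.Perm.mul_apply, Equiv.swap_apply_left, extend_apply_coe]

theorem extend_swap_right (hy : L y = i₀) : (extend hinv ρ * Equiv.swap y p) p = σ y := by
  rw [Equiv.Perm.mul_apply, Equiv.swap_apply_right, extend_apply_of_eq hinv _ hy]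

theorem extend_swap_of_eq {x : X} (hx : L x = i₀) (hxy : x ≠ y) :
    (extend hinv ρ * Equiv.swap y p) x = σ x := by
  rw [Equiv.Perm.mul_apply, Equiv.swap_apply_of_ne_of_ne hxy, extend_apply_of_eq hinv _ hx]
  rintro rfl
  exact p.2 hx

theorem extend_swap_coe (hy : L y = i₀) {q : {x // L x ≠ i₀}} (hq : q ≠ p) :
    (extend hinv ρ * Equiv.swap y p) q = ρ q := by
  rw [Equiv.Perm.mul_apply, Equiv.swap_apply_of_ne_of_ne _ fun h => hq (Subtype.ext h),
    extend_apply_coe]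
  intro h
  exact q.2 (h ▸ hy)

theorem lab_extend_swap_iff [Finite X] [DecidableEq κ] {μ : ι → ℕ} (hσ : Lab σ μ L)
    (hy : L y = i₀) {ν : κ → ℕ} {M : X → κ} {j : κ} (hM : ∀ x, L x = i₀ → M x = j)
    (hp : M p = j) (hν : μ i₀ ≤ ν j) :
    Lab (extend hinv ρ * Equiv.swap y p) ν M ↔
      Lab ρ (Function.update ν j (ν j - μ i₀)) fun q => M q := by
  classical
  set R := extend hinv ρ * Equiv.swap y p with hR
  have e1 : R y = ρ p := extend_swap_left hinv ρ p
  have e2 : R p = σ y := extend_swap_right hinv ρ p hy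
  have e3 : ∀ x, L x = i₀ → x ≠ y → R x = σ x := fun x => extend_swap_of_eq hinv ρ p
  have e4 : ∀ q, q ≠ p → R q = ρ q := fun q => extend_swap_coe hinv ρ p hy
  have hcard : (∀ j', Nat.card {x // M x = j'} = ν j') ↔
      ∀ j', Nat.card {q : {x // L x ≠ i₀} // M q = j'} =
        Function.update ν j (ν j - μ i₀) j' := by
    refine forall_congr' fun j' => ?_
    rw [card_fiber_rest hM, hσ.card]
    by_cases h : j' = j
    · subst h
      rw [if_pos rfl, Function.update_self]
      omega
    · rw [if_neg h, Function.update_of_ne h, add_zero]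
  constructor
  · intro h
    refine ⟨fun q => ?_, hcard.1 h.card, fun x x' hx => sameCycle_of_invariant fun f hf => ?_⟩
    · by_cases hq : q = p
      · subst hq
        rw [hp, ← e1, h.inv, hM y hy]
      · rw [← e4 q hq, h.inv]
    · have hg := h.eq_of_invariant (f := extendLab L i₀ (f p) f) (fun z => ?_) hx
      · rwa [extendLab_coe, extendLab_coe] at hg
      · by_cases hz : L z = i₀
        · rw [extendLab_of_eq _ _ hz]
          by_cases hzy : z = y
          · rw [hzy, e1, extendLab_coe, hf]
          · rw [e3 z hz hzy, extendLab_of_eq _ _ (by rw [hinv, hz])]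
        · obtain ⟨q, rfl⟩ : ∃ q : {x // L x ≠ i₀}, (q : X) = z := ⟨⟨z, hz⟩, rfl⟩
          rw [extendLab_coe]
          by_cases hq : q = p
          · rw [hq, e2, extendLab_of_eq _ _ (by rw [hinv, hy])]
          · rw [e4 q hq, extendLab_coe, hf]
  · intro h
    refine ⟨fun x => ?_, hcard.2 h.card, fun x x' hx => sameCycle_of_invariant fun f hf => ?_⟩
    · by_cases hx : L x = i₀
      · by_cases hxy : x = y
        · rw [hxy, e1, hM y hy, ← hp]
          exact h.inv p
        · rw [e3 x hx hxy, hM _ (by rw [hinv, hx]), hM x hx]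
      · obtain ⟨q, rfl⟩ : ∃ q : {x // L x ≠ i₀}, (q : X) = x := ⟨⟨x, hx⟩, rfl⟩
        by_cases hq : q = p
        · rw [hq, e2, hM _ (by rw [hinv, hy]), hp]
        · rw [e4 q hq]
          exact h.inv q
    · have hfy : f (σ y) = f y := by
        refine apply_eq_of_forall_ne (P := fun x => L x = i₀) (fun x => by rw [hinv]) hy ?_
        intro x hx hxy
        rw [← e3 x hx hxy, hf]
      have hA : ∀ x, L x = i₀ → f x = f y := by
        intro x hx
        have := hσ.eq_of_invariant (f := fun x => if L x = i₀ then f x else 0) (fun z => ?_)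
          (hx.trans hy.symm)
        · simpa [hx, hy] using this
        · simp only [hinv]
          split_ifs with hz
          · by_cases hzy : z = y
            · rw [hzy, hfy]
            · rw [← e3 z hz hzy, hf]
          · rfl
      have hpy : f p = f y := by rw [← hf p, e2, hfy]
      have hrest : ∀ q q' : {x // L x ≠ i₀}, M q = M q' → f q = f q' := by
        intro q q' hqq
        refine h.eq_of_invariant (f := fun q => f q) (fun z => ?_) hqq
        by_cases hz : z = p
        · rw [hz, ← e1, hf, hpy]
        · rw [← e4 z hz, hf]
      have hval : ∀ z, ∃ q : {x // L x ≠ i₀}, M q = M z ∧ f q = f z := by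
        intro z
        by_cases hz : L z = i₀
        · exact ⟨p, by rw [hp, hM z hz], by rw [hA z hz, hpy]⟩
        · exact ⟨⟨z, hz⟩, rfl, rfl⟩
      obtain ⟨q, hq1, hq2⟩ := hval x
      obtain ⟨q', hq1', hq2'⟩ := hval x'
      rw [← hq2, ← hq2']
      exact hrest q q' (by rw [hq1, hq1', hx])

end

end Fermion

namespace Fermion

variable {X : Type} {ι κ : Type} {b : ℕ} [DecidableEq X]

section

variable {σ : Equiv.Perm X} {L : X → ι} {i₀ : ι}

/-- Insert the cycle labelled `i₀` into a path at time `t`, joining it to the point `p`. -/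
noncomputable def insertLeaf (hinv : ∀ x, L (σ x) = L x)
    (η : Fin (b + 1) → Equiv.Perm {x // L x ≠ i₀}) (t : Fin (b + 1)) (y : X)
    (p : {x // L x ≠ i₀}) (s : Fin (b + 2)) : Equiv.Perm X :=
  extend hinv (η (t.predAbove s)) * if t.castSucc < s then Equiv.swap y p else 1

variable (hinv : ∀ x, L (σ x) = L x) (η : Fin (b + 1) → Equiv.Perm {x // L x ≠ i₀})
  (t : Fin (b + 1)) (y : X) (p : {x // L x ≠ i₀})

theorem predAbove_succAbove_castSucc (s : Fin b) :
    t.predAbove (t.succAbove s).castSucc = s.castSucc := by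
  rcases lt_or_ge s.castSucc t with h | h
  · rw [Fin.succAbove_of_castSucc_lt _ _ h, Fin.predAbove_of_le_castSucc]
    · rfl
    · exact Fin.castSucc_le_castSucc_iff.2 h.le
  · rw [Fin.succAbove_of_le_castSucc _ _ h, Fin.predAbove_of_castSucc_lt]
    · rfl
    · exact Fin.castSucc_lt_castSucc_iff.2 (h.trans_lt Fin.castSucc_lt_succ)

theorem predAbove_succAbove_succ (s : Fin b) :
    t.predAbove (t.succAbove s).succ = s.succ := by
  rcases lt_or_ge s.castSucc t with h | h
  · rw [Fin.succAbove_of_castSucc_lt _ _ h, Fin.predAbove_of_le_castSucc]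
    · rfl
    · rw [← Fin.castSucc_succ, Fin.castSucc_le_castSucc_iff]
      exact h
  · rw [Fin.succAbove_of_le_castSucc _ _ h, Fin.predAbove_of_castSucc_lt]
    · rfl
    · exact Fin.castSucc_lt_succ_iff.2 (h.trans Fin.castSucc_lt_succ.le)

theorem castSucc_lt_succAbove_iff (s : Fin b) :
    t.castSucc < (t.succAbove s).succ ↔ t.castSucc < (t.succAbove s).castSucc := by
  rw [Fin.castSucc_lt_succ_iff, Fin.castSucc_lt_castSucc_iff]
  exact ⟨fun h => h.lt_of_ne (Fin.ne_succAbove t s), le_of_lt⟩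

theorem insertLeaf_zero : insertLeaf hinv η t y p 0 = extend hinv (η 0) := by
  simp [insertLeaf]

theorem insertLeaf_last :
    insertLeaf hinv η t y p (Fin.last _) = extend hinv (η (Fin.last b)) * Equiv.swap y p := by
  rw [insertLeaf, if_pos (Fin.castSucc_lt_last t), Fin.predAbove_right_last]

theorem insertLeaf_castSucc :
    insertLeaf hinv η t y p t.castSucc = extend hinv (η t) := by
  simp [insertLeaf]

theorem insertLeaf_succ :
    insertLeaf hinv η t y p t.succ = extend hinv (η t) * Equiv.swap y p := by
  rw [insertLeaf, if_pos Fin.castSucc_lt_succ, Fin.predAbove_succ_self]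

theorem insertLeaf_succAbove_castSucc (s : Fin b) :
    insertLeaf hinv η t y p (t.succAbove s).castSucc = extend hinv (η s.castSucc) *
      if t.castSucc < (t.succAbove s).castSucc then Equiv.swap y p else 1 := by
  rw [insertLeaf, predAbove_succAbove_castSucc]

theorem insertLeaf_succAbove_succ (s : Fin b) :
    insertLeaf hinv η t y p (t.succAbove s).succ = extend hinv (η s.succ) *
      if t.castSucc < (t.succAbove s).castSucc then Equiv.swap y p else 1 := by
  rw [insertLeaf, predAbove_succAbove_succ, if_congr (castSucc_lt_succAbove_iff t s) rfl rfl]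

theorem isSwap_insertLeaf_iff [Finite X] (s : Fin b) :
    (insertLeaf hinv η t y p (t.succAbove s).succ *
      (insertLeaf hinv η t y p (t.succAbove s).castSucc)⁻¹).IsSwap ↔
      (η s.succ * (η s.castSucc)⁻¹).IsSwap := by
  classical
  rw [insertLeaf_succAbove_castSucc, insertLeaf_succAbove_succ, mul_inv_rev, mul_assoc,
    mul_inv_cancel_left, extend_mul_inv]
  convert isSwap_ofSubtype_iff (η s.succ * (η s.castSucc)⁻¹)

theorem isPath_insertLeaf_iff [Finite X] (hy : L y = i₀) :
    IsPath (insertLeaf hinv η t y p) ↔ IsPath η := by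
  constructor
  · intro h s
    exact (isSwap_insertLeaf_iff hinv η t y p s).1 (h _)
  · intro h s
    rcases Fin.eq_self_or_eq_succAbove t s with rfl | ⟨s', rfl⟩
    · rw [insertLeaf_castSucc, insertLeaf_succ, ← Equiv.swap_apply_apply]
      refine ⟨_, _, fun h => ?_, rfl⟩
      have := (extend hinv (η s)).injective h
      exact p.2 (this ▸ hy)
    · exact (isSwap_insertLeaf_iff hinv η t y p s').2 (h s')

theorem touches_inv_insertLeaf_iff {i : ι} (hi : i ≠ i₀) (s : Fin b) :
    Touches (fun s => (insertLeaf hinv η t y p s)⁻¹) L (t.succAbove s) i ↔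
      Touches (fun s => (η s)⁻¹) (fun q => L q) s i := by
  have key : ∀ q : {x // L x ≠ i₀},
      (insertLeaf hinv η t y p (t.succAbove s).castSucc)⁻¹ q ≠
        (insertLeaf hinv η t y p (t.succAbove s).succ)⁻¹ q ↔
      (η s.castSucc)⁻¹ q ≠ (η s.succ)⁻¹ q := by
    intro q
    rw [insertLeaf_succAbove_castSucc, insertLeaf_succAbove_succ, mul_inv_rev, mul_inv_rev,
      Equiv.Perm.mul_apply, Equiv.Perm.mul_apply, (Equiv.injective _).ne_iff, extend_inv_apply_coe,
      extend_inv_apply_coe, Subtype.coe_injective.ne_iff]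
  constructor
  · rintro ⟨v, hv, h⟩
    exact ⟨⟨v, hv ▸ hi⟩, hv, (key _).1 h⟩
  · rintro ⟨q, hq, h⟩
    exact ⟨q, hq, (key q).2 h⟩

theorem not_touches_inv_insertLeaf (s : Fin b) :
    ¬ Touches (fun s => (insertLeaf hinv η t y p s)⁻¹) L (t.succAbove s) i₀ := by
  rintro ⟨v, hv, h⟩
  apply h
  simp only [insertLeaf_succAbove_castSucc, insertLeaf_succAbove_succ, mul_inv_rev,
    Equiv.Perm.mul_apply, extend_inv_apply_of_eq hinv _ hv]

theorem touches_inv_insertLeaf_self_iff (hy : L y = i₀) (i : ι) :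
    Touches (fun s => (insertLeaf hinv η t y p s)⁻¹) L t i ↔ i = i₀ ∨ i = L (η t p) := by
  have key : ∀ v, (insertLeaf hinv η t y p t.castSucc)⁻¹ v ≠
      (insertLeaf hinv η t y p t.succ)⁻¹ v ↔ v = σ y ∨ v = η t p := by
    intro v
    rw [insertLeaf_castSucc, insertLeaf_succ, mul_inv_rev, Equiv.Perm.mul_apply, Equiv.swap_inv,
      ne_comm, Equiv.swap_apply_ne_self_iff, Equiv.Perm.inv_eq_iff_eq, Equiv.Perm.inv_eq_iff_eq,
      extend_apply_coe, extend_apply_of_eq hinv _ hy]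
    refine and_iff_right fun h => p.2 (h ▸ hy)
  simp only [Touches, key]
  constructor
  · rintro ⟨v, rfl, rfl | rfl⟩
    · left
      rw [hinv, hy]
    · right
      rfl
  · rintro (rfl | rfl)
    · exact ⟨σ y, by rw [hinv, hy], Or.inl rfl⟩
    · exact ⟨_, rfl, Or.inr rfl⟩

variable (M : {x // L x ≠ i₀} → κ) {j : κ}

theorem touches_insertLeaf_iff (hy : L y = i₀) (hp : M p = j) {j' : κ} (hj : j' ≠ j) (s : Fin b) :
    Touches (insertLeaf hinv η t y p) (extendLab L i₀ j M) (t.succAbove s) j' ↔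
      Touches η M s j' := by
  have key : ∀ q : {x // L x ≠ i₀}, q ≠ p →
      (insertLeaf hinv η t y p (t.succAbove s).castSucc q ≠
        insertLeaf hinv η t y p (t.succAbove s).succ q ↔ η s.castSucc q ≠ η s.succ q) := by
    intro q hq
    have h1 : (if t.castSucc < (t.succAbove s).castSucc then Equiv.swap y (p : X) else 1) q = q := by
      split_ifs
      · refine Equiv.swap_apply_of_ne_of_ne (fun h => q.2 (h ▸ hy)) fun h => hq (Subtype.ext h)
      · rfl
    rw [insertLeaf_succAbove_castSucc, insertLeaf_succAbove_succ,
      Equiv.Perm.mul_apply, Equiv.Perm.mul_apply, h1, extend_apply_coe,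
      extend_apply_coe, Subtype.coe_injective.ne_iff]
  constructor
  · rintro ⟨v, hv, h⟩
    have hvi : L v ≠ i₀ := fun h => hj (by rw [← hv, extendLab_of_eq _ _ h])
    obtain ⟨q, rfl⟩ : ∃ q : {x // L x ≠ i₀}, (q : X) = v := ⟨⟨v, hvi⟩, rfl⟩
    rw [extendLab_coe] at hv
    exact ⟨q, hv, (key q fun h => hj (by rw [← hv, h, hp])).1 h⟩
  · rintro ⟨q, hq, h⟩
    exact ⟨q, by rw [extendLab_coe, hq], (key q fun h => hj (by rw [← hq, h, hp])).2 h⟩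

theorem eq_of_touches_insertLeaf_self (hp : M p = j) (hy : L y = i₀) {j' : κ}
    (h : Touches (insertLeaf hinv η t y p) (extendLab L i₀ j M) t j') : j' = j := by
  obtain ⟨v, rfl, h⟩ := h
  rw [insertLeaf_castSucc, insertLeaf_succ, Equiv.Perm.mul_apply, (Equiv.injective _).ne_iff,
    ne_comm, Equiv.swap_apply_ne_self_iff] at h
  rcases h.2 with rfl | rfl
  · rw [extendLab_of_eq _ _ hy]
  · rw [extendLab_coe, hp]

theorem adm_insertLeaf_iff [Finite X] [DecidableEq ι] [DecidableEq κ] {μ : ι → ℕ} (hσ : Lab σ μ L)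
    (hy : L y = i₀) {ν : κ → ℕ} {I : Finset ι} {α : ι → κ} {J : Finset κ} (hI : i₀ ∉ I)
    (hJ : α i₀ ∉ J) (hp : M p = α i₀) (hν : μ i₀ ≤ ν (α i₀)) (ht : L (η t p) ∉ I) :
    Adm σ L ν (insert i₀ I) α J (insertLeaf hinv η t y p) (extendLab L i₀ (α i₀) M) ↔
      Adm (rest i₀ hinv) (fun q => L q)
        (Function.update ν (α i₀) (ν (α i₀) - μ i₀)) I α J η M := by
  have hlab : Lab (insertLeaf hinv η t y p (Fin.last _)) ν (extendLab L i₀ (α i₀) M) ↔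
      Lab (η (Fin.last b)) (Function.update ν (α i₀) (ν (α i₀) - μ i₀)) M := by
    rw [insertLeaf_last, lab_extend_swap_iff hinv _ p hσ hy (fun x => extendLab_of_eq _ _)
      (by rw [extendLab_coe, hp]) hν]
    simp only [extendLab_coe]
  have hne : ∀ i ∈ I, i ≠ i₀ := fun i hi h => hI (h ▸ hi)
  have hne' : ∀ j ∈ J, j ≠ α i₀ := fun i hi h => hJ (h ▸ hi)
  constructor
  · intro h
    refine ⟨extend_injective hinv ?_, (isPath_insertLeaf_iff hinv η t y p hy).1 h.step,
      hlab.1 h.lab, fun i hi s s' hs hs' => ?_, fun j hj s s' hs hs' => ?_, fun q hq => ?_⟩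
    · rw [extend_rest, ← insertLeaf_zero hinv η t y p, h.start]
    · rw [← touches_inv_insertLeaf_iff hinv η t y p (hne i hi)] at hs hs'
      exact Fin.succAbove_right_injective
        (h.leaf i (Finset.mem_insert_of_mem hi) _ _ hs hs')
    · rw [← touches_insertLeaf_iff hinv η t y p M hy hp (hne' j hj)] at hs hs'
      exact Fin.succAbove_right_injective (h.dual j hj _ _ hs hs')
    · rw [← h.label q (Finset.mem_insert_of_mem hq), extendLab_coe]
  · intro h
    refine ⟨?_, (isPath_insertLeaf_iff hinv η t y p hy).2 h.step,
      hlab.2 h.lab, fun i hi s s' hs hs' => ?_, fun j hj s s' hs hs' => ?_, fun x hx => ?_⟩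
    · rw [insertLeaf_zero, h.start, extend_rest]
    · rcases Finset.mem_insert.1 hi with rfl | hi
      · have key : ∀ s, Touches (fun s => (insertLeaf hinv η t y p s)⁻¹) L s i → s = t := by
          intro s hs
          rcases Fin.eq_self_or_eq_succAbove t s with rfl | ⟨s', rfl⟩
          · rfl
          · exact absurd hs (not_touches_inv_insertLeaf hinv η t y p s')
        rw [key s hs, key s' hs']
      · have key : ∀ s, Touches (fun s => (insertLeaf hinv η t y p s)⁻¹) L s i →
            ∃ s', s = t.succAbove s' ∧ Touches (fun s => (η s)⁻¹) (fun q => L q) s' i := by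
          intro s hs
          rcases Fin.eq_self_or_eq_succAbove t s with rfl | ⟨s', rfl⟩
          · rcases (touches_inv_insertLeaf_self_iff hinv η s y p hy i).1 hs with h | h
            · exact absurd h (hne i hi)
            · exact absurd hi (h ▸ ht)
          · exact ⟨s', rfl, (touches_inv_insertLeaf_iff hinv η t y p (hne i hi) s').1 hs⟩
        obtain ⟨a, rfl, ha⟩ := key s hs
        obtain ⟨a', rfl, ha'⟩ := key s' hs'
        rw [h.leaf i hi a a' ha ha']
    · have key : ∀ s, Touches (insertLeaf hinv η t y p) (extendLab L i₀ (α i₀) M) s j →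
            ∃ s', s = t.succAbove s' ∧ Touches η M s' j := by
          intro s hs
          rcases Fin.eq_self_or_eq_succAbove t s with rfl | ⟨s', rfl⟩
          · exact absurd (eq_of_touches_insertLeaf_self hinv η s y p M hp hy hs) (hne' j hj)
          · exact ⟨s', rfl, (touches_insertLeaf_iff hinv η t y p M hy hp (hne' j hj) s').1 hs⟩
      obtain ⟨a, rfl, ha⟩ := key s hs
      obtain ⟨a', rfl, ha'⟩ := key s' hs'
      rw [h.dual j hj a a' ha ha']
    · by_cases hxi : L x = i₀
      · rw [extendLab_of_eq _ _ hxi, hxi]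
      · rw [show x = ((⟨x, hxi⟩ : {x // L x ≠ i₀}) : X) from rfl, extendLab_coe]
        exact h.label _ ((Finset.mem_insert.1 hx).resolve_left hxi)

end

end Fermion

namespace Fermion

variable {X : Type} {ι κ : Type} {b : ℕ}

/-- No partial sums of `μ` and `ν` agree except for the trivial ones. -/
def Generic [Fintype ι] (μ : ι → ℕ) (ν : κ → ℕ) : Prop :=
  ∀ (I : Finset ι) (J : Finset κ), ∑ i ∈ I, μ i = ∑ j ∈ J, ν j →
    ∑ i ∈ I, μ i = 0 ∨ ∑ i ∈ I, μ i = ∑ i, μ i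

theorem Generic.symm [Fintype ι] [Fintype κ] {μ : ι → ℕ} {ν : κ → ℕ} (h : Generic μ ν)
    (hs : ∑ i, μ i = ∑ j, ν j) : Generic ν μ := by
  intro J I hJI
  rw [hJI, ← hs]
  exact h I J hJI.symm

theorem Lab.card_mem [Fintype X] [DecidableEq ι] {σ : Equiv.Perm X} {μ : ι → ℕ} {L : X → ι}
    (h : Lab σ μ L) (I : Finset ι) :
    (Finset.univ.filter fun x => L x ∈ I).card = ∑ i ∈ I, μ i := by
  rw [Finset.card_eq_sum_card_fiberwise (f := L) (t := I) (by intro x hx; simpa using hx)]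
  refine Finset.sum_congr rfl fun i hi => ?_
  rw [← h.card i, Nat.card_eq_fintype_card, Fintype.card_subtype, Finset.filter_filter]
  congr 1
  ext x
  simp only [Finset.mem_filter, Finset.mem_univ, true_and, and_iff_right_iff_imp]
  rintro rfl
  exact hi

/-- In the generic case a proper union of cycles of `σ` is not a union of cycles of `ζ`. -/
theorem Generic.trivial_of_invariant [Finite X] [Fintype ι] [Fintype κ] [DecidableEq ι]
    {μ : ι → ℕ} {ν : κ → ℕ} (hG : Generic μ ν) {σ ζ : Equiv.Perm X} {L : X → ι} {M : X → κ}
    (hσ : Lab σ μ L) (hζ : Lab ζ ν M) {I : Finset ι} (hI : ∀ x, L x ∈ I → L (ζ x) ∈ I) :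
    (∀ x, L x ∉ I) ∨ ∀ x, L x ∈ I := by
  classical
  have := Fintype.ofFinite X
  have hinv : ∀ x, L (ζ x) ∈ I ↔ L x ∈ I := by
    intro x
    refine ⟨fun h => ?_, hI x⟩
    have h1 := Equiv.Perm.perm_symm_on_of_perm_on_finite (p := fun x => L x ∈ I) hI h
    rwa [Equiv.symm_apply_apply] at h1
  have hconst : ∀ x y, M x = M y → (L x ∈ I ↔ L y ∈ I) := by
    intro x y hxy
    have := hζ.eq_of_invariant (f := fun x => L x ∈ I) (fun x => propext (hinv x)) hxy
    exact iff_of_eq this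
  set B := Finset.univ.filter fun x => L x ∈ I with hB
  have h1 : B = Finset.univ.filter fun x => M x ∈ B.image M := by
    ext x
    simp only [hB, Finset.mem_filter, Finset.mem_univ, true_and, Finset.mem_image]
    exact ⟨fun h => ⟨x, h, rfl⟩, fun ⟨y, hy, hxy⟩ => (hconst _ _ hxy).1 hy⟩
  have h2 : ∑ i ∈ I, μ i = ∑ j ∈ B.image M, ν j := by
    rw [← hσ.card_mem, ← hζ.card_mem, ← hB]
    exact congrArg _ h1
  rcases hG _ _ h2 with h | h
  · left
    rw [← hσ.card_mem, Finset.card_eq_zero, Finset.filter_eq_empty_iff] at h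
    exact fun x => h (Finset.mem_univ x)
  · right
    rw [hσ.sum_eq, ← hσ.card_mem, Finset.card_eq_iff_eq_univ] at h
    intro x
    have hx : x ∈ Finset.univ := Finset.mem_univ x
    rw [← h] at hx
    exact (Finset.mem_filter.1 hx).2

theorem Generic.trivial_of_inv_invariant [Finite X] [Fintype ι] [Fintype κ] [DecidableEq ι]
    {μ : ι → ℕ} {ν : κ → ℕ} (hG : Generic μ ν) {σ ζ : Equiv.Perm X} {L : X → ι} {M : X → κ}
    (hσ : Lab σ μ L) (hζ : Lab ζ ν M) {I : Finset ι} (hI : ∀ x, L x ∈ I → L (ζ⁻¹ x) ∈ I) :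
    (∀ x, L x ∉ I) ∨ ∀ x, L x ∈ I :=
  hG.trivial_of_invariant hσ hζ fun _ hx =>
    Equiv.Perm.perm_symm_on_of_perm_on_finite (p := fun x => L x ∈ I) hI hx

theorem Lab.exists_eq [Finite X] {σ : Equiv.Perm X} {μ : ι → ℕ} {L : X → ι} (h : Lab σ μ L) {i : ι}
    (hi : 0 < μ i) : ∃ x, L x = i := by
  rw [← h.card i, Nat.card_pos_iff] at hi
  obtain ⟨x, hx⟩ := hi.1
  exact ⟨x, hx⟩

theorem Lab.inv_apply [Finite X] {σ : Equiv.Perm X} {μ : ι → ℕ} {L : X → ι} (h : Lab σ μ L) (x : X) :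
    L (σ⁻¹ x) = L x := by
  rw [← h.inv, perm_apply_inv]

section

variable [DecidableEq X] [Finite X] [Fintype ι] [Fintype κ] [DecidableEq ι]
  {σ : Equiv.Perm X} {L : X → ι} {i₀ : ι} {μ : ι → ℕ} {ν : κ → ℕ} {I : Finset ι} {α : ι → κ}
  {J : Finset κ} {M : X → κ}

theorem Adm.exists_touches (hσ : Lab σ μ L) (hG : Generic μ ν) (hμ : 0 < μ i₀)
    (hk : ∃ k ∉ insert i₀ I, 0 < μ k) {η : Fin (b + 1) → Equiv.Perm X}
    (h : Adm σ L ν (insert i₀ I) α J η M) : ∃ t, Touches (fun s => (η s)⁻¹) L t i₀ := by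
  by_contra! hcon
  obtain ⟨k, hkI, hk⟩ := hk
  obtain ⟨x, hx⟩ := hσ.exists_eq hμ
  obtain ⟨z, hz⟩ := hσ.exists_eq hk
  have hinv : ∀ v, L v ∈ ({i₀} : Finset ι) → L ((η (Fin.last b))⁻¹ v) ∈ ({i₀} : Finset ι) := by
    intro v hv
    rw [Finset.mem_singleton] at hv ⊢
    rw [eq_zero_of_not_touches hcon hv, h.start, hσ.inv_apply, hv]
  rcases hG.trivial_of_inv_invariant hσ h.lab hinv with h1 | h1
  · exact h1 x (by simp [hx])
  · have := h1 z
    rw [Finset.mem_singleton, hz] at this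
    simp [this] at hkI

variable [DecidableEq κ]

theorem Adm.exists_insertLeaf (hσ : Lab σ μ L) (hG : Generic μ ν) (hμ : 0 < μ i₀)
    (hk : ∃ k ∉ insert i₀ I, 0 < μ k) (hj : ∃ j ∉ J, 0 < ν j) {η : Fin (b + 2) → Equiv.Perm X}
    (h : Adm σ L ν (insert i₀ I) α J η M) :
    α i₀ ∉ J ∧ μ i₀ ≤ ν (α i₀) ∧
    ∃ (η' : Fin (b + 1) → Equiv.Perm {x // L x ≠ i₀}) (M' : {x // L x ≠ i₀} → κ)
      (t : Fin (b + 1)) (y : X) (p : {x // L x ≠ i₀}), L y = i₀ ∧ M' p = α i₀ ∧ L (η' t p) ∉ I ∧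
      η = insertLeaf hσ.inv η' t y p ∧ M = extendLab L i₀ (α i₀) M' := by
  obtain ⟨t, ht⟩ := h.exists_touches hσ hG hμ hk
  obtain ⟨k, hkI, hk⟩ := hk
  obtain ⟨xk, hxk⟩ := hσ.exists_eq hk
  have hleaf := h.leaf i₀ (Finset.mem_insert_self _ _)
  obtain ⟨y, z, hyi, hyz, hstep⟩ : ∃ y z, L y = i₀ ∧ y ≠ z ∧
      η t.succ = Equiv.swap y z * η t.castSucc := by
    obtain ⟨v, hv, hne⟩ := ht
    obtain ⟨y, z, hyz, hstep⟩ := h.step t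
    have hstep' : η t.succ = Equiv.swap y z * η t.castSucc := by
      rw [← hstep, inv_mul_cancel_right]
    simp only [hstep', mul_inv_rev, Equiv.Perm.mul_apply] at hne
    rw [(Equiv.injective _).ne_iff, Equiv.swap_inv,
      ne_comm, Equiv.swap_apply_ne_self_iff] at hne
    rcases hne.2 with rfl | rfl
    · exact ⟨v, z, hv, hyz, hstep'⟩
    · exact ⟨v, y, hv, hyz.symm, by rw [Equiv.swap_comm, hstep']⟩
  have hstep2 : ∀ v, (η t.succ)⁻¹ v = (η t.castSucc)⁻¹ (Equiv.swap y z v) := by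
    intro v
    rw [hstep, mul_inv_rev, Equiv.swap_inv, Equiv.Perm.mul_apply]
  have hA : ∀ v, L v = i₀ → ∀ s ≤ t.castSucc, (η s)⁻¹ v = σ⁻¹ v := by
    intro v hv s hs
    rw [hleaf.eq_zero ht hv hs, h.start]
  have hA' : ∀ v, L v = i₀ → ∀ s, t.castSucc < s →
      (η s)⁻¹ v = (η t.castSucc)⁻¹ (Equiv.swap y z v) := by
    intro v hv s hs
    rw [← hstep2, hleaf.eq_last ht hv hs, hleaf.eq_last ht hv Fin.castSucc_lt_succ]
  have hlast : t.castSucc < Fin.last (b + 1) := Fin.castSucc_lt_last t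
  -- a union of cycles cannot split off
  have hsplit : ∀ I' ⊆ insert i₀ I, i₀ ∈ I' →
      ¬ ∀ v, L v ∈ I' → L ((η (Fin.last (b + 1)))⁻¹ v) ∈ I' := by
    intro I' hI' hi hinv
    rcases hG.trivial_of_inv_invariant hσ h.lab hinv with h1 | h1
    · exact h1 y (hyi ▸ hi)
    · exact hkI (hI' (hxk ▸ h1 xk))
  have hz : L z ≠ i₀ := by
    intro hz
    refine hsplit {i₀} (by simp) (by simp) fun v hv => ?_
    rw [Finset.mem_singleton] at hv ⊢
    have : L (Equiv.swap y z v) = i₀ := by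
      rcases eq_or_ne v y with rfl | h1
      · rw [Equiv.swap_apply_left, hz]
      rcases eq_or_ne v z with rfl | h2
      · rw [Equiv.swap_apply_right, hyi]
      rw [Equiv.swap_apply_of_ne_of_ne h1 h2, hv]
    rw [hA' v hv _ hlast, hA _ this _ le_rfl, hσ.inv_apply, this]
  have hzI : L z ∉ I := by
    intro hzI
    have hleafz := h.leaf _ (Finset.mem_insert_of_mem hzI)
    have htz : Touches (fun s => (η s)⁻¹) L t (L z) := by
      refine ⟨z, rfl, ?_⟩
      rw [hstep2, Equiv.swap_apply_right, (Equiv.injective _).ne_iff]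
      exact hyz.symm
    have hB : ∀ v, L v = L z → (η t.castSucc)⁻¹ v = σ⁻¹ v := by
      intro v hv
      rw [hleafz.eq_zero htz hv le_rfl, h.start]
    have hB' : ∀ v, L v = L z → (η (Fin.last (b + 1)))⁻¹ v =
        (η t.castSucc)⁻¹ (Equiv.swap y z v) := by
      intro v hv
      rw [← hstep2, ← hleafz.eq_last htz hv Fin.castSucc_lt_succ]
    refine hsplit {i₀, L z} ?_ (by simp) fun v hv => ?_
    · rw [Finset.insert_subset_iff, Finset.singleton_subset_iff]
      exact ⟨Finset.mem_insert_self _ _, Finset.mem_insert_of_mem hzI⟩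
    · have h0 : (η (Fin.last (b + 1)))⁻¹ v = (η t.castSucc)⁻¹ (Equiv.swap y z v) := by
        rw [Finset.mem_insert, Finset.mem_singleton] at hv
        rcases hv with hv | hv
        · exact hA' v hv _ hlast
        · exact hB' v hv
      have h1 : L (Equiv.swap y z v) ∈ ({i₀, L z} : Finset ι) := by
        rcases eq_or_ne v y with rfl | h1
        · simp
        rcases eq_or_ne v z with rfl | h2
        · simp [hyi]
        rwa [Equiv.swap_apply_of_ne_of_ne h1 h2]
      have h2 : (η t.castSucc)⁻¹ (Equiv.swap y z v) = σ⁻¹ (Equiv.swap y z v) := by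
        rw [Finset.mem_insert, Finset.mem_singleton] at h1
        rcases h1 with h1 | h1
        · exact hA _ h1 _ le_rfl
        · exact hB _ h1
      rw [h0, h2, hσ.inv_apply]
      exact h1
  have hx : (η t.castSucc)⁻¹ y = σ⁻¹ y := hA y hyi _ le_rfl
  have hpi : L ((η t.castSucc)⁻¹ z) ≠ i₀ := by
    intro hpi
    have h1 := hA (σ ((η t.castSucc)⁻¹ z)) (by rw [hσ.inv, hpi]) _ le_rfl
    rw [perm_inv_apply] at h1
    have h2 := (Equiv.injective _) h1
    apply hz
    rw [← h2, hσ.inv, hpi]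
  set p : {x // L x ≠ i₀} := ⟨(η t.castSucc)⁻¹ z, hpi⟩ with hp
  set x := σ⁻¹ y with hxdef
  have hxi : L x = i₀ := by rw [hσ.inv_apply, hyi]
  have hstep3 : η t.succ = η t.castSucc * Equiv.swap x p := by
    rw [hstep, Equiv.swap_mul_eq_mul_swap, hx]
  have hexists : ∀ s, ∃ ρ : Equiv.Perm {x // L x ≠ i₀}, extend hσ.inv ρ =
      η s * if t.castSucc < s then Equiv.swap x p else 1 := by
    intro s
    refine exists_extend_eq hσ.inv fun v hv => ?_
    rw [Equiv.Perm.mul_apply, ← Equiv.Perm.eq_inv_iff_eq]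
    have h1 : (η t.castSucc)⁻¹ (σ v) = v := by
      rw [hA _ (by rw [hσ.inv, hv]) _ le_rfl, perm_inv_apply]
    split_ifs with hs
    · rw [hA' _ (by rw [hσ.inv, hv]) _ hs, ← hstep2, hstep3, mul_inv_rev, Equiv.swap_inv,
        Equiv.Perm.mul_apply, h1]
    · rw [hA _ (by rw [hσ.inv, hv]) _ (not_lt.1 hs), perm_inv_apply]
      rfl
  choose ρ hρ using hexists
  have hρt : ρ t.castSucc = ρ t.succ := by
    apply extend_injective hσ.inv
    rw [hρ, hρ, if_neg (lt_irrefl _), if_pos Fin.castSucc_lt_succ, hstep3, mul_one,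
      Equiv.mul_swap_mul_self]
  have hη : η = insertLeaf hσ.inv (fun a => ρ (t.castSucc.succAbove a)) t x p := by
    funext s
    have h1 : ρ (t.castSucc.succAbove (t.predAbove s)) = ρ s := by
      rcases eq_or_ne s t.castSucc with rfl | hs
      · rw [Fin.predAbove_castSucc_self, Fin.succAbove_castSucc_self, hρt]
      · rcases hs.lt_or_gt with hs | hs
        · rw [Fin.predAbove_of_le_castSucc _ _ hs.le, Fin.succAbove_of_castSucc_lt]
          · rw [Fin.castSucc_castPred]
          · rwa [Fin.castSucc_castPred]
        · have h2 := Fin.succAbove_succAbove_predAbove s t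
          rw [Fin.succAbove_of_castSucc_lt _ _ hs] at h2
          rw [h2]
    rw [insertLeaf, h1, hρ, mul_assoc]
    split_ifs
    · rw [Equiv.swap_mul_self, mul_one]
    · rw [mul_one, mul_one]
  have hMA : ∀ v, L v = i₀ → M v = α i₀ := by
    intro v hv
    rw [h.label v (hv ▸ Finset.mem_insert_self _ _), hv]
  have hMp : M p = α i₀ := by
    have h1 := h.lab.inv p
    rw [hη, insertLeaf_last, extend_swap_right _ _ _ hxi, hMA _ (by rw [hσ.inv, hxi])] at h1
    exact h1.symm
  refine ⟨fun hJ => ?_, ?_, fun a => ρ (t.castSucc.succAbove a), fun q => M q, t, x, p, hxi, hMp,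
    ?_, hη, ?_⟩
  · have hd := h.dual _ hJ
    have htd : Touches η M t (α i₀) := by
      refine ⟨x, hMA x hxi, ?_⟩
      rw [hstep3, Equiv.Perm.mul_apply, (Equiv.injective _).ne_iff, Equiv.swap_apply_left]
      intro h1
      exact p.2 (h1 ▸ hxi)
    have h1 : ∀ v, M v = α i₀ → M (σ v) = α i₀ := by
      intro v hv
      have hsw : M (Equiv.swap x (p : X) v) = α i₀ := by
        rcases eq_or_ne v x with rfl | h1
        · rw [Equiv.swap_apply_left, hMp]
        rcases eq_or_ne v p with rfl | h2
        · rw [Equiv.swap_apply_right, hMA x hxi]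
        rw [Equiv.swap_apply_of_ne_of_ne h1 h2, hv]
      have h2 := h.lab.inv (Equiv.swap x (p : X) v)
      rw [← hd.eq_last htd hsw Fin.castSucc_lt_succ, hstep3, Equiv.Perm.mul_apply,
        Equiv.swap_apply_self, hd.eq_zero htd hv le_rfl, h.start, hsw] at h2
      exact h2
    have := Fintype.ofFinite X
    obtain ⟨j', hj', hν⟩ := hj
    obtain ⟨w, hw⟩ := h.lab.exists_eq hν
    have h2 := (hG.symm (hσ.sum_eq.trans h.lab.sum_eq.symm)).trivial_of_invariant h.lab hσ
      (I := {α i₀}) (by simpa using h1)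
    rcases h2 with h2 | h2
    · exact h2 x (by simp [hMA x hxi])
    · have h3 := h2 w
      rw [Finset.mem_singleton, hw] at h3
      exact hj' (h3 ▸ hJ)
  · rw [← hσ.card i₀, ← h.lab.card]
    exact Nat.card_mono (Set.toFinite _) hMA
  · have h1 : ((ρ (t.castSucc.succAbove t) p : {x // L x ≠ i₀}) : X) = z := by
      rw [Fin.succAbove_castSucc_self, ← hρt, ← extend_apply_coe hσ.inv, hρ,
        if_neg (lt_irrefl _), mul_one, hp, perm_apply_inv]
    rw [h1]
    exact hzI
  · funext v
    by_cases hv : L v = i₀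
    · rw [extendLab_of_eq _ _ hv, hMA v hv]
    · exact (extendLab_coe (α i₀) (fun q : {x // L x ≠ i₀} => M q) ⟨v, hv⟩).symm

end

end Fermion

namespace Fermion

variable {X : Type} {ι κ : Type} {b : ℕ}

theorem card_subtype_prod {A B : Type*} [Finite A] [Finite B] (P : A → Prop) (R : A → B → Prop)
    {c : ℕ} (h : ∀ a, P a → Nat.card {b // R a b} = c) :
    Nat.card {w : A × B // P w.1 ∧ R w.1 w.2} = Nat.card {a // P a} * c := by
  classical
  have := Fintype.ofFinite {a // P a}
  let e : {w : A × B // P w.1 ∧ R w.1 w.2} ≃ Σ a : {a // P a}, {b // R a b} :=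
    { toFun := fun w => ⟨⟨w.1.1, w.2.1⟩, w.1.2, w.2.2⟩
      invFun := fun a => ⟨(a.1, a.2.1), a.1.2, a.2.2⟩
      left_inv := fun _ => rfl
      right_inv := fun _ => rfl }
  have h1 : ∀ a : {a // P a}, Nat.card {b // R a b} = c := fun a => h a.1 a.2
  rw [Nat.card_congr e, Nat.card_sigma, Finset.sum_congr rfl fun a _ => h1 a, Finset.sum_const,
    Finset.card_univ, Nat.card_eq_fintype_card, smul_eq_mul]

section

variable {σ : Equiv.Perm X} {L : X → ι} {i₀ : ι}

theorem Lab.rest [Finite X] [DecidableEq ι] {μ : ι → ℕ} (h : Lab σ μ L) :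
    Lab (rest i₀ h.inv) (Function.update μ i₀ 0) (fun q : {x // L x ≠ i₀} => L q) := by
  classical
  refine ⟨fun q => h.inv q, fun i => ?_, fun q q' hq => sameCycle_of_invariant fun f hf => ?_⟩
  · by_cases hi : i = i₀
    · subst hi
      rw [Function.update_self, Nat.card_eq_zero]
      exact Or.inl ⟨fun q => q.1.2 q.2⟩
    · rw [Function.update_of_ne hi, ← h.card i]
      refine Nat.card_congr ⟨fun q => ⟨q.1, q.2⟩, fun x => ⟨⟨x.1, fun hx => hi (x.2.symm.trans hx)⟩, x.2⟩, fun _ => rfl,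
        fun _ => rfl⟩
  · have := h.eq_of_invariant (f := extendLab L i₀ 0 f) (fun z => ?_) hq
    · rwa [extendLab_coe, extendLab_coe] at this
    · by_cases hz : L z = i₀
      · rw [extendLab_of_eq _ _ hz, extendLab_of_eq _ _ (by rw [h.inv, hz])]
      · have h1 := hf ⟨z, hz⟩
        rw [← extendLab_coe (0 : ℤ) f, ← extendLab_coe (0 : ℤ) f] at h1
        exact h1

theorem insertLeaf_inj [DecidableEq X] (hinv : ∀ x, L (σ x) = L x)
    {η η' : Fin (b + 1) → Equiv.Perm {x // L x ≠ i₀}} {t t' : Fin (b + 1)} {y y' : X}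
    {p p' : {x // L x ≠ i₀}} (hy : L y = i₀) (hy' : L y' = i₀)
    (h : insertLeaf hinv η t y p = insertLeaf hinv η' t' y' p') :
    η = η' ∧ t = t' ∧ y = y' ∧ p = p' := by
  have ht : t = t' := by
    have h1 := (touches_inv_insertLeaf_self_iff hinv η t y p hy i₀).2 (Or.inl rfl)
    rw [h] at h1
    rcases Fin.eq_self_or_eq_succAbove t' t with h2 | ⟨s, h2⟩
    · exact h2
    · rw [h2] at h1
      exact absurd h1 (not_touches_inv_insertLeaf hinv η' t' y' p' s)
  subst ht
  have hc := congrFun h t.castSucc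
  have hs := congrFun h t.succ
  rw [insertLeaf_castSucc, insertLeaf_castSucc] at hc
  rw [insertLeaf_succ, insertLeaf_succ, hc, mul_left_cancel_iff] at hs
  have hp : ∀ q : {x // L x ≠ i₀}, (q : X) ≠ y := fun q hq => q.2 (hq ▸ hy)
  have hp' : ∀ q : {x // L x ≠ i₀}, (q : X) ≠ y' := fun q hq => q.2 (hq ▸ hy')
  have hyy : y = y' := by
    have h1 : Equiv.swap y' (p' : X) y ≠ y := by
      rw [← hs, Equiv.swap_apply_left]
      exact hp p
    rw [Equiv.swap_apply_ne_self_iff] at h1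
    exact h1.2.resolve_right fun h2 => hp p' h2.symm
  subst hyy
  have hpp : p = p' := by
    have h1 : Equiv.swap y (p : X) y = Equiv.swap y (p' : X) y := by rw [hs]
    rw [Equiv.swap_apply_left, Equiv.swap_apply_left] at h1
    exact Subtype.ext h1
  subst hpp
  refine ⟨funext fun a => ?_, rfl, rfl, rfl⟩
  obtain ⟨s, rfl⟩ : ∃ s, t.predAbove s = a := Fin.predAbove_surjective t a
  have h1 := congrFun h s
  rw [insertLeaf, insertLeaf, mul_right_cancel_iff] at h1
  exact extend_injective hinv h1

end

section

variable [DecidableEq X] {σ : Equiv.Perm X} {L : X → ι} {μ : ι → ℕ} {ν : κ → ℕ} {I : Finset ι}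
  {α : ι → κ} {J : Finset κ} {M : X → κ}

/-- The number of admissible sequences of length `b`. -/
noncomputable def admCard (b : ℕ) (σ : Equiv.Perm X) (L : X → ι) (ν : κ → ℕ) (I : Finset ι)
    (α : ι → κ) (J : Finset κ) : ℕ :=
  Nat.card {w : (Fin (b + 1) → Equiv.Perm X) × (X → κ) // Adm σ L ν I α J w.1 w.2}

theorem Adm.apply_inv [Finite X] (hσ : Lab σ μ L) {η : Fin (b + 1) → Equiv.Perm X}
    (h : Adm σ L ν I α J η M) {x : X} (hx : L x ∈ I) (t : Fin (b + 1)) :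
    M ((η t)⁻¹ x) = α (L x) := by
  have h0 : M ((η 0)⁻¹ x) = α (L x) := by
    rw [h.start, h.label _ (by rwa [hσ.inv_apply]), hσ.inv_apply]
  by_cases hcon : ∃ s, Touches (fun s => (η s)⁻¹) L s (L x)
  · obtain ⟨s, hs⟩ := hcon
    rcases le_or_gt t s.castSucc with ht | ht
    · rwa [(h.leaf _ hx).eq_zero hs rfl ht]
    · rw [(h.leaf _ hx).eq_last hs rfl ht, h.lab.inv_apply, h.label x hx]
  · rw [not_exists] at hcon
    rwa [eq_zero_of_not_touches hcon rfl]

theorem Adm.card_join [Finite X] [DecidableEq ι] [DecidableEq κ] (hσ : Lab σ μ L)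
    {η : Fin (b + 1) → Equiv.Perm X}
    (h : Adm σ L ν I α J η M) (j : κ) (t : Fin (b + 1)) :
    Nat.card {p // M p = j ∧ L (η t p) ∉ I} = ν j - ∑ i ∈ I with α i = j, μ i := by
  classical
  have := Fintype.ofFinite X
  have h1 : (Finset.univ.filter fun p => M p = j ∧ L (η t p) ∈ I).card =
      ∑ i ∈ I with α i = j, μ i := by
    rw [← hσ.card_mem]
    refine Finset.card_equiv (η t) fun p => ?_
    simp only [Finset.mem_filter, Finset.mem_univ, true_and]
    rw [and_comm]
    refine and_congr_right fun hp => ?_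
    have := h.apply_inv hσ hp t
    rw [perm_inv_apply] at this
    rw [this]
  have h2 := Finset.card_filter_add_card_filter_not (s := Finset.univ.filter fun p => M p = j)
    (fun p => L (η t p) ∈ I)
  rw [Finset.filter_filter, Finset.filter_filter, h1] at h2
  have h3 : (Finset.univ.filter fun p => M p = j).card = ν j := by
    rw [← h.lab.card j, Nat.card_eq_fintype_card, Fintype.card_subtype]
  rw [Nat.card_eq_fintype_card, Fintype.card_subtype]
  omega

theorem admCard_insert [Finite X] [Fintype ι] [Fintype κ] [DecidableEq ι] [DecidableEq κ]
    {i₀ : ι} (hσ : Lab σ μ L) (hG : Generic μ ν)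
    (hI : i₀ ∉ I) (hμ : 0 < μ i₀) (hk : ∃ k ∉ insert i₀ I, 0 < μ k) (hj : ∃ j ∉ J, 0 < ν j)
    (hJ : α i₀ ∉ J) :
    admCard (b + 1) σ L ν (insert i₀ I) α J = (b + 1) * (μ i₀ *
      (ν (α i₀) - μ i₀ - ∑ i ∈ I with α i = α i₀, μ i)) *
      admCard b (rest i₀ hσ.inv) (fun q => L q)
        (Function.update ν (α i₀) (ν (α i₀) - μ i₀)) I α J := by
  by_cases hν : μ i₀ ≤ ν (α i₀)
  swap
  · have : ν (α i₀) - μ i₀ - ∑ i ∈ I with α i = α i₀, μ i = 0 := by omega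
    rw [this, mul_zero, mul_zero, zero_mul, admCard, Nat.card_eq_zero]
    exact Or.inl ⟨fun w => hν (w.2.exists_insertLeaf hσ hG hμ hk hj).2.1⟩
  rw [mul_comm, admCard, admCard]
  set P : (Fin (b + 1) → Equiv.Perm {x // L x ≠ i₀}) × ({x // L x ≠ i₀} → κ) → Prop := fun w =>
    Adm (rest i₀ hσ.inv) (fun q => L q)
      (Function.update ν (α i₀) (ν (α i₀) - μ i₀)) I α J w.1 w.2 with hP
  let R : (Fin (b + 1) → Equiv.Perm {x // L x ≠ i₀}) × ({x // L x ≠ i₀} → κ) →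
    Fin (b + 1) × X × {x // L x ≠ i₀} → Prop := fun w u =>
      True ∧ L u.2.1 = i₀ ∧ w.2 u.2.2 = α i₀ ∧ L (w.1 u.1 u.2.2) ∉ I
  rw [← card_subtype_prod P R fun w hw => ?_]
  · symm
    refine Nat.card_eq_of_bijective (fun u => ⟨(insertLeaf hσ.inv u.1.1.1 u.1.2.1 u.1.2.2.1
      u.1.2.2.2, extendLab L i₀ (α i₀) u.1.1.2), (adm_insertLeaf_iff hσ.inv _ _ _ _ _ hσ u.2.2.2.1
        hI hJ u.2.2.2.2.1 hν u.2.2.2.2.2).2 u.2.1⟩) ⟨?_, ?_⟩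
    · rintro ⟨⟨⟨η, M⟩, t, y, p⟩, h1, _, h2, h3⟩ ⟨⟨⟨η', M'⟩, t', y', p'⟩, h1', _, h2', h3'⟩ heq
      have hq1 : insertLeaf hσ.inv η t y p = insertLeaf hσ.inv η' t' y' p' :=
        congrArg (fun w => w.1.1) heq
      have hq2 : extendLab L i₀ (α i₀) M = extendLab L i₀ (α i₀) M' :=
        congrArg (fun w => w.1.2) heq
      obtain ⟨rfl, rfl, rfl, rfl⟩ := insertLeaf_inj hσ.inv h2 h2' hq1
      have : M = M' := by
        funext q
        have := congrFun hq2 q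
        rwa [extendLab_coe, extendLab_coe] at this
      subst this
      rfl
    · rintro ⟨⟨η, M⟩, h⟩
      obtain ⟨-, -, η', M', t, y, p, hy, hp, ht, rfl, rfl⟩ :=
        h.exists_insertLeaf hσ hG hμ hk hj
      exact ⟨⟨((η', M'), t, y, p), (adm_insertLeaf_iff hσ.inv _ _ _ _ _ hσ hy hI hJ hp hν ht).1 h,
        trivial, hy, hp, ht⟩, rfl⟩
  · rw [card_subtype_prod (fun _ => True) (fun t (u : X × {x // L x ≠ i₀}) =>
      L u.1 = i₀ ∧ w.2 u.2 = α i₀ ∧ L (w.1 t u.2) ∉ I)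
      (c := μ i₀ * (ν (α i₀) - μ i₀ - ∑ i ∈ I with α i = α i₀, μ i)) fun t _ => ?_]
    · congr 1
      rw [Nat.card_congr (Equiv.subtypeUnivEquiv fun _ => trivial), Nat.card_fin]
    · rw [card_subtype_prod (fun y => L y = i₀) (fun _ (p : {x // L x ≠ i₀}) =>
        w.2 p = α i₀ ∧ L (w.1 t p) ∉ I) fun y _ => hw.card_join hσ.rest _ t, hσ.card,
        Function.update_self]
      congr 2
      refine Finset.sum_congr rfl fun i hi => ?_
      rw [Function.update_of_ne]
      rintro rfl
      exact hI (Finset.mem_filter.1 hi).1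

theorem admCard_insert_eq_zero [Finite X] [Fintype ι] [Fintype κ] [DecidableEq ι] [DecidableEq κ]
    {i₀ : ι} (hσ : Lab σ μ L) (hG : Generic μ ν)
    (hμ : 0 < μ i₀) (hk : ∃ k ∉ insert i₀ I, 0 < μ k) (hj : ∃ j ∉ J, 0 < ν j)
    (hJ : b = 0 ∨ α i₀ ∈ J) :
    admCard b σ L ν (insert i₀ I) α J = 0 := by
  rw [admCard, Nat.card_eq_zero]
  refine Or.inl ⟨fun w => ?_⟩
  cases b with
  | zero =>
    obtain ⟨t, -⟩ := w.2.exists_touches hσ hG hμ hk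
    exact t.elim0
  | succ b => exact (w.2.exists_insertLeaf hσ hG hμ hk hj).1 (hJ.resolve_left (by simp))

end

end Fermion

namespace Fermion

variable {X Y : Type} {ι κ : Type} {b : ℕ}

theorem finRotate_val {n : ℕ} (k : Fin n) : (finRotate n k : ℕ) = (k + 1) % n := by
  cases n with
  | zero => exact k.elim0
  | succ n =>
    rw [finRotate_apply, Fin.val_add, Fin.val_one', Nat.add_mod_mod]

/-- The standard permutation with one cycle of length `μ i` for every `i`. -/
def standardPerm (μ : ι → ℕ) : Equiv.Perm (Σ i, Fin (μ i)) :=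
  Equiv.sigmaCongrRight fun i => finRotate (μ i)

theorem standardPerm_mk (μ : ι → ℕ) (i : ι) (k : Fin (μ i)) :
    standardPerm μ ⟨i, k⟩ = ⟨i, finRotate _ k⟩ := rfl

theorem eq_zero_of_standardPerm_invariant {μ : ι → ℕ} {α : Type*} {f : (Σ i, Fin (μ i)) → α}
    (hf : ∀ z, f (standardPerm μ z) = f z) (i : ι) (k : ℕ) (hk : k < μ i) :
    f ⟨i, k, hk⟩ = f ⟨i, 0, by omega⟩ := by
  induction k with
  | zero => rfl
  | succ k ih =>
    rw [← ih (by omega), ← hf ⟨i, k, by omega⟩, standardPerm_mk]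
    congr 2
    refine Fin.ext ?_
    rw [finRotate_val]
    exact (Nat.mod_eq_of_lt hk).symm

theorem lab_standardPerm (μ : ι → ℕ) : Lab (standardPerm μ) μ Sigma.fst where
  inv _ := rfl
  card i := by
    let e : {x : Σ i, Fin (μ i) // x.1 = i} ≃ Fin (μ i) :=
      { toFun := fun x => x.2 ▸ x.1.2
        invFun := fun k => ⟨⟨i, k⟩, rfl⟩
        left_inv := by
          rintro ⟨⟨j, k⟩, rfl⟩
          rfl
        right_inv := fun k => rfl }
    rw [Nat.card_congr e, Nat.card_fin]
  same := by
    rintro ⟨i, k, hk⟩ ⟨j, l, hl⟩ h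
    obtain rfl : i = j := h
    exact sameCycle_of_invariant fun f hf => by
      rw [eq_zero_of_standardPerm_invariant hf i k hk, eq_zero_of_standardPerm_invariant hf i l hl]

theorem Lab.map [Finite X] {σ : Equiv.Perm X} {μ : ι → ℕ} {L : X → ι} (h : Lab σ μ L)
    (e : X ≃ Y) : Lab (e.permCongr σ) μ (fun y => L (e.symm y)) where
  inv x := by
    simp only [Equiv.permCongr_apply, Equiv.symm_apply_apply]
    exact h.inv _
  card i := by
    rw [← h.card i]
    exact Nat.card_congr (e.symm.subtypeEquiv fun x => Iff.rfl)
  same x y hxy := by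
    refine sameCycle_of_invariant fun f hf => ?_
    have := h.eq_of_invariant (f := fun z => f (e z)) (fun z => ?_) hxy
    · simpa using this
    · have := hf (e z)
      rwa [Equiv.permCongr_apply, Equiv.symm_apply_apply] at this

theorem Lab.minimalPeriod_eq [Finite X] {σ : Equiv.Perm X} {μ : ι → ℕ} {L : X → ι}
    (h : Lab σ μ L) (x : X) : Function.minimalPeriod σ x = μ (L x) := by
  classical
  have := Fintype.ofFinite X
  have h1 : Function.minimalPeriod σ x = Function.minimalPeriod (σ • ·) x := rfl
  rw [h1, MulAction.minimalPeriod_eq_card, ← h.card, ← Nat.card_eq_fintype_card]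
  refine Nat.card_congr (Equiv.subtypeEquivRight fun y => ?_)
  rw [MulAction.mem_orbit_iff]
  constructor
  · rintro ⟨⟨_, k, rfl⟩, rfl⟩
    have hL : Equiv.Perm.SameCycle σ x ((σ ^ k) x) := ⟨k, rfl⟩
    exact (apply_eq_of_sameCycle h.inv hL).symm
  · intro hy
    obtain ⟨k, hk⟩ := h.same x y hy.symm
    exact ⟨⟨σ ^ k, k, rfl⟩, hk⟩

/-- The coordinates on a labelled permutation given by base points of its cycles. -/
theorem Lab.exists_equiv [Finite X] [Fintype ι] {σ : Equiv.Perm X} {μ : ι → ℕ} {L : X → ι}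
    (h : Lab σ μ L) (p : ∀ i : {i // 0 < μ i}, {x // L x = i}) :
    ∃ e : (Σ i, Fin (μ i)) ≃ X, (∀ z, e (standardPerm μ z) = σ (e z)) ∧ (∀ z, L (e z) = z.1) ∧
      ∀ i : {i // 0 < μ i}, e ⟨i, 0, i.2⟩ = p i := by
  have := Fintype.ofFinite X
  let f : (Σ i, Fin (μ i)) → X := fun z => σ^[z.2] (p ⟨z.1, z.2.pos⟩)
  have hLf : ∀ z, L (f z) = z.1 := by
    intro z
    have : ∀ k x, L (σ^[k] x) = L x := by
      intro k x
      induction k with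
      | zero => rfl
      | succ k ih => rw [Function.iterate_succ_apply', h.inv, ih]
    rw [this]
    exact (p ⟨z.1, z.2.pos⟩).2
  have hper : ∀ i : {i // 0 < μ i}, Function.minimalPeriod σ (p i) = μ i := fun i => by
    rw [h.minimalPeriod_eq, (p i).2]
  have hf : Function.Injective f := by
    rintro ⟨i, k⟩ ⟨j, l⟩ hz
    obtain rfl : i = j := by
      have := congrArg L hz
      rwa [hLf, hLf] at this
    congr 1
    refine Fin.ext ?_
    refine Function.iterate_injOn_Iio_minimalPeriod (f := σ) (x := p ⟨i, k.pos⟩) ?_ ?_ hz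
    · rw [hper]; exact k.2
    · rw [hper]; exact l.2
  have hbij : Function.Bijective f := by
    rw [Fintype.bijective_iff_injective_and_card]
    refine ⟨hf, ?_⟩
    rw [Fintype.card_sigma, ← h.sum_eq]
    simp
  refine ⟨Equiv.ofBijective f hbij, ?_, hLf, fun i => rfl⟩
  rintro ⟨i, k⟩
  have h1 := Function.iterate_mod_minimalPeriod_eq (f := σ) (x := p ⟨i, k.pos⟩) (n := k + 1)
  rw [hper ⟨i, k.pos⟩, Function.iterate_succ_apply'] at h1
  refine Eq.trans ?_ h1
  change σ^[(finRotate _ k : ℕ)] (p ⟨i, _⟩) = _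
  rw [finRotate_val]

theorem equiv_ext {σ : Equiv.Perm X} {μ : ι → ℕ} {e e' : (Σ i, Fin (μ i)) ≃ X}
    (he : ∀ z, e (standardPerm μ z) = σ (e z)) (he' : ∀ z, e' (standardPerm μ z) = σ (e' z))
    (h : ∀ i : {i // 0 < μ i}, e ⟨i, 0, i.2⟩ = e' ⟨i, 0, i.2⟩) : e = e' := by
  ext ⟨i, k, hk⟩
  induction k with
  | zero => exact h ⟨i, hk⟩
  | succ k ih =>
    have h1 : (⟨i, k + 1, hk⟩ : Σ i, Fin (μ i)) = standardPerm μ ⟨i, k, by omega⟩ := by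
      rw [standardPerm_mk]
      congr 1
      refine Fin.ext ?_
      rw [finRotate_val]
      exact (Nat.mod_eq_of_lt hk).symm
    rw [h1, he, he', ih]

/-- The product of the nonzero parts. -/
def partProd [Fintype ι] (μ : ι → ℕ) : ℕ := ∏ i, if 0 < μ i then μ i else 1

theorem card_lab_mul_partProd [Fintype X] [Fintype ι] {μ : ι → ℕ}
    (hs : ∑ i, μ i = Fintype.card X) :
    Nat.card {w : Equiv.Perm X × (X → ι) // Lab w.1 μ w.2} * partProd μ =
      (Fintype.card X).factorial := by
  classical
  have h0 : Nat.card ((Σ i, Fin (μ i)) ≃ X) = (Fintype.card X).factorial := by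
    have e0 : (Σ i, Fin (μ i)) ≃ X := Fintype.equivOfCardEq (by simp [hs])
    rw [Nat.card_eq_fintype_card, Fintype.card_equiv e0, Fintype.card_congr e0]
  rw [← h0, ← card_subtype_prod (fun w : Equiv.Perm X × (X → ι) => Lab w.1 μ w.2)
    (fun w (e : (Σ i, Fin (μ i)) ≃ X) => (∀ z, e (standardPerm μ z) = w.1 (e z)) ∧
      ∀ z, w.2 (e z) = z.1) (c := partProd μ)]
  · refine Nat.card_eq_of_bijective (fun u => u.1.2) ⟨?_, ?_⟩
    · rintro ⟨⟨⟨σ, L⟩, e⟩, h1, h2, h3⟩ ⟨⟨⟨σ', L'⟩, e'⟩, h1', h2', h3'⟩ heq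
      obtain rfl : e = e' := heq
      have hσ : σ = σ' := by
        ext x
        obtain ⟨z, rfl⟩ := e.surjective x
        exact (h2 z).symm.trans (h2' z)
      have hL : L = L' := by
        ext x
        obtain ⟨z, rfl⟩ := e.surjective x
        exact (h3 z).trans (h3' z).symm
      subst hσ hL
      rfl
    · intro e
      refine ⟨⟨((e.permCongr (standardPerm μ), fun x => (e.symm x).1), e), ?_, ?_, ?_⟩, rfl⟩
      · exact (lab_standardPerm μ).map e
      · intro z
        simp [Equiv.permCongr_apply]
      · intro z
        simp
  · intro w hw
    have h1 : Nat.card (∀ i : {i // 0 < μ i}, {x // w.2 x = i}) = partProd μ := by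
      rw [Nat.card_pi, partProd, ← Finset.prod_filter,
        Finset.prod_congr rfl fun (i : {i // 0 < μ i}) _ => hw.card i.1]
      exact (Finset.prod_subtype _ (by simp) μ).symm
    rw [← h1]
    refine Nat.card_eq_of_bijective (fun e i => ⟨e.1 ⟨i, 0, i.2⟩, e.2.2 _⟩) ⟨?_, ?_⟩
    · intro e e' he
      refine Subtype.ext (equiv_ext e.2.1 e'.2.1 fun i => ?_)
      exact congrArg Subtype.val (congrFun he i)
    · intro p
      obtain ⟨e, h1, h2, h3⟩ := hw.exists_equiv p
      exact ⟨⟨e, h1, h2⟩, funext fun i => Subtype.ext (h3 i)⟩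

theorem permCongr_inv (e : X ≃ Y) (σ : Equiv.Perm X) : (e.permCongr σ)⁻¹ = e.permCongr σ⁻¹ := rfl

theorem permCongr_mul (e : X ≃ Y) (σ τ : Equiv.Perm X) :
    e.permCongr σ * e.permCongr τ = e.permCongr (σ * τ) := by
  ext y
  simp [Equiv.permCongr_apply]

theorem isSwap_permCongr [DecidableEq X] [DecidableEq Y] (e : X ≃ Y) {τ : Equiv.Perm X}
    (h : τ.IsSwap) : (e.permCongr τ).IsSwap := by
  obtain ⟨x, y, hxy, rfl⟩ := h
  exact ⟨e x, e y, e.injective.ne hxy, Equiv.permCongr_def e _ ▸ Equiv.symm_trans_swap_trans x y e⟩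

theorem isPath_map [DecidableEq X] [DecidableEq Y] (e : X ≃ Y) {η : Fin (b + 1) → Equiv.Perm X}
    (h : IsPath η) : IsPath fun s => e.permCongr (η s) := by
  intro s
  rw [permCongr_inv, permCongr_mul]
  exact isSwap_permCongr e (h s)

theorem Touches.of_map (e : X ≃ Y) {η : Fin (b + 1) → Equiv.Perm X} {L : X → κ} {s : Fin b} {j : κ}
    (h : Touches (fun s => e.permCongr (η s)) (fun y => L (e.symm y)) s j) : Touches η L s j := by
  obtain ⟨v, hv, hne⟩ := h
  refine ⟨e.symm v, hv, fun heq => hne ?_⟩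
  simp only [Equiv.permCongr_apply]
  rw [heq]

theorem Leaf.map (e : X ≃ Y) {η : Fin (b + 1) → Equiv.Perm X} {L : X → κ} {j : κ}
    (h : Leaf η L j) : Leaf (fun s => e.permCongr (η s)) (fun y => L (e.symm y)) j :=
  fun s s' hs hs' => h s s' (hs.of_map e) (hs'.of_map e)

section

variable {I : Finset ι} {α : ι → κ} {J : Finset κ} {ν : κ → ℕ}

theorem Adm.map [Finite X] [DecidableEq X] [DecidableEq Y] (e : X ≃ Y) {σ : Equiv.Perm X}
    {L : X → ι} {η : Fin (b + 1) → Equiv.Perm X} {M : X → κ} (h : Adm σ L ν I α J η M) :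
    Adm (e.permCongr σ) (fun y => L (e.symm y)) ν I α J (fun s => e.permCongr (η s))
      (fun y => M (e.symm y)) where
  start := by rw [h.start]
  step := isPath_map e h.step
  lab := h.lab.map e
  leaf i hi := (h.leaf i hi).map e
  dual j hj := (h.dual j hj).map e
  label x hx := h.label _ hx

theorem admCard_map_le [Finite X] [Finite κ] [DecidableEq X] [DecidableEq Y] (e : X ≃ Y)
    (σ : Equiv.Perm X) (L : X → ι) :
    admCard b σ L ν I α J ≤ admCard b (e.permCongr σ) (fun y => L (e.symm y)) ν I α J := by
  have := Finite.of_equiv X e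
  refine Nat.card_le_card_of_injective (fun w => ⟨(_, _), w.2.map e⟩) ?_
  rintro ⟨⟨η, M⟩, h⟩ ⟨⟨η', M'⟩, h'⟩ heq
  have h1 : η = η' := by
    funext s
    exact e.permCongr.injective (congrFun (congrArg (fun w => w.1.1) heq) s)
  have h2 : M = M' := by
    funext x
    have := congrFun (congrArg (fun w => w.1.2) heq) (e x)
    simpa using this
  subst h1 h2
  rfl

theorem admCard_map [Finite X] [Finite κ] [DecidableEq X] [DecidableEq Y] (e : X ≃ Y)
    (σ : Equiv.Perm X) (L : X → ι) :
    admCard b (e.permCongr σ) (fun y => L (e.symm y)) ν I α J = admCard b σ L ν I α J := by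
  have := Finite.of_equiv X e
  refine le_antisymm ?_ (admCard_map_le e σ L)
  have h := admCard_map_le (b := b) (ν := ν) (I := I) (α := α) (J := J) e.symm (e.permCongr σ)
    (fun y => L (e.symm y))
  have h1 : e.symm.permCongr (e.permCongr σ) = σ := by
    ext x
    simp
  have h2 : (fun y => L (e.symm (e.symm.symm y))) = L := by
    funext x
    simp
  rwa [h1, h2] at h

/-- The number of admissible sequences starting at the standard labelled permutation. -/
noncomputable def modelCard [DecidableEq ι] (b : ℕ) (μ : ι → ℕ) (ν : κ → ℕ) (I : Finset ι)
    (α : ι → κ) (J : Finset κ) : ℕ :=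
  admCard b (standardPerm μ) Sigma.fst ν I α J

theorem admCard_eq_modelCard [Finite X] [Fintype ι] [Finite κ] [DecidableEq X] [DecidableEq ι]
    {σ : Equiv.Perm X} {L : X → ι} {μ : ι → ℕ} (h : Lab σ μ L) :
    admCard b σ L ν I α J = modelCard b μ ν I α J := by
  have hne : ∀ i : {i // 0 < μ i}, Nonempty {x // L x = i} := fun i => by
    obtain ⟨x, hx⟩ := h.exists_eq i.2
    exact ⟨⟨x, hx⟩⟩
  obtain ⟨e, h1, h2, -⟩ := h.exists_equiv fun i => (hne i).some
  rw [modelCard, ← admCard_map e]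
  congr 1
  · ext x
    obtain ⟨z, rfl⟩ := e.surjective x
    rw [Equiv.permCongr_apply, Equiv.symm_apply_apply, h1]
  · funext x
    rw [← h2, Equiv.apply_symm_apply]

end

end Fermion

namespace Fermion

variable {ι κ : Type} {b : ℕ}

theorem modelCard_empty [DecidableEq ι] (μ : ι → ℕ) (ν : κ → ℕ) (α α' : ι → κ) (J : Finset κ) :
    modelCard b μ ν ∅ α J = modelCard b μ ν ∅ α' J := by
  refine Nat.card_congr (Equiv.subtypeEquivRight fun w => ?_)
  constructor
  · exact fun h => ⟨h.start, h.step, h.lab, by simp, h.dual, by simp⟩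
  · exact fun h => ⟨h.start, h.step, h.lab, by simp, h.dual, by simp⟩

section

variable [DecidableEq κ]

/-- The parts of `ν` reduced by the parts of `μ` attached to them by `α`. -/
def red (ν : κ → ℕ) (μ : ι → ℕ) (I : Finset ι) (α : ι → κ) (j : κ) : ℕ :=
  ν j - ∑ i ∈ I with α i = j, μ i

theorem sum_red {ν : κ → ℕ} {μ : ι → ℕ} {I : Finset ι} {α : ι → κ}
    (h : ∀ j, ∑ i ∈ I with α i = j, μ i ≤ ν j) (J₀ : Finset κ) :
    ∑ j ∈ J₀, red ν μ I α j + ∑ i ∈ I with α i ∈ J₀, μ i = ∑ j ∈ J₀, ν j := by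
  have h1 : ∑ i ∈ I with α i ∈ J₀, μ i = ∑ j ∈ J₀, ∑ i ∈ I with α i = j, μ i := by
    rw [← Finset.sum_fiberwise_of_maps_to (s := I.filter fun i => α i ∈ J₀) (t := J₀) (g := α)
      fun i hi => (Finset.mem_filter.1 hi).2]
    refine Finset.sum_congr rfl fun j hj => ?_
    rw [Finset.filter_filter]
    refine Finset.sum_congr ?_ fun _ _ => rfl
    ext i
    simp only [Finset.mem_filter]
    constructor
    · rintro ⟨h1, -, h2⟩
      exact ⟨h1, h2⟩
    · rintro ⟨h1, rfl⟩
      exact ⟨h1, hj, rfl⟩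
  rw [h1, ← Finset.sum_add_distrib]
  refine Finset.sum_congr rfl fun j _ => ?_
  have := h j
  rw [red]
  omega

variable [DecidableEq ι]

/-- The parts of `μ` with index outside `I`, the other ones being replaced by zero. -/
def off (μ : ι → ℕ) (I : Finset ι) (i : ι) : ℕ := if i ∈ I then 0 else μ i

/-- The indices contributing to the partial sums with indices `I₀` and `J₀` after attaching
the parts with index in `I`. -/
def lift (I : Finset ι) (α : ι → κ) (I₀ : Finset ι) (J₀ : Finset κ) : Finset ι :=
  I₀ \ I ∪ I.filter fun i => α i ∈ J₀

theorem sum_off (μ : ι → ℕ) (I I₀ : Finset ι) : ∑ i ∈ I₀, off μ I i = ∑ i ∈ I₀ \ I, μ i := by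
  simp only [off]
  rw [Finset.sum_ite, Finset.sum_const_zero, zero_add, Finset.sdiff_eq_filter]

theorem sum_lift (μ : ι → ℕ) (I : Finset ι) (α : ι → κ) (I₀ : Finset ι) (J₀ : Finset κ) :
    ∑ i ∈ lift I α I₀ J₀, μ i = ∑ i ∈ I₀, off μ I i + ∑ i ∈ I with α i ∈ J₀, μ i := by
  rw [lift, sum_off, Finset.sum_union]
  rw [Finset.disjoint_left]
  intro i hi hi'
  exact (Finset.mem_sdiff.1 hi).2 (Finset.mem_filter.1 hi').1

theorem sum_lift_sub {ν : κ → ℕ} {μ : ι → ℕ} {I : Finset ι} {α : ι → κ}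
    (h : ∀ j, ∑ i ∈ I with α i = j, μ i ≤ ν j) (I₀ : Finset ι) (J₀ : Finset κ) :
    (∑ i ∈ I₀, (off μ I i : ℤ)) - ∑ j ∈ J₀, (red ν μ I α j : ℤ) =
      ∑ i ∈ lift I α I₀ J₀, (μ i : ℤ) - ∑ j ∈ J₀, (ν j : ℤ) := by
  have h1 := sum_lift μ I α I₀ J₀
  have h2 := sum_red h J₀
  zify at h1 h2
  linarith

theorem lift_univ [Fintype ι] [Fintype κ] (I : Finset ι) (α : ι → κ) :
    lift I α Finset.univ Finset.univ = Finset.univ := by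
  ext i
  simp only [lift, Finset.mem_union, Finset.mem_sdiff, Finset.mem_filter, Finset.mem_univ]
  tauto

theorem sum_off_eq_sum_red [Fintype ι] [Fintype κ] {ν : κ → ℕ} {μ : ι → ℕ} {I : Finset ι}
    {α : ι → κ} (h : ∀ j, ∑ i ∈ I with α i = j, μ i ≤ ν j) (hs : ∑ i, μ i = ∑ j, ν j) :
    ∑ i, off μ I i = ∑ j, red ν μ I α j := by
  have h1 := sum_lift_sub h Finset.univ Finset.univ
  rw [lift_univ] at h1
  zify at hs ⊢
  linarith

theorem Generic.off_red [Fintype ι] [Fintype κ] {ν : κ → ℕ} {μ : ι → ℕ} {I : Finset ι}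
    {α : ι → κ} (hG : Generic μ ν) (h : ∀ j, ∑ i ∈ I with α i = j, μ i ≤ ν j) :
    Generic (off μ I) (red ν μ I α) := by
  intro I₀ J₀ h0
  have h1 : ∑ i ∈ lift I α I₀ J₀, μ i = ∑ j ∈ J₀, ν j := by
    have := sum_lift_sub h I₀ J₀
    zify at h0 ⊢
    linarith
  rcases hG _ _ h1 with h2 | h2
  · left
    have := sum_lift μ I α I₀ J₀
    omega
  · right
    refine Finset.sum_subset (Finset.subset_univ _) fun i _ hi => ?_
    have h3 : ∑ i ∈ (lift I α I₀ J₀)ᶜ, μ i = 0 := by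
      have := Finset.sum_add_sum_compl (lift I α I₀ J₀) μ
      omega
    rw [off]
    split_ifs with hiI
    · rfl
    · refine Finset.sum_eq_zero_iff.1 h3 i ?_
      rw [Finset.mem_compl, lift, Finset.mem_union, Finset.mem_sdiff, Finset.mem_filter]
      tauto

theorem modelCard_eq [Fintype ι] [Fintype κ] (I : Finset ι) (α : ι → κ) (J : Finset κ) :
    ∀ (b : ℕ) (μ : ι → ℕ) (ν : κ → ℕ), Generic μ ν → ∑ i, μ i = ∑ j, ν j → (∀ i ∈ I, 0 < μ i) →
    (∃ k ∉ I, 0 < μ k) → (∃ j ∉ J, 0 < ν j) →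
    modelCard b μ ν I α J = if ∃ i ∈ I, α i ∈ J then 0 else
      b.descFactorial I.card * ((∏ i ∈ I, μ i) * ∏ i ∈ I, red ν μ I α (α i)) *
        modelCard (b - I.card) (off μ I) (red ν μ I α) ∅ α J := by
  induction I using Finset.induction_on with
  | empty =>
    intro b μ ν hG hs hμ hk hj
    have h1 : off μ ∅ = μ := by
      ext i
      simp [off]
    have h2 : red ν μ ∅ α = ν := by
      ext j
      simp [red]
    simp [h1, h2]
  | insert i₀ I hI ih =>
    intro b μ ν hG hs hμ hk hj
    by_cases h0 : b = 0 ∨ α i₀ ∈ J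
    · rw [modelCard, admCard_insert_eq_zero (lab_standardPerm μ) hG (hμ _ (by simp)) hk hj h0]
      rcases h0 with rfl | h0
      · simp [Finset.card_insert_of_notMem hI]
      · rw [if_pos ⟨i₀, by simp, h0⟩]
    rw [not_or] at h0
    obtain ⟨b, rfl⟩ := Nat.exists_eq_succ_of_ne_zero h0.1
    rw [modelCard, Nat.succ_eq_add_one,
      admCard_insert (lab_standardPerm μ) hG hI (hμ _ (by simp)) hk hj h0.2,
      admCard_eq_modelCard (lab_standardPerm μ).rest]
    have hsum : ∑ i ∈ insert i₀ I with α i = α i₀, μ i = μ i₀ + ∑ i ∈ I with α i = α i₀, μ i := by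
      rw [Finset.filter_insert, if_pos rfl, Finset.sum_insert (by simp [hI])]
    have hr : red ν μ (insert i₀ I) α (α i₀) = ν (α i₀) - μ i₀ - ∑ i ∈ I with α i = α i₀, μ i := by
      rw [red, hsum, Nat.sub_add_eq]
    rw [← hr]
    rw [Finset.prod_insert hI (f := fun i => red ν μ (insert i₀ I) α (α i))]
    rcases Nat.eq_zero_or_pos (red ν μ (insert i₀ I) α (α i₀)) with h00 | hpos
    · simp [h00]
    set μ' := Function.update μ i₀ 0 with hμ'
    set ν' := Function.update ν (α i₀) (ν (α i₀) - μ i₀) with hν'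
    have e1 : off μ {i₀} = μ' := by
      ext i
      simp only [off, hμ', Function.update_apply, Finset.mem_singleton]
    have e2 : red ν μ {i₀} α = ν' := by
      ext j
      rw [red, hν', Function.update_apply, Finset.filter_singleton]
      split_ifs with h1 h2 h2
      · subst h1; simp
      · exact absurd h1.symm h2
      · exact absurd h2.symm h1
      · simp
    have htr : ∀ j, ∑ i ∈ {i₀} with α i = j, μ i ≤ ν j := by
      intro j
      rw [Finset.filter_singleton]
      split_ifs with h1
      · subst h1
        rw [Finset.sum_singleton]
        omega
      · simp
    have hsumI : ∀ s ⊆ I, ∑ i ∈ s, μ' i = ∑ i ∈ s, μ i := fun s hs =>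
      Finset.sum_congr rfl fun i hi => by
        rw [hμ', Function.update_of_ne]
        rintro rfl
        exact hI (hs hi)
    have e3 : red ν' μ' I α = red ν μ (insert i₀ I) α := by
      ext j
      rw [red, red, hsumI _ (Finset.filter_subset _ _), hν', Function.update_apply,
        Finset.filter_insert]
      split_ifs with h1 h2 h2
      · subst h1
        rw [Finset.sum_insert (by simp [hI])]
        omega
      · exact absurd h1.symm h2
      · exact absurd h2.symm h1
      · rfl
    have e4 : off μ' I = off μ (insert i₀ I) := by
      ext i
      rw [off, off, hμ', Function.update_apply]
      simp only [Finset.mem_insert]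
      split_ifs <;> simp_all
    have e5 : ∏ i ∈ I, μ' i = ∏ i ∈ I, μ i :=
      Finset.prod_congr rfl fun i hi => by
        rw [hμ', Function.update_of_ne]
        rintro rfl
        exact hI hi
    rw [ih b μ' ν' (e1 ▸ e2 ▸ hG.off_red htr) (e1 ▸ e2 ▸ sum_off_eq_sum_red htr hs) ?_ ?_ ?_,
      e3, e4, e5]
    · have hc : (∃ i ∈ insert i₀ I, α i ∈ J) ↔ ∃ i ∈ I, α i ∈ J := by
        simp [h0.2]
      rw [if_congr hc rfl rfl, Finset.card_insert_of_notMem hI, Nat.succ_descFactorial_succ,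
        Finset.prod_insert hI, Nat.add_sub_add_right]
      split_ifs
      · simp
      · ring
    · intro i hi
      rw [hμ', Function.update_of_ne]
      · exact hμ i (Finset.mem_insert_of_mem hi)
      · rintro rfl
        exact hI hi
    · obtain ⟨k, hk, hk'⟩ := hk
      rw [Finset.mem_insert, not_or] at hk
      exact ⟨k, hk.2, by rwa [hμ', Function.update_of_ne hk.1]⟩
    · exact ⟨α i₀, h0.2, by rw [hν', Function.update_self]; omega⟩

end

end Fermion

namespace Fermion

variable {X : Type} {ι κ : Type} {b : ℕ}

theorem Lab.inv_perm [Finite X] {σ : Equiv.Perm X} {μ : ι → ℕ} {L : X → ι} (h : Lab σ μ L) :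
    Lab σ⁻¹ μ L where
  inv := h.inv_apply
  card := h.card
  same x y hxy := (h.same x y hxy).inv

/-- The labels of a leaf are attached to a single cycle of the last permutation. -/
theorem Leaf.label_eq [Finite X] [DecidableEq X] [Fintype ι] [Fintype κ] {μ : ι → ℕ} {ν : κ → ℕ}
    (hG : Generic μ ν) {η : Fin (b + 1) → Equiv.Perm X} {L : X → ι} {M : X → κ}
    (hL : Lab (η 0) μ L) (hM : Lab (η (Fin.last b)) ν M) (hη : IsPath η) {i : ι}
    (hk : ∃ k ≠ i, 0 < μ k) (h : Leaf (fun s => (η s)⁻¹) L i) {x y : X} (hx : L x = i)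
    (hy : L y = i) : M x = M y := by
  classical
  have key : ∃ u, ∀ v, L v = i → v ≠ u → (η (Fin.last b))⁻¹ v = (η 0)⁻¹ v := by
    by_cases hcon : ∃ s, Touches (fun s => (η s)⁻¹) L s i
    · obtain ⟨t, ht⟩ := hcon
      obtain ⟨u, w, -, huw⟩ := hη t
      have hsw : ∀ v, (η t.succ)⁻¹ v = (η t.castSucc)⁻¹ (Equiv.swap u w v) := by
        intro v
        have h1 : η t.succ = Equiv.swap u w * η t.castSucc := by
          rw [← huw, inv_mul_cancel_right]
        rw [h1, mul_inv_rev, Equiv.swap_inv]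
        rfl
      have hlast : ∀ v, L v = i → (η (Fin.last b))⁻¹ v = (η 0)⁻¹ (Equiv.swap u w v) ∨
          ¬ L (Equiv.swap u w v) = i := by
        intro v hv
        by_cases hsv : L (Equiv.swap u w v) = i
        · left
          have h1 := h.eq_last ht hv (s := t.succ) Fin.castSucc_lt_succ
          have h2 := h.eq_zero ht hsv (s := t.castSucc) le_rfl
          exact h1.symm.trans ((hsw v).trans h2)
        · exact Or.inr hsv
      have hfix : ∀ v, L v = i → v ≠ u → v ≠ w → (η (Fin.last b))⁻¹ v = (η 0)⁻¹ v := by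
        intro v hv hvu hvw
        have h1 := hlast v hv
        rw [Equiv.swap_apply_of_ne_of_ne hvu hvw] at h1
        exact h1.resolve_right (not_not.2 hv)
      by_cases hu : L u = i
      · by_cases hw : L w = i
        · exfalso
          have hinv : ∀ v, L v ∈ ({i} : Finset ι) → L ((η (Fin.last b))⁻¹ v) ∈ ({i} : Finset ι) := by
            intro v hv
            rw [Finset.mem_singleton] at hv ⊢
            have hsv : L (Equiv.swap u w v) = i := by
              rw [Equiv.swap_apply_def]
              split_ifs <;> assumption
            rw [(hlast v hv).resolve_right (not_not.2 hsv), hL.inv_apply, hsv]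
          rcases hG.trivial_of_inv_invariant hL hM hinv with h1 | h1
          · exact h1 u (by simp [hu])
          · obtain ⟨k, hki, hk0⟩ := hk
            obtain ⟨z, rfl⟩ := hL.exists_eq hk0
            exact hki (by simpa using h1 z)
        · exact ⟨u, fun v hv hvu => hfix v hv hvu fun h => hw (h ▸ hv)⟩
      · exact ⟨w, fun v hv hvw => hfix v hv (fun h => hu (h ▸ hv)) hvw⟩
    · rw [not_exists] at hcon
      exact ⟨x, fun v hv _ => eq_zero_of_not_touches hcon hv _⟩
  obtain ⟨u, hu⟩ := key
  have hMv : ∀ v, L v = i → v ≠ u → M ((η 0)⁻¹ v) = M v := by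
    intro v hv hvu
    rw [← hu v hv hvu, hM.inv_apply]
  have hMu : ∀ v, L v = i → M ((η 0)⁻¹ v) = M v := by
    intro v hv
    by_cases hvu : v = u
    · subst hvu
      have h1 := apply_eq_of_forall_ne (σ := (η 0)⁻¹) (P := fun x => L x = i) (y := v)
        (f := fun x => if M x = M v then 1 else 0) (fun x => by rw [hL.inv_apply]) hv
        (fun x hx hxv => by rw [hMv x hx hxv])
      by_contra hne
      rw [if_pos rfl, if_neg hne] at h1
      exact zero_ne_one h1
    · exact hMv v hv hvu
  have h1 := hL.inv_perm.eq_of_invariant (f := fun v => if L v = i then some (M v) else none)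
    (fun v => by
      rw [hL.inv_apply]
      split_ifs with hv
      · rw [hMu v hv]
      · rfl) (hx.trans hy.symm)
  simpa [hx, hy] using h1

/-- Sequences between two labelled permutations such that the cycles of the first one with label
in `I` and the cycles of the last one with label in `J` are leaves. -/
structure LabPath [DecidableEq X] (μ : ι → ℕ) (ν : κ → ℕ) (I : Finset ι) (J : Finset κ)
    (η : Fin (b + 1) → Equiv.Perm X) (L : X → ι) (M : X → κ) : Prop where
  src : Lab (η 0) μ L
  tgt : Lab (η (Fin.last b)) ν M
  step : IsPath η
  leaf : ∀ i ∈ I, Leaf (fun s => (η s)⁻¹) L i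
  dual : ∀ j ∈ J, Leaf η M j

/-- The number of sequences between labelled permutations with prescribed leaves. -/
noncomputable def labPathCard (X : Type) [DecidableEq X] (b : ℕ) (μ : ι → ℕ) (ν : κ → ℕ)
    (I : Finset ι) (J : Finset κ) : ℕ :=
  Nat.card {w : (Fin (b + 1) → Equiv.Perm X) × (X → ι) × (X → κ) //
    LabPath μ ν I J w.1 w.2.1 w.2.2}

theorem touches_rev {η : Fin (b + 1) → Equiv.Perm X} {L : X → κ} {s : Fin b} {j : κ}
    (h : Touches (fun s => η s.rev) L s j) : Touches η L s.rev j := by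
  obtain ⟨v, hv, hne⟩ := h
  refine ⟨v, hv, fun heq => hne ?_⟩
  dsimp only
  rw [Fin.rev_castSucc, Fin.rev_succ]
  exact heq.symm

theorem Leaf.rev {η : Fin (b + 1) → Equiv.Perm X} {L : X → κ} {j : κ}
    (h : Leaf η L j) : Leaf (fun s => η s.rev) L j :=
  fun _ _ hs hs' => Fin.rev_injective (h _ _ (touches_rev hs) (touches_rev hs'))

theorem IsPath.rev_inv [DecidableEq X] {η : Fin (b + 1) → Equiv.Perm X} (h : IsPath η) :
    IsPath fun s => (η s.rev)⁻¹ := by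
  intro s
  dsimp only
  rw [Fin.rev_castSucc, Fin.rev_succ, inv_inv]
  obtain ⟨u, w, huw, heq⟩ := h s.rev
  refine ⟨(η s.rev.castSucc)⁻¹ u, (η s.rev.castSucc)⁻¹ w, fun hh => huw (Equiv.injective _ hh), ?_⟩
  rw [Equiv.swap_apply_apply, ← heq]
  group

theorem LabPath.dualize [Finite X] [DecidableEq X] {μ : ι → ℕ} {ν : κ → ℕ} {I : Finset ι}
    {J : Finset κ} {η : Fin (b + 1) → Equiv.Perm X} {L : X → ι} {M : X → κ}
    (h : LabPath μ ν I J η L M) : LabPath ν μ J I (fun s => (η s.rev)⁻¹) M L where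
  src := by
    rw [Fin.rev_zero]
    exact h.tgt.inv_perm
  tgt := by
    rw [Fin.rev_last]
    exact h.src.inv_perm
  step := h.step.rev_inv
  leaf j hj := by
    simp only [inv_inv]
    exact (h.dual j hj).rev
  dual i hi := (h.leaf i hi).rev

theorem labPathCard_le [Finite X] [DecidableEq X] [Finite ι] [Finite κ] (μ : ι → ℕ) (ν : κ → ℕ)
    (I : Finset ι) (J : Finset κ) : labPathCard X b μ ν I J ≤ labPathCard X b ν μ J I := by
  refine Nat.card_le_card_of_injective (fun w => ⟨(_, _, _), w.2.dualize⟩) ?_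
  rintro ⟨⟨η, L, M⟩, h⟩ ⟨⟨η', L', M'⟩, h'⟩ heq
  have h1 : η = η' := by
    funext s
    have := congrFun (congrArg (fun w => w.1.1) heq) s.rev
    simpa using this
  have h2 : L = L' := congrArg (fun w => w.1.2.2) heq
  have h3 : M = M' := congrArg (fun w => w.1.2.1) heq
  subst h1 h2 h3
  rfl

theorem labPathCard_comm [Finite X] [DecidableEq X] [Finite ι] [Finite κ] (μ : ι → ℕ) (ν : κ → ℕ)
    (I : Finset ι) (J : Finset κ) : labPathCard X b μ ν I J = labPathCard X b ν μ J I :=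
  le_antisymm (labPathCard_le μ ν I J) (labPathCard_le ν μ J I)

theorem labPathCard_eq_sum [Fintype X] [DecidableEq X] [Fintype ι] [Fintype κ] [DecidableEq ι]
    [DecidableEq κ] {μ : ι → ℕ} {ν : κ → ℕ} (hG : Generic μ ν) {I : Finset ι} (J : Finset κ)
    (hμ : ∀ i ∈ I, 0 < μ i) (hk : ∃ k ∉ I, 0 < μ k) (j₀ : κ) :
    labPathCard X b μ ν I J = Nat.card {w : Equiv.Perm X × (X → ι) // Lab w.1 μ w.2} *
      ∑ α : ι → κ with ∀ i ∉ I, α i = j₀, modelCard b μ ν I α J := by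
  rw [← card_subtype_prod (fun w : Equiv.Perm X × (X → ι) => Lab w.1 μ w.2)
    (fun w (u : (Fin (b + 1) → Equiv.Perm X) × (X → κ)) =>
      u.1 0 = w.1 ∧ LabPath μ ν I J u.1 w.2 u.2)]
  · refine Nat.card_eq_of_bijective
      (fun w => ⟨((w.1.1 0, w.1.2.1), (w.1.1, w.1.2.2)), w.2.src, rfl, w.2⟩) ⟨?_, ?_⟩
    · rintro ⟨⟨η, L, M⟩, h⟩ ⟨⟨η', L', M'⟩, h'⟩ heq
      have h1 : η = η' := congrArg (fun w => w.1.2.1) heq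
      have h2 : L = L' := congrArg (fun w => w.1.1.2) heq
      have h3 : M = M' := congrArg (fun w => w.1.2.2) heq
      subst h1 h2 h3
      rfl
    · rintro ⟨⟨⟨σ, L⟩, η, M⟩, h1, h2, h3⟩
      obtain rfl : η 0 = σ := h2
      exact ⟨⟨(η, L, M), h3⟩, rfl⟩
  · rintro ⟨σ, L⟩ hσ
    change Lab σ μ L at hσ
    rw [Finset.sum_congr rfl fun α _ => (admCard_eq_modelCard hσ).symm,
      Finset.sum_subtype (p := fun α : ι → κ => ∀ i ∉ I, α i = j₀) _ (by simp)]
    simp only [admCard]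
    rw [← Nat.card_sigma]
    symm
    have hadm : ∀ (α : ι → κ) (u : (Fin (b + 1) → Equiv.Perm X) × (X → κ)),
        Adm σ L ν I α J u.1 u.2 → LabPath μ ν I J u.1 L u.2 := fun α u h =>
      ⟨by rw [h.start]; exact hσ, h.lab, h.step, h.leaf, h.dual⟩
    refine Nat.card_eq_of_bijective (fun z => ⟨z.2.1, z.2.2.start, hadm _ _ z.2.2⟩) ⟨?_, ?_⟩
    · rintro ⟨⟨α, hα⟩, u, h⟩ ⟨⟨α', hα'⟩, u', h'⟩ heq
      obtain rfl : u = u' := congrArg Subtype.val heq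
      obtain rfl : α = α' := by
        funext i
        by_cases hi : i ∈ I
        · obtain ⟨x, rfl⟩ := hσ.exists_eq (hμ i hi)
          exact (h.label x hi).symm.trans (h'.label x hi)
        · rw [hα i hi, hα' i hi]
      rfl
    · rintro ⟨⟨η, M⟩, h1, h2⟩
      obtain rfl : η 0 = σ := h1
      have hex : ∀ i : I, ∃ x, L x = i := fun i => hσ.exists_eq (hμ i i.2)
      choose r hr using hex
      let α : ι → κ := fun i => if h : i ∈ I then M (r ⟨i, h⟩) else j₀
      have hα : ∀ i ∉ I, α i = j₀ := fun i hi => dif_neg hi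
      refine ⟨⟨⟨α, hα⟩, (η, M), rfl, h2.step, h2.tgt, h2.leaf, h2.dual, fun x hx => ?_⟩, rfl⟩
      have : α (L x) = M (r ⟨L x, hx⟩) := dif_pos hx
      refine Eq.trans ?_ this.symm
      refine (h2.leaf _ hx).label_eq hG hσ h2.tgt h2.step ?_ rfl (hr _)
      obtain ⟨k, hk, hk0⟩ := hk
      exact ⟨k, fun h => hk (h ▸ hx), hk0⟩

end Fermion

namespace Fermion

variable {X : Type} {ι κ : Type} {b : ℕ}

open Classical in
theorem admCard_eq_pathSum [Fintype X] [DecidableEq X] [Finite κ] (L : X → ι) (ν : κ → ℕ)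
    (α : ι → κ) : ∀ (b : ℕ) (σ : Equiv.Perm X), admCard b σ L ν ∅ α ∅ =
      pathSum b (fun σ' => Nat.card {M : X → κ // Lab σ' ν M}) σ := by
  intro b
  induction b with
  | zero =>
    intro σ
    rw [pathSum]
    refine Nat.card_eq_of_bijective (fun w => ⟨w.1.2, by
      have h := w.2.lab
      have h1 := w.2.start
      rwa [show Fin.last 0 = 0 from rfl, h1] at h⟩) ⟨?_, ?_⟩
    · rintro ⟨⟨η, M⟩, h⟩ ⟨⟨η', M'⟩, h'⟩ heq
      have h1 : M = M' := congrArg Subtype.val heq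
      have h2 : η = η' := by
        funext s
        rw [show s = 0 from Fin.ext (by omega)]
        exact h.start.trans h'.start.symm
      subst h1 h2
      rfl
    · rintro ⟨M, h⟩
      exact ⟨⟨(fun _ => σ, M), rfl, fun s => s.elim0, h, by simp, by simp, by simp⟩, rfl⟩
  | succ b ih =>
    intro σ
    rw [pathSum, Finset.sum_subtype (p := fun τ : Equiv.Perm X => τ.IsSwap) _ (by simp),
      Finset.sum_congr rfl fun τ _ => (ih _).symm]
    simp only [admCard]
    rw [← Nat.card_sigma]
    symm
    have hadm : ∀ (τ : Equiv.Perm X) (_ : τ.IsSwap) (η : Fin (b + 1) → Equiv.Perm X) (M : X → κ),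
        Adm (τ * σ) L ν ∅ α ∅ η M →
          Adm σ L ν ∅ α ∅ (Fin.cons σ η : Fin (b + 2) → Equiv.Perm X) M := by
      intro τ hτ η M h
      refine ⟨rfl, fun s => ?_, ?_, by simp, by simp, by simp⟩
      · refine Fin.cases ?_ (fun s => ?_) s
        · rw [Fin.castSucc_zero, Fin.cons_zero, Fin.cons_succ, h.start, mul_inv_cancel_right]
          exact hτ
        · rw [← Fin.succ_castSucc, Fin.cons_succ, Fin.cons_succ]
          exact h.step s
      · rw [← Fin.succ_last, Fin.cons_succ]
        exact h.lab
    refine Nat.card_eq_of_bijective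
      (fun z => ⟨(Fin.cons σ z.2.1.1, z.2.1.2), hadm _ z.1.2 _ _ z.2.2⟩) ⟨?_, ?_⟩
    · rintro ⟨⟨τ, hτ⟩, ⟨η, M⟩, h⟩ ⟨⟨τ', hτ'⟩, ⟨η', M'⟩, h'⟩ heq
      have h1 : M = M' := congrArg (fun w => w.1.2) heq
      have h2 : η = η' := by
        have := congrArg (fun w => w.1.1) heq
        exact (Fin.cons_injective2 (α := fun _ => Equiv.Perm X) this).2
      subst h1 h2
      obtain rfl : τ = τ' := mul_right_cancel (h.start.symm.trans h'.start)
      rfl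
    · rintro ⟨⟨η, M⟩, h⟩
      refine ⟨⟨⟨η 1 * (η 0)⁻¹, h.step 0⟩, (fun s => η s.succ, M), ?_⟩, ?_⟩
      · refine ⟨?_, fun s => ?_, ?_, by simp, by simp, by simp⟩
        · have h0 : η 0 = σ := h.start
          subst h0
          exact (inv_mul_cancel_right _ _).symm
        · have := h.step s.succ
          rwa [← Fin.succ_castSucc] at this
        · have := h.lab
          rwa [← Fin.succ_last] at this
      · refine Subtype.ext (Prod.ext ?_ rfl)
        have h0 := h.start
        change (Fin.cons σ (fun s => η s.succ) : Fin (b + 2) → Equiv.Perm X) = η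
        rw [← h0]
        exact Fin.cons_self_tail η

theorem partProd_pos [Fintype ι] (μ : ι → ℕ) : 0 < partProd μ := by
  refine Finset.prod_pos fun i _ => ?_
  split_ifs with h
  · exact h
  · exact one_pos

theorem le_of_red_pos [DecidableEq κ] {ν : κ → ℕ} {μ : ι → ℕ} {I : Finset ι} {α : ι → κ}
    (h : ∀ i ∈ I, 0 < red ν μ I α (α i)) (j : κ) : ∑ i ∈ I with α i = j, μ i ≤ ν j := by
  by_cases hj : ∃ i ∈ I, α i = j
  · obtain ⟨i, hi, rfl⟩ := hj
    have := h i hi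
    rw [red] at this
    omega
  · rw [Finset.filter_eq_empty_iff.2 fun i hi hij => hj ⟨i, hi, hij⟩]
    simp

theorem eq_mul_sum_div_of_mul_eq {B : Type*} {s : Finset B} {c c' u v p q r a A : ℚ} {f g : B → ℚ}
    (hq : q ≠ 0) (hp : p ≠ 0) (h : q * A = r * ∑ x ∈ s, c' * (v * f x) * g x) (hv : v * p = q) :
    c * (a * u) * A = a * r * ∑ x ∈ s, c * c' * (u * f x) * (g x / p) := by
  refine mul_left_cancel₀ hq ?_
  rw [show q * (c * (a * u) * A) = c * (a * u) * (q * A) by ring, h, ← hv]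
  simp only [Finset.mul_sum]
  refine Finset.sum_congr rfl fun x _ => ?_
  field_simp

section

variable [Fintype ι] [Fintype κ] [DecidableEq ι] [DecidableEq κ]

theorem modelCard_comm {μ : ι → ℕ} {ν : κ → ℕ} (hG : Generic μ ν)
    (hs : ∑ i, μ i = ∑ j, ν j) (J : Finset κ) (hν : ∀ j ∈ J, 0 < ν j) (hk : ∃ k ∉ J, 0 < ν k)
    (α : ι → κ) (i₀ : ι) : partProd ν * modelCard b μ ν ∅ α J = partProd μ *
      ∑ β : κ → ι with ∀ j ∉ J, β j = i₀, modelCard b ν μ J β ∅ := by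
  obtain ⟨k, hkJ, hk⟩ := hk
  have hi : ∃ i ∉ (∅ : Finset ι), 0 < μ i := by
    by_contra! hcon
    have h1 : ∑ i, μ i = 0 := Finset.sum_eq_zero fun i _ => Nat.le_zero.1 (hcon i (by simp))
    have h2 := Finset.single_le_sum (f := ν) (fun _ _ => Nat.zero_le _) (Finset.mem_univ k)
    omega
  have h1 := labPathCard_eq_sum (X := Fin (∑ i, μ i)) (b := b) hG (I := ∅) J (by simp) hi k
  have h2 := labPathCard_eq_sum (X := Fin (∑ i, μ i)) (b := b) (hG.symm hs) (I := J) ∅ hν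
    ⟨k, hkJ, hk⟩ i₀
  have h3 : (Finset.univ.filter fun α : ι → κ => ∀ i ∉ (∅ : Finset ι), α i = k) = {fun _ => k} := by
    ext α
    simp [funext_iff]
  rw [h3, Finset.sum_singleton, labPathCard_comm, h2, modelCard_empty μ ν _ α] at h1
  have h4 := card_lab_mul_partProd (X := Fin (∑ i, μ i)) (μ := μ) (by simp)
  have h5 := card_lab_mul_partProd (X := Fin (∑ i, μ i)) (μ := ν) (by simp [hs])
  refine Nat.eq_of_mul_eq_mul_left (Nat.factorial_pos (Fintype.card (Fin (∑ i, μ i)))) ?_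
  nth_rewrite 1 [← h4]
  rw [← h5]
  zify at h1 ⊢
  linear_combination (-partProd μ * partProd ν : ℤ) * h1

theorem prod_mul_partProd_off {μ : ι → ℕ} {I : Finset ι} (hμ : ∀ i ∈ I, 0 < μ i) :
    (∏ i ∈ I, μ i) * partProd (off μ I) = partProd μ := by
  rw [partProd, partProd, ← Finset.prod_mul_prod_compl I (fun i => if 0 < μ i then μ i else 1),
    ← Finset.prod_mul_prod_compl I (fun i => if 0 < off μ I i then off μ I i else 1)]
  have h1 : ∏ i ∈ I, (if 0 < off μ I i then off μ I i else 1) = 1 :=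
    Finset.prod_eq_one fun i hi => by simp [off, hi]
  have h2 : ∏ i ∈ I, μ i = ∏ i ∈ I, if 0 < μ i then μ i else 1 :=
    Finset.prod_congr rfl fun i hi => by rw [if_pos (hμ i hi)]
  have h3 : ∏ i ∈ Iᶜ, (if 0 < off μ I i then off μ I i else 1) =
      ∏ i ∈ Iᶜ, if 0 < μ i then μ i else 1 :=
    Finset.prod_congr rfl fun i hi => by simp [off, Finset.mem_compl.1 hi]
  rw [h1, h2, h3, one_mul]

theorem modelCard_eq_sum {μ : ι → ℕ} {ν : κ → ℕ} (hG : Generic μ ν) (hs : ∑ i, μ i = ∑ j, ν j)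
    (hμ : ∀ i, 0 < μ i) (hν : ∀ j, 0 < ν j) {I : Finset ι} {J : Finset κ}
    (hI : I ≠ Finset.univ) (hJ : J ≠ Finset.univ) (b : ℕ) (α : ι → κ) (i₀ : ι) :
    (modelCard b μ ν I α J : ℚ) = partProd μ * if ∃ i ∈ I, α i ∈ J then 0 else
      ∑ β : κ → ι with ∀ j ∉ J, β j = i₀,
        (b.descFactorial I.card * (b - I.card).descFactorial J.card : ℕ) *
          ((∏ i ∈ I, red ν μ I α (α i) : ℕ) *
            (∏ j ∈ J, red (off μ I) (red ν μ I α) J β (β j) : ℕ)) *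
          ((modelCard (b - I.card - J.card) (off (red ν μ I α) J)
            (red (off μ I) (red ν μ I α) J β) ∅ β ∅ : ℚ) / partProd (off (red ν μ I α) J)) := by
  obtain ⟨k, hk⟩ : ∃ k, k ∉ I := by
    by_contra! h
    exact hI (Finset.eq_univ_of_forall h)
  obtain ⟨l, hl⟩ : ∃ l, l ∉ J := by
    by_contra! h
    exact hJ (Finset.eq_univ_of_forall h)
  rw [modelCard_eq I α J b μ ν hG hs (fun i _ => hμ i) ⟨k, hk, hμ k⟩ ⟨l, hl, hν l⟩]
  split_ifs with hgood
  · simp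
  push Not at hgood
  by_cases hred : ∀ i ∈ I, 0 < red ν μ I α (α i)
  swap
  · push Not at hred
    obtain ⟨i, hi, h0⟩ := hred
    have : ∏ i ∈ I, red ν μ I α (α i) = 0 := Finset.prod_eq_zero hi (Nat.le_zero.1 h0)
    simp [this]
  have htr := le_of_red_pos hred
  have hG' : Generic (off μ I) (red ν μ I α) := hG.off_red htr
  have hs' := sum_off_eq_sum_red htr hs
  have hν' : ∀ j ∈ J, 0 < red ν μ I α j := by
    intro j hj
    have h0 : I.filter (fun i => α i = j) = ∅ :=
      Finset.filter_false_of_mem fun i hi hij => hgood i hi (by rw [hij]; exact hj)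
    rw [red, h0]
    simpa using hν j
  have hk' : 0 < off μ I k := by
    rw [off, if_neg hk]
    exact hμ k
  have hl' : ∃ l ∉ J, 0 < red ν μ I α l := by
    rcases I.eq_empty_or_nonempty with rfl | ⟨i, hi⟩
    · exact ⟨l, hl, by simpa [red] using hν l⟩
    · exact ⟨α i, hgood i hi, hred i hi⟩
  have hcomm := modelCard_comm (b := b - I.card) hG' hs' J hν' hl' α i₀
  rw [Finset.sum_congr rfl fun β _ => modelCard_eq J β ∅ (b - I.card) _ _ (hG'.symm hs') hs'.symm
    hν' hl' ⟨k, by simp, hk'⟩] at hcomm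
  simp only [Finset.notMem_empty, and_false, exists_false, if_false] at hcomm
  have hp1 := prod_mul_partProd_off (μ := μ) (I := I) fun i _ => hμ i
  have hp2 := prod_mul_partProd_off hν'
  have h1 : (partProd (red ν μ I α) : ℚ) ≠ 0 := by exact_mod_cast (partProd_pos _).ne'
  have h2 : (partProd (off (red ν μ I α) J) : ℚ) ≠ 0 := by exact_mod_cast (partProd_pos _).ne'
  have hcommQ := congrArg (Nat.cast : ℕ → ℚ) hcomm
  have hp1Q := congrArg (Nat.cast : ℕ → ℚ) hp1
  have hp2Q := congrArg (Nat.cast : ℕ → ℚ) hp2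
  simp only [Nat.cast_mul, Nat.cast_sum] at hcommQ hp1Q hp2Q ⊢
  rw [← hp1Q]
  exact eq_mul_sum_div_of_mul_eq h1 h2 hcommQ hp2Q

end

end Fermion

namespace Fermion

open MvPolynomial

variable {ι κ : Type}

theorem totalDegree_bind_le {A B : Type*} {l : A → MvPolynomial B ℚ}
    (hl : ∀ a, (l a).totalDegree ≤ 1) (P : MvPolynomial A ℚ) :
    (bind₁ l P).totalDegree ≤ P.totalDegree := by
  rw [bind₁, aeval_def, eval₂_eq]
  refine totalDegree_finsetSum_le fun d hd => (totalDegree_mul _ _).trans ?_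
  rw [algebraMap_eq, totalDegree_C, zero_add]
  refine (totalDegree_finsetProd _ _).trans ((Finset.sum_le_sum fun a _ => ?_).trans
    (le_totalDegree hd))
  exact (totalDegree_pow _ _).trans ((Nat.mul_le_mul_left (d a) (hl a)).trans (mul_one _).le)

theorem totalDegree_list_prod_X_le {A : Type*} (l : List A) :
    (l.map fun a => (X a : MvPolynomial A ℚ)).prod.totalDegree ≤ l.length := by
  induction l with
  | nil => simp
  | cons a l ih =>
    rw [List.map_cons, List.prod_cons, List.length_cons, add_comm]
    refine (totalDegree_mul _ _).trans (add_le_add ?_ ih)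
    rw [totalDegree_X]

theorem partProd_eq_prod [Fintype ι] {μ : ι → ℕ} {s : Finset ι} (h : ∀ i, i ∈ s ↔ μ i ≠ 0) :
    partProd μ = ∏ i ∈ s, μ i := by
  rw [partProd, ← Finset.prod_subset (Finset.subset_univ s)]
  · exact Finset.prod_congr rfl fun i hi => if_pos (Nat.pos_of_ne_zero ((h i).1 hi))
  · intro i _ hi
    rw [if_neg]
    have := mt (h i).2 hi
    omega

theorem modelCard_eq_pathSum [Fintype ι] [Fintype κ] [DecidableEq ι] (b : ℕ) (μ : ι → ℕ) (ν : κ → ℕ) (α : ι → κ) :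
    modelCard b μ ν ∅ α ∅ =
      pathSum b (fun σ' => Nat.card {M : (Σ i, Fin (μ i)) → κ // Lab σ' ν M}) (standardPerm μ) :=
  admCard_eq_pathSum _ _ _ _ _

variable [Fintype ι] [Fintype κ] [DecidableEq ι] [DecidableEq κ]

/-- The normalised numbers of factorisations without leaves, multiplied by some of the parts,
are polynomial. -/
theorem exists_modelCard_eq (b : ℕ) {C : Finset (ι ⊕ κ)} {D : Set ((ι → ℕ) × (κ → ℕ))}
    (hD : Wall C D) {i₀ : ι} (hi : Sum.inl i₀ ∈ C) {j₀ : κ} (hj : Sum.inr j₀ ∈ C)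
    (α : ι → κ) (hb : C.card ≤ b + 2) (l : List (ι ⊕ κ)) (hl : ∀ e ∈ l, e ∈ C)
    (hlC : 3 ≤ l.length + C.card) :
    ∃ Q : MvPolynomial (ι ⊕ κ) ℚ, Q.totalDegree ≤ l.length + 2 * b + 1 - C.card ∧
      ∀ p ∈ D, (l.map (pt p.1 p.2)).prod * ((modelCard b p.1 p.2 ∅ α ∅ : ℚ) / partProd p.1) =
        eval (pt p.1 p.2) Q := by
  have hprod : ∀ (l : List (ι ⊕ κ)) (f : ι ⊕ κ → ℚ),
      eval f (l.map fun a => (X a : MvPolynomial (ι ⊕ κ) ℚ)).prod = (l.map f).prod := by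
    intro l f
    rw [map_list_prod, List.map_map]
    congr 1
    exact List.map_congr_left fun a _ => eval_X a
  have hpart : ∀ p ∈ D, partProd p.1 = ∏ i ∈ C.toLeft, p.1 i := fun p hp =>
    partProd_eq_prod fun i => by rw [Finset.mem_toLeft, hD.left p hp]
  have hpos : ∀ p : (ι → ℕ) × (κ → ℕ), (partProd p.1 : ℚ) ≠ 0 := fun p => by
    exact_mod_cast (partProd_pos _).ne'
  have hsub : {Sum.inl i₀, Sum.inr j₀} ⊆ C := by
    intro e he
    rcases Finset.mem_insert.1 he with rfl | he
    · exact hi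
    · rw [Finset.mem_singleton.1 he]
      exact hj
  have h2 : ({Sum.inl i₀, Sum.inr j₀} : Finset (ι ⊕ κ)).card = 2 := Finset.card_pair (by simp)
  rcases (h2.symm.le.trans (Finset.card_le_card hsub)).lt_or_eq with hc | hc
  · obtain ⟨Q, hQ, hev⟩ := exists_pathSum_eq b hD hi hc
    refine ⟨(l.map fun a => (X a : MvPolynomial (ι ⊕ κ) ℚ)).prod * Q,
      (totalDegree_mul _ _).trans ?_, fun p hp => ?_⟩
    · have := totalDegree_list_prod_X_le l
      omega
    · rw [map_mul, hprod, modelCard_eq_pathSum, hev p hp _ _ _ (lab_standardPerm p.1),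
        ← hpart p hp, mul_div_cancel_left₀ _ (hpos p)]
  · have hC : C = {Sum.inl i₀, Sum.inr j₀} :=
      (Finset.eq_of_subset_of_card_le hsub (by omega)).symm
    obtain ⟨Q, hQ, hev⟩ := exists_pathSum_eq_of_card_two b hD hC
    cases l with
    | nil => simp at hlC; omega
    | cons e l =>
      have hL : C.toLeft = {i₀} := by
        ext i
        simp [hC]
      have hR : C.toRight = {j₀} := by
        ext i
        simp [hC]
      refine ⟨(l.map fun a => (X a : MvPolynomial (ι ⊕ κ) ℚ)).prod * Q,
        (totalDegree_mul _ _).trans ?_, fun p hp => ?_⟩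
      · have := totalDegree_list_prod_X_le l
        rw [List.length_cons]
        omega
      · have hp0 := hpos p
        have h3 := hpart p hp
        rw [hL, Finset.prod_singleton] at h3
        have h4 : pt p.1 p.2 e = partProd p.1 := by
          have he := hl e (by simp)
          rw [hC, Finset.mem_insert, Finset.mem_singleton] at he
          rcases he with rfl | rfl
          · rw [h3]
            rfl
          · have h5 := hD.sum p hp
            rw [Finset.sum_eq_single_of_mem i₀ (Finset.mem_univ _) (fun i _ hne => by
              by_contra h
              have := (hD.left p hp i).2 h
              simp [hC, hne] at this), Finset.sum_eq_single_of_mem j₀ (Finset.mem_univ _)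
              (fun j _ hne => by
              by_contra h
              have := (hD.right p hp j).2 h
              simp [hC, hne] at this)] at h5
            rw [h3, h5]
            rfl
        rw [map_mul, hprod, modelCard_eq_pathSum, hev p hp _ _ _ (lab_standardPerm p.1),
          List.map_cons, List.prod_cons, h4]
        field_simp [hp0]

end Fermion

namespace Fermion

open MvPolynomial

variable {ι κ : Type}

theorem red_off_red [DecidableEq ι] [DecidableEq κ] (μ : ι → ℕ) (ν : κ → ℕ) {I : Finset ι} {J : Finset κ} {α : ι → κ}
    (hα : ∀ i ∈ I, α i ∉ J) (β : κ → ι) (i : ι) :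
    red (off μ I) (red ν μ I α) J β i = if i ∈ I then 0 else red μ ν J β i := by
  have h1 : ∑ j ∈ J with β j = i, red ν μ I α j = ∑ j ∈ J with β j = i, ν j := by
    refine Finset.sum_congr rfl fun j hj => ?_
    have h0 : I.filter (fun i => α i = j) = ∅ :=
      Finset.filter_false_of_mem fun i hi hij => hα i hi (by
        rw [hij]
        exact (Finset.mem_filter.1 hj).1)
    rw [red, h0, Finset.sum_empty, Nat.sub_zero]
  rw [red, h1, off, red]
  split_ifs
  · omega
  · rfl

/-- The linear form computing a reduced part. -/
noncomputable def redForm {A B : Type} [DecidableEq A] (I : Finset B) (J : Finset A) (α : B → A)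
    (x : A → MvPolynomial (ι ⊕ κ) ℚ) (y : B → MvPolynomial (ι ⊕ κ) ℚ) (a : A) :
    MvPolynomial (ι ⊕ κ) ℚ :=
  if a ∈ J then 0 else x a - ∑ i ∈ I with α i = a, y i

theorem totalDegree_redForm_le {A B : Type} [DecidableEq A] (I : Finset B) (J : Finset A)
    (α : B → A) {x : A → MvPolynomial (ι ⊕ κ) ℚ} {y : B → MvPolynomial (ι ⊕ κ) ℚ}
    (hx : ∀ a, (x a).totalDegree ≤ 1) (hy : ∀ i, (y i).totalDegree ≤ 1) (a : A) :
    (redForm I J α x y a).totalDegree ≤ 1 := by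
  rw [redForm]
  split_ifs
  · simp
  · exact (totalDegree_sub _ _).trans
      (max_le (hx a) (totalDegree_finsetSum_le fun i _ => hy i))

theorem eval_redForm {A B : Type} [DecidableEq A] (I : Finset B) (J : Finset A)
    (α : B → A) {x : A → MvPolynomial (ι ⊕ κ) ℚ} {y : B → MvPolynomial (ι ⊕ κ) ℚ}
    {μ : B → ℕ} {ν : A → ℕ} {f : ι ⊕ κ → ℚ} (hx : ∀ a, eval f (x a) = ν a)
    (hy : ∀ i, eval f (y i) = μ i) (a : A) (h : ∑ i ∈ I with α i = a, μ i ≤ ν a) :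
    eval f (redForm I J α x y a) = if a ∈ J then (0 : ℚ) else (red ν μ I α a : ℚ) := by
  rw [redForm, red, Nat.cast_sub h]
  split_ifs
  · simp
  · rw [map_sub, map_sum, hx, Nat.cast_sum, Finset.sum_congr rfl fun i _ => hy i]

variable [Fintype ι] [Fintype κ]

/-- A set of pairs of compositions of the same size on which the differences of partial sums
have constant nonzero signs. -/
structure Chamber (D : Set ((ι → ℕ) × (κ → ℕ))) : Prop where
  pos_left : ∀ p ∈ D, ∀ i, 0 < p.1 i
  pos_right : ∀ p ∈ D, ∀ j, 0 < p.2 j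
  sum : ∀ p ∈ D, ∑ i, p.1 i = ∑ j, p.2 j
  sign : ∀ (I : Finset ι) (J : Finset κ), ¬ (I = ∅ ∧ J = ∅) →
    ¬ (I = Finset.univ ∧ J = Finset.univ) →
      (∀ p ∈ D, ∑ i ∈ I, p.1 i < ∑ j ∈ J, p.2 j) ∨ ∀ p ∈ D, ∑ j ∈ J, p.2 j < ∑ i ∈ I, p.1 i

variable {D : Set ((ι → ℕ) × (κ → ℕ))}

theorem Chamber.swap (hD : Chamber D) : Chamber (Prod.swap '' D) where
  pos_left := by
    rintro - ⟨p, hp, rfl⟩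
    exact hD.pos_right p hp
  pos_right := by
    rintro - ⟨p, hp, rfl⟩
    exact hD.pos_left p hp
  sum := by
    rintro - ⟨p, hp, rfl⟩
    exact (hD.sum p hp).symm
  sign I J h0 h1 := by
    rcases hD.sign J I (fun h => h0 h.symm) (fun h => h1 h.symm) with h | h
    · right
      rintro - ⟨p, hp, rfl⟩
      exact h p hp
    · left
      rintro - ⟨p, hp, rfl⟩
      exact h p hp

theorem Chamber.generic (hD : Chamber D) {p : (ι → ℕ) × (κ → ℕ)} (hp : p ∈ D) :
    Generic p.1 p.2 := by
  intro I J h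
  by_cases h0 : I = ∅ ∧ J = ∅
  · left
    rw [h0.1, Finset.sum_empty]
  by_cases h1 : I = Finset.univ ∧ J = Finset.univ
  · right
    rw [h1.1]
  rcases hD.sign I J h0 h1 with h2 | h2
  · exact absurd h (h2 p hp).ne
  · exact absurd h (h2 p hp).ne'

section

variable [DecidableEq κ]

theorem Chamber.red_pos_or (hD : Chamber D) {I : Finset ι} (hI : I ≠ Finset.univ) (α : ι → κ)
    (j : κ) : (∀ p ∈ D, 0 < red p.2 p.1 I α j) ∨ ∀ p ∈ D, red p.2 p.1 I α j = 0 := by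
  rcases hD.sign (I.filter fun i => α i = j) {j} (by simp) (fun h => hI
    (Finset.univ_subset_iff.1 (h.1.symm.subset.trans (Finset.filter_subset _ _)))) with h | h
  · left
    intro p hp
    have := h p hp
    rw [Finset.sum_singleton] at this
    rw [red]
    omega
  · right
    intro p hp
    have := h p hp
    rw [Finset.sum_singleton] at this
    rw [red]
    omega

variable [DecidableEq ι]

/-- The parts left over after removing leaves on both sides. -/
def core (I : Finset ι) (J : Finset κ) (α : ι → κ) (β : κ → ι) (p : (ι → ℕ) × (κ → ℕ)) :
    (κ → ℕ) × (ι → ℕ) :=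
  (off (red p.2 p.1 I α) J, red (off p.1 I) (red p.2 p.1 I α) J β)

theorem Chamber.wall_core (hD : Chamber D) {I : Finset ι} {J : Finset κ} {α : ι → κ} {β : κ → ι} (hα : ∀ i ∈ I, α i ∉ J)
    (hβ : ∀ j ∈ J, β j ∉ I) (hα' : ∀ i ∈ I, ∀ p ∈ D, 0 < red p.2 p.1 I α (α i))
    (hβ' : ∀ j ∈ J, ∀ p ∈ D, 0 < red p.1 p.2 J β (β j)) :
    Wall (Jᶜ.disjSum Iᶜ) (core I J α β '' D) := by
  have hred : ∀ (p : (ι → ℕ) × (κ → ℕ)), p ∈ D → ∀ j, 0 < red p.2 p.1 I α j := by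
    intro p hp j
    by_cases hj : ∃ i ∈ I, α i = j
    · obtain ⟨i, hi, rfl⟩ := hj
      exact hα' i hi p hp
    · have h0 : I.filter (fun i => α i = j) = ∅ :=
        Finset.filter_false_of_mem fun i hi hij => hj ⟨i, hi, hij⟩
      rw [red, h0, Finset.sum_empty]
      exact hD.pos_right p hp j
  have hred' : ∀ (p : (ι → ℕ) × (κ → ℕ)), p ∈ D → ∀ i, 0 < red p.1 p.2 J β i := by
    intro p hp j
    by_cases hj : ∃ i ∈ J, β i = j
    · obtain ⟨i, hi, rfl⟩ := hj
      exact hβ' i hi p hp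
    · have h0 : J.filter (fun i => β i = j) = ∅ :=
        Finset.filter_false_of_mem fun i hi hij => hj ⟨i, hi, hij⟩
      rw [red, h0, Finset.sum_empty]
      exact hD.pos_left p hp j
  have htr : ∀ (p : (ι → ℕ) × (κ → ℕ)), p ∈ D → ∀ j, ∑ i ∈ I with α i = j, p.1 i ≤ p.2 j :=
    fun p hp => le_of_red_pos fun i hi => hα' i hi p hp
  have htr' : ∀ (p : (ι → ℕ) × (κ → ℕ)), p ∈ D →
      ∀ i, ∑ j ∈ J with β j = i, red p.2 p.1 I α j ≤ off p.1 I i := by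
    refine fun p hp => le_of_red_pos fun j hj => ?_
    rw [red_off_red _ _ hα, if_neg (hβ j hj)]
    exact hβ' j hj p hp
  refine ⟨?_, ?_, ?_, ?_⟩
  · rintro - ⟨p, hp, rfl⟩ j
    rw [Finset.inl_mem_disjSum, Finset.mem_compl, core]
    have := hred p hp j
    by_cases hj : j ∈ J
    · simp [off, hj]
    · simp [off, hj, this.ne']
  · rintro - ⟨p, hp, rfl⟩ i
    rw [Finset.inr_mem_disjSum, Finset.mem_compl, core]
    dsimp only
    rw [red_off_red _ _ hα]
    have := hred' p hp i
    by_cases hi : i ∈ I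
    · simp [hi]
    · simp [hi, this.ne']
  · rintro - ⟨p, hp, rfl⟩
    exact sum_off_eq_sum_red (htr' p hp) (sum_off_eq_sum_red (htr p hp) (hD.sum p hp)).symm
  · intro S hS hS0 hS1
    set J₁ := lift J β S.toLeft S.toRight with hJ₁
    set I₁ := lift I α S.toRight J₁ with hI₁
    have hl : ∀ j, Sum.inl j ∈ S → j ∉ J := fun j hj => by simpa using hS hj
    have hr : ∀ i, Sum.inr i ∈ S → i ∉ I := fun i hi => by simpa using hS hi
    have hJm : ∀ j ∉ J, j ∈ J₁ ↔ Sum.inl j ∈ S := by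
      intro j hj
      simp [hJ₁, lift, hj]
    have hIm : ∀ i ∉ I, i ∈ I₁ ↔ Sum.inr i ∈ S := by
      intro i hi
      simp [hI₁, lift, hi]
    have key : ∀ p ∈ D, ∑ e ∈ S, sgnPt (core I J α β p).1 (core I J α β p).2 e =
        ∑ i ∈ I₁, (p.1 i : ℤ) - ∑ j ∈ J₁, (p.2 j : ℤ) := by
      intro p hp
      have h1 := sum_lift_sub (htr' p hp) S.toLeft S.toRight
      have h2 := sum_lift_sub (htr p hp) S.toRight J₁
      rw [← Finset.toLeft_disjSum_toRight (u := S), Finset.sum_disjSum]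
      simp only [sgnPt, Sum.elim_inl, Sum.elim_inr, Finset.sum_neg_distrib, core]
      linarith
    have hne0 : ¬ (I₁ = ∅ ∧ J₁ = ∅) := by
      rintro ⟨h1, h2⟩
      refine hS0 (Finset.eq_empty_of_forall_notMem ?_)
      rintro (j | i) he
      · have := (hJm j (hl j he)).2 he
        simp [h2] at this
      · have := (hIm i (hr i he)).2 he
        simp [h1] at this
    have hne1 : ¬ (I₁ = Finset.univ ∧ J₁ = Finset.univ) := by
      rintro ⟨h1, h2⟩
      refine hS1 (hS.antisymm ?_)
      rintro (j | i) he
      · refine (hJm j (by simpa using he)).1 ?_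
        simp [h2]
      · refine (hIm i (by simpa using he)).1 ?_
        simp [h1]
    rcases hD.sign I₁ J₁ hne0 hne1 with h | h
    · right
      rintro - ⟨p, hp, rfl⟩
      rw [key p hp]
      have := h p hp
      zify at this
      linarith
    · left
      rintro - ⟨p, hp, rfl⟩
      rw [key p hp]
      have := h p hp
      zify at this
      linarith

end

end Fermion

namespace Fermion

open MvPolynomial

variable {ι κ : Type} [Fintype ι] [Fintype κ] [DecidableEq ι] [DecidableEq κ]
  {D : Set ((ι → ℕ) × (κ → ℕ))}

/-- The contribution of given attaching maps of the leaves to the number of factorisations. -/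
theorem Chamber.exists_term_eq (hD : Chamber D) {I : Finset ι} {J : Finset κ}
    (hI : I ≠ Finset.univ) (hJ : J ≠ Finset.univ) {b : ℕ}
    (hb : Fintype.card ι + Fintype.card κ ≤ b + 2) (hcard : 3 ≤ Fintype.card ι + Fintype.card κ)
    {α : ι → κ} (β : κ → ι) (hα : ∀ i ∈ I, α i ∉ J) :
    ∃ Q : MvPolynomial (ι ⊕ κ) ℚ,
      Q.totalDegree ≤ 2 * b + 1 - (Fintype.card ι + Fintype.card κ) ∧
      ∀ p ∈ D, (b.descFactorial I.card * (b - I.card).descFactorial J.card : ℕ) *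
          ((∏ i ∈ I, red p.2 p.1 I α (α i) : ℕ) *
            (∏ j ∈ J, red (off p.1 I) (red p.2 p.1 I α) J β (β j) : ℕ)) *
          ((modelCard (b - I.card - J.card) (off (red p.2 p.1 I α) J)
            (red (off p.1 I) (red p.2 p.1 I α) J β) ∅ β ∅ : ℚ) /
              partProd (off (red p.2 p.1 I α) J)) = eval (pt p.1 p.2) Q := by
  by_cases hbI : b < I.card + J.card
  · refine ⟨0, by simp, fun p _ => ?_⟩
    have : b.descFactorial I.card * (b - I.card).descFactorial J.card = 0 := by
      rw [mul_eq_zero, Nat.descFactorial_eq_zero_iff_lt, Nat.descFactorial_eq_zero_iff_lt]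
      omega
    rw [this]
    simp
  by_cases hα' : ∀ i ∈ I, ∀ p ∈ D, 0 < red p.2 p.1 I α (α i)
  swap
  · push Not at hα'
    obtain ⟨i, hi, p, hp, h0⟩ := hα'
    rcases hD.red_pos_or hI α (α i) with h | h
    · exact absurd h0 (h p hp).not_ge
    refine ⟨0, by simp, fun q hq => ?_⟩
    rw [Finset.prod_eq_zero hi (h q hq)]
    simp
  by_cases hβ : ∀ j ∈ J, β j ∉ I
  swap
  · push Not at hβ
    obtain ⟨j, hj, h0⟩ := hβ
    refine ⟨0, by simp, fun q hq => ?_⟩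
    have : red (off q.1 I) (red q.2 q.1 I α) J β (β j) = 0 := by
      rw [red_off_red _ _ hα, if_pos h0]
    rw [Finset.prod_eq_zero hj this]
    simp
  by_cases hβ' : ∀ j ∈ J, ∀ p ∈ D, 0 < red p.1 p.2 J β (β j)
  swap
  · push Not at hβ'
    obtain ⟨j, hj, p, hp, h0⟩ := hβ'
    rcases hD.swap.red_pos_or hJ β (β j) with h | h
    · exact absurd h0 (h _ ⟨p, hp, rfl⟩).not_ge
    refine ⟨0, by simp, fun q hq => ?_⟩
    have : red (off q.1 I) (red q.2 q.1 I α) J β (β j) = 0 := by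
      rw [red_off_red _ _ hα, if_neg (hβ j hj)]
      exact h _ ⟨q, hq, rfl⟩
    rw [Finset.prod_eq_zero hj this]
    simp
  have hW := hD.wall_core hα hβ hα' hβ'
  obtain ⟨k, hk⟩ : ∃ k, k ∉ I := by
    by_contra! h
    exact hI (Finset.eq_univ_of_forall h)
  obtain ⟨l, hl⟩ : ∃ l, l ∉ J := by
    by_contra! h
    exact hJ (Finset.eq_univ_of_forall h)
  have hIc := Finset.card_compl I
  have hJc := Finset.card_compl J
  have hIle := Finset.card_le_univ I
  have hJle := Finset.card_le_univ J
  have hC : (Jᶜ.disjSum Iᶜ : Finset (κ ⊕ ι)).card = Jᶜ.card + Iᶜ.card := Finset.card_disjSum _ _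
  have hlen : (I.toList.map (fun i => (Sum.inl (α i) : κ ⊕ ι)) ++
      J.toList.map fun j => (Sum.inr (β j) : κ ⊕ ι)).length = I.card + J.card := by simp
  obtain ⟨Q, hQ, hev⟩ := exists_modelCard_eq (b - I.card - J.card) hW (i₀ := l) (by simpa using hl)
    (j₀ := k) (by simpa using hk) β (by omega)
    (I.toList.map (fun i => (Sum.inl (α i) : κ ⊕ ι)) ++
      J.toList.map fun j => (Sum.inr (β j) : κ ⊕ ι)) (by
        intro e he
        rw [List.mem_append, List.mem_map, List.mem_map] at he
        rcases he with ⟨i, hi, rfl⟩ | ⟨j, hj, rfl⟩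
        · simpa using hα i (by simpa using hi)
        · simpa using hβ j (by simpa using hj)) (by omega)
  set x : κ ⊕ ι → MvPolynomial (ι ⊕ κ) ℚ :=
    Sum.elim (redForm I J α (fun j => X (Sum.inr j)) fun i => X (Sum.inl i))
      (redForm J I β (fun i => X (Sum.inl i)) fun j => X (Sum.inr j)) with hx
  have hxdeg : ∀ e, (x e).totalDegree ≤ 1 := by
    rintro (j | i)
    · exact totalDegree_redForm_le _ _ _ (fun _ => (totalDegree_X _).le)
        (fun _ => (totalDegree_X _).le) _
    · exact totalDegree_redForm_le _ _ _ (fun _ => (totalDegree_X _).le)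
        (fun _ => (totalDegree_X _).le) _
  have hxev : ∀ p ∈ D, ∀ e,
      eval (pt p.1 p.2) (x e) = pt (core I J α β p).1 (core I J α β p).2 e := by
    intro p hp
    have htr := le_of_red_pos fun i hi => hα' i hi p hp
    have htr' := le_of_red_pos fun i hi => hβ' i hi p hp
    rintro (j | i)
    · rw [hx, Sum.elim_inl, eval_redForm (μ := p.1) (ν := p.2) I J α
        (fun j => by rw [eval_X]; rfl) (fun i => by rw [eval_X]; rfl) j (htr j)]
      simp [pt, core, off]
    · rw [hx, Sum.elim_inr, eval_redForm (μ := p.2) (ν := p.1) J I β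
        (fun j => by rw [eval_X]; rfl) (fun i => by rw [eval_X]; rfl) i (htr' i)]
      simp only [pt, core, Sum.elim_inr]
      rw [red_off_red _ _ hα]
      simp
  refine ⟨C ((b.descFactorial I.card * (b - I.card).descFactorial J.card : ℕ) : ℚ) * bind₁ x Q,
    ?_, fun p hp => ?_⟩
  · refine (totalDegree_mul _ _).trans ?_
    have h1 := totalDegree_bind_le hxdeg Q
    rw [totalDegree_C]
    rw [hlen] at hQ
    omega
  · have h1 := hev _ ⟨p, hp, rfl⟩
    have h2 : eval (pt p.1 p.2) (bind₁ x Q) =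
        eval (pt (core I J α β p).1 (core I J α β p).2) Q := by
      rw [← funext (hxev p hp)]
      rw [← coe_aeval_eq_eval, ← coe_aeval_eq_eval]
      exact aeval_bind₁ _ _ _
    rw [map_mul, eval_C, h2, ← h1, mul_assoc]
    congr 2
    rw [List.map_append, List.prod_append, List.map_map, List.map_map, Finset.prod_map_toList,
      Finset.prod_map_toList, Nat.cast_prod, Nat.cast_prod]
    congr 1
    refine Finset.prod_congr rfl fun i hi => ?_
    simp [pt, core, off, hα i hi]

/-- Polynomiality of the number of labelled paths with prescribed leaves. -/
theorem Chamber.exists_labPathCard_eq (hD : Chamber D) {I : Finset ι} {J : Finset κ}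
    (hI : I ≠ Finset.univ) (hJ : J ≠ Finset.univ) {b : ℕ}
    (hb : Fintype.card ι + Fintype.card κ ≤ b + 2)
    (hcard : 3 ≤ Fintype.card ι + Fintype.card κ) :
    ∃ Q : MvPolynomial (ι ⊕ κ) ℚ,
      Q.totalDegree ≤ 2 * b + 1 - (Fintype.card ι + Fintype.card κ) ∧
      ∀ p ∈ D, ∀ (X : Type) [Fintype X] [DecidableEq X], ∑ i, p.1 i = Fintype.card X →
        (labPathCard X b p.1 p.2 I J : ℚ) =
          (Fintype.card X).factorial * eval (pt p.1 p.2) Q := by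
  obtain ⟨k, hk⟩ : ∃ k, k ∉ I := by
    by_contra! h
    exact hI (Finset.eq_univ_of_forall h)
  obtain ⟨l, hl⟩ : ∃ l, l ∉ J := by
    by_contra! h
    exact hJ (Finset.eq_univ_of_forall h)
  have hterm : ∀ (α : ι → κ) (β : κ → ι), (∀ i ∈ I, α i ∉ J) → _ := fun α β hα =>
    hD.exists_term_eq hI hJ hb hcard β hα
  choose Q hQ hev using hterm
  classical
  refine ⟨∑ α : ι → κ with ∀ i ∉ I, α i = l, if h : ∀ i ∈ I, α i ∉ J then
    ∑ β : κ → ι with ∀ j ∉ J, β j = k, Q α β h else 0, ?_, ?_⟩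
  · refine totalDegree_finsetSum_le fun α _ => ?_
    split_ifs with h
    · exact totalDegree_finsetSum_le fun β _ => hQ α β h
    · simp
  · intro p hp X _ _ hX
    rw [labPathCard_eq_sum (hD.generic hp) J (fun i _ => hD.pos_left p hp i)
      ⟨k, hk, hD.pos_left p hp k⟩ l, ← card_lab_mul_partProd hX, map_sum, Nat.cast_mul,
      Nat.cast_mul, mul_assoc, Nat.cast_sum, Finset.mul_sum (a := (partProd p.1 : ℚ))]
    congr 1
    refine Finset.sum_congr rfl fun α _ => ?_
    rw [modelCard_eq_sum (hD.generic hp) (hD.sum p hp) (hD.pos_left p hp) (hD.pos_right p hp)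
      hI hJ b α k]
    congr 1
    by_cases h : ∀ i ∈ I, α i ∉ J
    · rw [dif_pos h, if_neg (by push Not; exact h), map_sum]
      exact Finset.sum_congr rfl fun β _ => hev α β h p hp
    · rw [dif_neg h, if_pos (by push Not at h; exact h), map_zero]

end Fermion

namespace Fermion

open MvPolynomial

variable {ι κ X : Type} [DecidableEq X] {b : ℕ}

/-- Not all cycles of the first permutation can be leaves, unless the path is very short. -/
theorem not_labPath_univ [Finite X] [Fintype ι] [Fintype κ] [DecidableEq ι] {μ : ι → ℕ} {ν : κ → ℕ}
    (hG : Generic μ ν) {J : Finset κ} {η : Fin (b + 1) → Equiv.Perm X} {L : X → ι} {M : X → κ}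
    (hb : 2 ≤ b) : ¬ LabPath μ ν Finset.univ J η L M := by
  intro h
  obtain ⟨b, rfl⟩ : ∃ c, b = c + 2 := ⟨b - 2, by omega⟩
  have hstep : ∀ s : Fin (b + 2), ∃ u v, u ≠ v ∧
      ∀ x, (η s.succ)⁻¹ x = (η s.castSucc)⁻¹ (Equiv.swap u v x) := by
    intro s
    obtain ⟨u, v, huv, h1⟩ := h.step s
    refine ⟨u, v, huv, fun x => ?_⟩
    have h2 : η s.succ = Equiv.swap u v * η s.castSucc := by
      rw [← h1, inv_mul_cancel_right]
    rw [h2, mul_inv_rev, Equiv.swap_inv]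
    rfl
  have htouch : ∀ (s : Fin (b + 2)) (u v : X), u ≠ v →
      (∀ x, (η s.succ)⁻¹ x = (η s.castSucc)⁻¹ (Equiv.swap u v x)) →
        Touches (fun s => (η s)⁻¹) L s (L u) ∧ Touches (fun s => (η s)⁻¹) L s (L v) := by
    intro s u v huv hs
    refine ⟨⟨u, rfl, ?_⟩, ⟨v, rfl, ?_⟩⟩
    · dsimp only
      rw [hs, Equiv.swap_apply_left]
      exact fun h => huv ((η s.castSucc)⁻¹.injective h)
    · dsimp only
      rw [hs, Equiv.swap_apply_right]
      exact fun h => huv.symm ((η s.castSucc)⁻¹.injective h)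
  obtain ⟨u, v, huv, h0⟩ := hstep 0
  obtain ⟨u', v', huv', h1⟩ := hstep 1
  obtain ⟨tu, tv⟩ := htouch 0 u v huv h0
  have ht : ∀ x, L x ∈ ({L u, L v} : Finset ι) → Touches (fun s => (η s)⁻¹) L 0 (L x) := by
    intro x hx
    rw [Finset.mem_insert, Finset.mem_singleton] at hx
    rcases hx with hx | hx <;> rw [hx] <;> assumption
  have hinv : ∀ x, L x ∈ ({L u, L v} : Finset ι) →
      L ((η (Fin.last (b + 2)))⁻¹ x) ∈ ({L u, L v} : Finset ι) := by
    intro x hx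
    have h2 := (h.leaf (L x) (Finset.mem_univ _)).eq_last (ht x hx) rfl
      (s := (0 : Fin (b + 2)).succ) Fin.castSucc_lt_succ
    have h3 : (η (Fin.last (b + 2)))⁻¹ x = (η (0 : Fin (b + 2)).castSucc)⁻¹ (Equiv.swap u v x) :=
      h2.symm.trans (h0 x)
    have h4 : L ((η (0 : Fin (b + 2)).castSucc)⁻¹ (Equiv.swap u v x)) = L (Equiv.swap u v x) :=
      h.src.inv_apply _
    rw [h3, h4, Equiv.swap_apply_def]
    split_ifs
    · simp
    · simp
    · exact hx
  rcases hG.trivial_of_inv_invariant h.src h.tgt hinv with h2 | h2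
  · exact h2 u (by simp)
  · have := h.leaf (L u') (Finset.mem_univ _) 0 1 (ht u' (h2 u')) (htouch 1 u' v' huv' h1).1
    exact absurd this (by simp)

theorem labPathCard_univ_left [Finite X] [Fintype ι] [Fintype κ] [DecidableEq ι] {μ : ι → ℕ}
    {ν : κ → ℕ} (hG : Generic μ ν) (J : Finset κ) (hb : 2 ≤ b) :
    labPathCard X b μ ν Finset.univ J = 0 := by
  rw [labPathCard, Nat.card_eq_zero]
  exact Or.inl ⟨fun w => not_labPath_univ hG hb w.2⟩

/-- The number of paths between labelled permutations without leaves. -/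
noncomputable def prunedCard (X : Type) [DecidableEq X] (b : ℕ) (μ : ι → ℕ) (ν : κ → ℕ) : ℕ :=
  Nat.card {w : (Fin (b + 1) → Equiv.Perm X) × (X → ι) × (X → κ) //
    LabPath μ ν ∅ ∅ w.1 w.2.1 w.2.2 ∧ (∀ i, ¬ Leaf (fun s => (w.1 s)⁻¹) w.2.1 i) ∧
      ∀ j, ¬ Leaf w.1 w.2.2 j}

theorem card_forall_not_eq_sum {W E : Type*} [Finite W] [Fintype E] [DecidableEq E]
    (p : E → W → Prop) : (Nat.card {w // ∀ e, ¬ p e w} : ℤ) =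
      ∑ T : Finset E, (-1) ^ T.card * (Nat.card {w // ∀ e ∈ T, p e w} : ℤ) := by
  classical
  have := Fintype.ofFinite W
  have h := Finset.inclusion_exclusion_card_inf_compl Finset.univ
    fun e => Finset.univ.filter (p e)
  rw [Finset.powerset_univ] at h
  have h1 : ((Finset.univ : Finset E).inf fun e => (Finset.univ.filter (p e))ᶜ) =
      Finset.univ.filter fun w => ∀ e, ¬ p e w := by
    ext w
    simp [Finset.mem_inf]
  have h2 : ∀ T : Finset E, (T.inf fun e => Finset.univ.filter (p e)) =
      Finset.univ.filter fun w => ∀ e ∈ T, p e w := by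
    intro T
    ext w
    simp [Finset.mem_inf]
  simp only [h1, h2] at h
  simp only [Nat.card_eq_fintype_card, Fintype.card_subtype]
  exact h

theorem prunedCard_eq_sum [Finite X] [Fintype ι] [Fintype κ] [DecidableEq ι] [DecidableEq κ]
    (μ : ι → ℕ) (ν : κ → ℕ) : (prunedCard X b μ ν : ℤ) =
      ∑ T : Finset (ι ⊕ κ), (-1) ^ T.card * (labPathCard X b μ ν T.toLeft T.toRight : ℤ) := by
  have h := card_forall_not_eq_sum (W := {w : (Fin (b + 1) → Equiv.Perm X) × (X → ι) × (X → κ) //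
    LabPath μ ν ∅ ∅ w.1 w.2.1 w.2.2}) (E := ι ⊕ κ) fun e w =>
      Sum.elim (fun i => Leaf (fun s => (w.1.1 s)⁻¹) w.1.2.1 i) (fun j => Leaf w.1.1 w.1.2.2 j) e
  have h1 : prunedCard X b μ ν = _ :=
    Nat.card_congr (((Equiv.refl _).subtypeEquiv fun w => by simp [Sum.forall]).trans
      (Equiv.subtypeSubtypeEquivSubtypeInter (fun w : (Fin (b + 1) → Equiv.Perm X) ×
        (X → ι) × (X → κ) => LabPath μ ν ∅ ∅ w.1 w.2.1 w.2.2) (fun w => ∀ e : ι ⊕ κ,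
          ¬ Sum.elim (fun i => Leaf (fun s => (w.1 s)⁻¹) w.2.1 i)
            (fun j => Leaf w.1 w.2.2 j) e)).symm)
  rw [h1, h]
  refine Finset.sum_congr rfl fun T _ => ?_
  congr 2
  refine Nat.card_congr ((Equiv.subtypeSubtypeEquivSubtypeInter (fun w : (Fin (b + 1) →
    Equiv.Perm X) × (X → ι) × (X → κ) => LabPath μ ν ∅ ∅ w.1 w.2.1 w.2.2) (fun w => ∀ e ∈ T,
      Sum.elim (fun i => Leaf (fun s => (w.1 s)⁻¹) w.2.1 i) (fun j => Leaf w.1 w.2.2 j) e)).trans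
        ((Equiv.refl _).subtypeEquiv fun w => ?_))
  constructor
  · rintro ⟨h2, h3⟩
    refine ⟨h2.src, h2.tgt, h2.step, fun i hi => ?_, fun j hj => ?_⟩
    · exact h3 (Sum.inl i) (Finset.mem_toLeft.1 hi)
    · exact h3 (Sum.inr j) (Finset.mem_toRight.1 hj)
  · intro h2
    refine ⟨⟨h2.src, h2.tgt, h2.step, by simp, by simp⟩, ?_⟩
    rintro (i | j) he
    · exact h2.leaf i (Finset.mem_toLeft.2 he)
    · exact h2.dual j (Finset.mem_toRight.2 he)

theorem prunedCard_eq_zero [Nonempty ι] (μ : ι → ℕ) (ν : κ → ℕ) (hb : b < 2) :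
    prunedCard X b μ ν = 0 := by
  rw [prunedCard, Nat.card_eq_zero]
  refine Or.inl ⟨fun w => w.2.2.1 (Classical.arbitrary ι) fun s s' _ _ => Fin.ext ?_⟩
  omega

/-- Polynomiality of the number of labelled paths without leaves. -/
theorem Chamber.exists_prunedCard_eq [Fintype ι] [Fintype κ] [DecidableEq ι] [DecidableEq κ]
    [Nonempty ι] {D : Set ((ι → ℕ) × (κ → ℕ))} (hD : Chamber D)
    (hb : Fintype.card ι + Fintype.card κ ≤ b + 2)
    (hcard : 3 ≤ Fintype.card ι + Fintype.card κ) :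
    ∃ Q : MvPolynomial (ι ⊕ κ) ℚ,
      Q.totalDegree ≤ 2 * b + 1 - (Fintype.card ι + Fintype.card κ) ∧
      ∀ p ∈ D, ∀ (X : Type) [Fintype X] [DecidableEq X], ∑ i, p.1 i = Fintype.card X →
        (prunedCard X b p.1 p.2 : ℚ) = (Fintype.card X).factorial * eval (pt p.1 p.2) Q := by
  rcases lt_or_ge b 2 with hb2 | hb2
  · exact ⟨0, by simp, fun p _ X _ _ _ => by rw [prunedCard_eq_zero _ _ hb2]; simp⟩
  have hterm : ∀ T : Finset (ι ⊕ κ), ∃ Q : MvPolynomial (ι ⊕ κ) ℚ,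
      Q.totalDegree ≤ 2 * b + 1 - (Fintype.card ι + Fintype.card κ) ∧
      ∀ p ∈ D, ∀ (X : Type) [Fintype X] [DecidableEq X], ∑ i, p.1 i = Fintype.card X →
        (labPathCard X b p.1 p.2 T.toLeft T.toRight : ℚ) =
          (Fintype.card X).factorial * eval (pt p.1 p.2) Q := by
    intro T
    by_cases hI : T.toLeft = Finset.univ
    · refine ⟨0, by simp, fun p hp X _ _ _ => ?_⟩
      rw [hI, labPathCard_univ_left (hD.generic hp) _ hb2]
      simp
    by_cases hJ : T.toRight = Finset.univ
    · refine ⟨0, by simp, fun p hp X _ _ _ => ?_⟩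
      rw [hJ, labPathCard_comm, labPathCard_univ_left ((hD.generic hp).symm (hD.sum p hp)) _ hb2]
      simp
    exact hD.exists_labPathCard_eq hI hJ hb hcard
  choose Q hQ hev using hterm
  refine ⟨∑ T, C ((-1) ^ T.card) * Q T, totalDegree_finsetSum_le fun T _ =>
    (totalDegree_mul _ _).trans ?_, fun p hp X _ _ hX => ?_⟩
  · rw [totalDegree_C, zero_add]
    exact hQ T
  · have h := congrArg (Int.cast : ℤ → ℚ) (prunedCard_eq_sum (X := X) (b := b) p.1 p.2)
    push_cast at h
    rw [h, map_sum, Finset.mul_sum]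
    refine Finset.sum_congr rfl fun T _ => ?_
    rw [hev T p hp X hX, map_mul, eval_C]
    ring

end Fermion

namespace Fermion

theorem isLabeling_iff {d m : ℕ} {μ : Fin m → ℕ} {σ : Equiv.Perm (Fin d)} {L : Fin d → Fin m} :
    IsLabeling d m μ σ L ↔ Lab σ μ L := by
  have hc : ∀ i, Nat.card {x // L x = i} = (Finset.univ.filter fun x => L x = i).card := by
    intro i
    rw [Nat.card_eq_fintype_card, Fintype.card_subtype]
  constructor
  · rintro ⟨h1, h2, h3⟩
    exact ⟨h1, fun i => (hc i).trans (h2 i), fun {x y} h => h3 (L y) x y h rfl⟩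
  · intro h
    exact ⟨h.inv, fun i => (hc i).symm.trans (h.card i), fun i x y hx hy =>
      h.same _ _ (hx.trans hy.symm)⟩

theorem eta_zero (d b : ℕ) (σ : Equiv.Perm (Fin d)) (τ : Fin b → Equiv.Perm (Fin d)) :
    eta d b σ τ 0 = σ := by
  simp [eta]

theorem eta_succ (d b : ℕ) (σ : Equiv.Perm (Fin d)) (τ : Fin b → Equiv.Perm (Fin d)) (s : Fin b) :
    eta d b σ τ (s + 1) = τ s * eta d b σ τ s := by
  rw [eta, eta, List.take_add_one, List.getElem?_ofFn]
  simp [mul_assoc]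

theorem eta_self (d b : ℕ) (σ : Equiv.Perm (Fin d)) (τ : Fin b → Equiv.Perm (Fin d)) :
    eta d b σ τ b = (List.ofFn τ).reverse.prod * σ := by
  rw [eta, List.take_of_length_le (by simp)]

theorem isTransitiveOn_of_lab {d m n : ℕ} {μ : Fin m → ℕ} {ν : Fin n → ℕ} (hG : Generic μ ν)
    {σ ζ : Equiv.Perm (Fin d)} {L : Fin d → Fin m} {M : Fin d → Fin n} (hσ : Lab σ μ L)
    (hζ : Lab ζ ν M) {S : Set (Equiv.Perm (Fin d))} (hS : σ ∈ S) (hS' : ζ ∈ S) :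
    IsTransitiveOn d S := by
  classical
  intro x y
  set H := Subgroup.closure S with hH
  have hsc : ∀ u v, L u = L v → (∃ g ∈ H, g x = u) → ∃ g ∈ H, g x = v := by
    rintro u v huv ⟨g, hg, rfl⟩
    obtain ⟨k, hk⟩ := hσ.same _ _ huv
    exact ⟨σ ^ k * g, H.mul_mem (H.zpow_mem (Subgroup.subset_closure hS) k) hg, hk⟩
  set I := Finset.univ.filter fun i => ∃ u, L u = i ∧ ∃ g ∈ H, g x = u
  have hinv : ∀ z, L z ∈ I → L (ζ z) ∈ I := by
    intro z hz
    obtain ⟨u, hu, hg⟩ := (Finset.mem_filter.1 hz).2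
    obtain ⟨g, hg, rfl⟩ := hsc u z hu hg
    exact Finset.mem_filter.2 ⟨Finset.mem_univ _, _, rfl, ζ * g,
      H.mul_mem (Subgroup.subset_closure hS') hg, rfl⟩
  rcases hG.trivial_of_invariant hσ hζ hinv with h | h
  · exact absurd (Finset.mem_filter.2 ⟨Finset.mem_univ _, x, rfl, 1, H.one_mem, rfl⟩) (h x)
  · obtain ⟨u, hu, hg⟩ := (Finset.mem_filter.1 (h y)).2
    exact hsc u y hu hg

/-- The sequence of partial products of a factorisation. -/
def partialProducts {d m n b : ℕ} (F : FactTuple d m n b) (s : Fin (b + 1)) :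
    Equiv.Perm (Fin d) := eta d b F.1 F.2.2.1 s

theorem partialProducts_succ {d m n b : ℕ} (F : FactTuple d m n b) (s : Fin b) :
    partialProducts F s.succ = F.2.2.1 s * partialProducts F s.castSucc :=
  eta_succ d b F.1 F.2.2.1 s

theorem not_leaf_iff {X κ : Type} {b : ℕ} {η : Fin (b + 1) → Equiv.Perm X} {L : X → κ} {j : κ} :
    ¬ Leaf η L j ↔ ∃ s s', s ≠ s' ∧ Touches η L s j ∧ Touches η L s' j := by
  rw [Leaf]
  push Not
  exact ⟨fun ⟨s, s', h1, h2, h3⟩ => ⟨s, s', h3, h1, h2⟩,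
    fun ⟨s, s', h3, h1, h2⟩ => ⟨s, s', h1, h2, h3⟩⟩

theorem isBiPrunedFactorisation_iff {d m n b : ℕ} {μ : Fin m → ℕ} {ν : Fin n → ℕ}
    (hG : Generic μ ν) (F : FactTuple d m n b) : IsBiPrunedFactorisation d m n b μ ν F ↔
      (LabPath μ ν ∅ ∅ (partialProducts F) F.2.1 F.2.2.2.2 ∧
        (∀ i, ¬ Leaf (fun s => (partialProducts F s)⁻¹) F.2.1 i) ∧
        ∀ j, ¬ Leaf (partialProducts F) F.2.2.2.2 j) ∧
      partialProducts F (Fin.last b) = F.2.2.2.1 := by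
  obtain ⟨σ, L, τ, ζ, M⟩ := F
  have hτ : ∀ s, partialProducts (σ, L, τ, ζ, M) s.succ *
      (partialProducts (σ, L, τ, ζ, M) s.castSucc)⁻¹ = τ s := fun s => by
    rw [partialProducts_succ, mul_inv_cancel_right]
  have h0 : partialProducts (σ, L, τ, ζ, M) 0 = σ := eta_zero d b σ τ
  have hlast : partialProducts (σ, L, τ, ζ, M) (Fin.last b) = (List.ofFn τ).reverse.prod * σ :=
    eta_self d b σ τ
  have ht1 : ∀ s i, Touches (fun s => (partialProducts (σ, L, τ, ζ, M) s)⁻¹) L s i ↔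
      ∃ x, L x = i ∧ τ s x ≠ x := by
    intro s i
    refine exists_congr fun x => and_congr_right fun _ => not_congr ?_
    dsimp only
    rw [partialProducts_succ, mul_inv_rev]
    change (partialProducts (σ, L, τ, ζ, M) s.castSucc)⁻¹ x =
      (partialProducts (σ, L, τ, ζ, M) s.castSucc)⁻¹ ((τ s)⁻¹ x) ↔ _
    rw [(Equiv.injective _).eq_iff, eq_comm, Equiv.Perm.inv_eq_iff_eq, eq_comm]
  have ht2 : ∀ s i, Touches (partialProducts (σ, L, τ, ζ, M)) M s i ↔
      ∃ x, M x = i ∧ invertTau d b σ τ s x ≠ x := by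
    intro s i
    refine exists_congr fun x => and_congr_right fun _ => not_congr ?_
    change eta d b σ τ s x = eta d b σ τ (s + 1) x ↔
      (eta d b σ τ s)⁻¹ (eta d b σ τ (s + 1) x) = x
    rw [Equiv.Perm.inv_eq_iff_eq, eq_comm]
  simp only [not_leaf_iff, ht1, ht2, IsBiPrunedFactorisation, IsFactorisation, isLabeling_iff]
  constructor
  · rintro ⟨⟨hL, hM, hsw, -, hprod⟩, h1, h2⟩
    have h3 := hlast.trans hprod
    refine ⟨⟨⟨?_, ?_, fun s => ?_, by simp, by simp⟩, h1, h2⟩, h3⟩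
    · rw [h0]
      exact hL
    · rw [h3]
      exact hM
    · rw [hτ]
      exact hsw s
  · rintro ⟨⟨hp, h1, h2⟩, h3⟩
    have hL : Lab σ μ L := by
      have := hp.src
      rwa [h0] at this
    have hM : Lab ζ ν M := by
      have := hp.tgt
      rwa [h3] at this
    refine ⟨⟨hL, hM, fun s => ?_, isTransitiveOn_of_lab hG hL hM (by simp) (by simp),
      hlast.symm.trans h3⟩, h1, h2⟩
    have := hp.step s
    rwa [hτ] at this

theorem card_isBiPrunedFactorisation {d m n b : ℕ} {μ : Fin m → ℕ} {ν : Fin n → ℕ}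
    (hG : Generic μ ν) : Nat.card {F : FactTuple d m n b // IsBiPrunedFactorisation d m n b μ ν F} =
      prunedCard (Fin d) b μ ν := by
  refine Nat.card_eq_of_bijective (fun F => ⟨(partialProducts F.1, F.1.2.1, F.1.2.2.2.2),
    ((isBiPrunedFactorisation_iff hG F.1).1 F.2).1⟩) ⟨?_, ?_⟩
  · rintro ⟨F, hF⟩ ⟨F', hF'⟩ heq
    have h1 : partialProducts F = partialProducts F' := congrArg (fun w => w.1.1) heq
    have h2 : F.2.1 = F'.2.1 := congrArg (fun w => w.1.2.1) heq
    have h3 : F.2.2.2.2 = F'.2.2.2.2 := congrArg (fun w => w.1.2.2) heq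
    have h4 := ((isBiPrunedFactorisation_iff hG F).1 hF).2
    have h5 := ((isBiPrunedFactorisation_iff hG F').1 hF').2
    have h6 : F.1 = F'.1 :=
      (eta_zero d b F.1 F.2.2.1).symm.trans ((congrFun h1 0).trans (eta_zero d b F'.1 F'.2.2.1))
    have h7 : F.2.2.1 = F'.2.2.1 := by
      funext s
      have e1 := partialProducts_succ F s
      rw [h1, partialProducts_succ F' s] at e1
      exact (mul_right_cancel e1).symm
    have h8 : F.2.2.2.1 = F'.2.2.2.1 := by rw [← h4, ← h5, h1]
    exact Subtype.ext (Prod.ext h6 (Prod.ext h2 (Prod.ext h7 (Prod.ext h8 h3))))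
  · rintro ⟨⟨η, L, M⟩, h⟩
    let F : FactTuple d m n b := (η 0, L, fun s => η s.succ * (η s.castSucc)⁻¹, η (Fin.last b), M)
    have hF : partialProducts F = η := by
      funext s
      induction s using Fin.induction with
      | zero => exact eta_zero d b _ _
      | succ s ih =>
        rw [partialProducts_succ, ih]
        exact inv_mul_cancel_right _ _
    refine ⟨⟨F, (isBiPrunedFactorisation_iff hG F).2 ⟨?_, ?_⟩⟩, ?_⟩
    · rw [hF]
      exact h
    · rw [hF]
    · exact Subtype.ext (Prod.ext hF rfl)

/-- The chamber of a sign datum. -/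
theorem chamber_of_sign {m n : ℕ} (ε : Finset (Fin m) → Finset (Fin n) → ℤ)
    (hε : ∀ I J, ε I J = 1 ∨ ε I J = -1) :
    Chamber {p : (Fin m → ℕ) × (Fin n → ℕ) | (∀ i, 0 < p.1 i) ∧ (∀ j, 0 < p.2 j) ∧
      ∑ i, p.1 i = ∑ j, p.2 j ∧ ∀ I J, ProperPair m n I J →
        ((∑ i ∈ I, (p.1 i : ℤ)) - ∑ j ∈ J, (p.2 j : ℤ)).sign = ε I J} where
  pos_left p hp := hp.1
  pos_right p hp := hp.2.1
  sum p hp := hp.2.2.1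
  sign I J h0 h1 := by
    rcases hε I J with h | h
    · right
      intro p hp
      have := hp.2.2.2 I J ⟨h0, h1⟩
      rw [h, Int.sign_eq_one_iff_pos] at this
      zify
      omega
    · left
      intro p hp
      have := hp.2.2.2 I J ⟨h0, h1⟩
      rw [h, Int.sign_eq_neg_one_iff_neg] at this
      zify
      omega

end Fermion

/-- piecewise polynomiality of bi-pruned double Hurwitz numbers. For
every chamber datum `ε` there is a polynomial `P` in `m + n` variables of total
degree at most `4g − 3 + m + n` such that for every `(μ,ν)` in the chamber `C_ε`,
`|F^bi(g,μ,ν)| = d! · P(μ₁,…,μ_m,ν₁,…,ν_n)`. -/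
theorem stmt7 (g m n : ℕ) (hm : 1 ≤ m) (hn : 1 ≤ n) (hmn : 3 ≤ m + n)
    (ε : Finset (Fin m) → Finset (Fin n) → ℤ)
    (hε : ∀ I J, ε I J = 1 ∨ ε I J = -1) :
    ∃ P : MvPolynomial (Fin m ⊕ Fin n) ℚ,
      P.totalDegree ≤ 4 * g + m + n - 3 ∧
      ∀ (d : ℕ) (μ : Fin m → ℕ) (ν : Fin n → ℕ),
        1 ≤ d → (∀ i, 0 < μ i) → (∀ j, 0 < ν j) →
        (∑ i, μ i = d) → (∑ j, ν j = d) →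
        (∀ (I : Finset (Fin m)) (J : Finset (Fin n)), ProperPair m n I J →
          ((∑ i ∈ I, (μ i : ℤ)) - ∑ j ∈ J, (ν j : ℤ)) ≠ 0 ∧
          ((∑ i ∈ I, (μ i : ℤ)) - ∑ j ∈ J, (ν j : ℤ)).sign = ε I J) →
        (Nat.card {F : FactTuple d m n (2 * g + m + n - 2) //
            IsBiPrunedFactorisation d m n (2 * g + m + n - 2) μ ν F} : ℚ) =
          (d.factorial : ℚ) *
            MvPolynomial.eval
              (Sum.elim (fun i => (μ i : ℚ)) (fun j => (ν j : ℚ))) P := by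
  have : Nonempty (Fin m) := ⟨⟨0, hm⟩⟩
  obtain ⟨P, hP, hev⟩ := (Fermion.chamber_of_sign ε hε).exists_prunedCard_eq
    (b := 2 * g + m + n - 2) (by simp only [Fintype.card_fin]; omega)
    (by simpa only [Fintype.card_fin] using hmn)
  refine ⟨P, ?_, fun d μ ν _ hμ hν hμd hνd h => ?_⟩
  · simp only [Fintype.card_fin] at hP
    omega
  · have hp : (μ, ν) ∈ {p : (Fin m → ℕ) × (Fin n → ℕ) | (∀ i, 0 < p.1 i) ∧ (∀ j, 0 < p.2 j) ∧
        ∑ i, p.1 i = ∑ j, p.2 j ∧ ∀ I J, ProperPair m n I J →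
          ((∑ i ∈ I, (p.1 i : ℤ)) - ∑ j ∈ J, (p.2 j : ℤ)).sign = ε I J} :=
      ⟨hμ, hν, hμd.trans hνd.symm, fun I J hIJ => (h I J hIJ).2⟩
    have h1 := hev _ hp (Fin d) (by rw [Fintype.card_fin]; exact hμd)
    rw [Fermion.card_isBiPrunedFactorisation ((Fermion.chamber_of_sign ε hε).generic hp), h1,
      Fintype.card_fin]
    rfl
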